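/- (Corollary 1.) Assume additionally (B4) that N/2 is a positive integer, and let λ > 0 and Φ be a function real-analytic on a neighborhood of [0,1] with 𝓛Φ = λΦ on [0,1]; fix Θ₀ ∈ ℝ and set Y₁(t,x) = sin(√λ·t + Θ₀)·Φ(x) and V₁(t,x) = (√λ / J(x,0,0))·cos(√λ·t + Θ₀)·Φ(x). Then for every T > 0 there exist ε₀ > 0 and C > 0 such that for every real ε with |ε| ≤ ε₀ there exist y, v ∈ C^∞([0,T]×[0,1]) satisfying ∂_t y − J(x, y, x∂ₓy)·v = 0 and ∂_t v + H₁(x, y, x∂ₓy, v)·(𝓛y) + H₂(x, y, x∂ₓy, v, x∂ₓv) = 0 on [0,T]×[0,1], with y(0,·) = εY₁(0,·), v(0,·) = εV₁(0,·), and sup_{[0,T]×[0,1]} |y − εY₁| ≤ Cε², sup_{[0,T]×[0,1]} |v − εV₁| ≤ Cε². -/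

import Mathlib

open Set Real Filter

/-- The differential operator 𝓛:
`(𝓛y)(x) = −x(1−x)y''(x) − ((5/2)(1−x) − (N/2)x)y'(x) + ℓ₁(x)·x(1−x)·y'(x) + L₀(x)·y(x)`. -/
noncomputable def opL (N : ℝ) (ℓ₁ L₀ : ℝ → ℝ) (y : ℝ → ℝ) (x : ℝ) : ℝ :=
  -(x * (1 - x)) * deriv (deriv y) x
    - ((5 / 2) * (1 - x) - (N / 2) * x) * deriv y x
    + ℓ₁ x * (x * (1 - x)) * deriv y x
    + L₀ x * y x

/-- `𝓛y` expressed through the values `y`, `η = ∂ₓy`, `ζ = ∂ₓ²y`. -/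
noncomputable def Lfun (N : ℝ) (ℓ₁ L₀ : ℝ → ℝ) (x y η ζ : ℝ) : ℝ :=
  -(x * (1 - x)) * ζ - ((5 / 2) * (1 - x) - (N / 2) * x) * η
    + ℓ₁ x * (x * (1 - x)) * η + L₀ x * y

open scoped BoundedContinuousFunction

/-- The Banach space of absolutely summable sequences of bounded continuous functions of time. -/
def EllOne : Type := lp (fun _ : ℕ => ℝ →ᵇ ℝ) 1

namespace EllOne

noncomputable instance : NormedAddCommGroup EllOne :=
  inferInstanceAs (NormedAddCommGroup (lp (fun _ : ℕ => ℝ →ᵇ ℝ) 1))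

noncomputable instance : NormedSpace ℝ EllOne :=
  inferInstanceAs (NormedSpace ℝ (lp (fun _ : ℕ => ℝ →ᵇ ℝ) 1))

instance : CompleteSpace EllOne :=
  inferInstanceAs (CompleteSpace (lp (fun _ : ℕ => ℝ →ᵇ ℝ) 1))

instance : CoeFun EllOne fun _ => ℕ → (ℝ →ᵇ ℝ) :=
  ⟨fun a => (show lp (fun _ : ℕ => ℝ →ᵇ ℝ) 1 from a).1⟩

@[simp] theorem add_apply (a b : EllOne) (n : ℕ) : (a + b) n = a n + b n := rfl
@[simp] theorem sub_apply (a b : EllOne) (n : ℕ) : (a - b) n = a n - b n := rfl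
@[simp] theorem smul_apply (c : ℝ) (a : EllOne) (n : ℕ) : (c • a) n = c • a n := rfl

theorem summable_norm (a : EllOne) : Summable fun n => ‖a n‖ := by
  have h := (lp.memℓp (E := fun _ : ℕ => ℝ →ᵇ ℝ) (p := 1) a).summable (by norm_num)
  simpa using h

theorem norm_eq (a : EllOne) : ‖a‖ = ∑' n, ‖a n‖ := by
  have h := lp.norm_eq_tsum_rpow (E := fun _ : ℕ => ℝ →ᵇ ℝ) (p := 1) (by norm_num) a
  simp only [ENNReal.toReal_one, Real.rpow_one, div_one] at h
  exact h

/-- The sequence with a single nonzero entry. -/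
noncomputable def single (n : ℕ) (c : ℝ →ᵇ ℝ) : EllOne :=
  lp.single (E := fun _ : ℕ => ℝ →ᵇ ℝ) 1 n c

@[simp] theorem single_self (n : ℕ) (c : ℝ →ᵇ ℝ) : single n c n = c :=
  lp.single_apply_self (E := fun _ : ℕ => ℝ →ᵇ ℝ) 1 n c

theorem single_ne {m n : ℕ} (c : ℝ →ᵇ ℝ) (h : m ≠ n) : single n c m = 0 :=
  lp.single_apply_ne (E := fun _ : ℕ => ℝ →ᵇ ℝ) 1 n c h

theorem norm_single (n : ℕ) (c : ℝ →ᵇ ℝ) : ‖single n c‖ = ‖c‖ := by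
  rw [norm_eq, tsum_eq_single n (fun m hm => by rw [single_ne _ hm, norm_zero]), single_self]

theorem hasSum_single (a : EllOne) : HasSum (fun n => single n (a n)) a :=
  lp.hasSum_single (E := fun _ : ℕ => ℝ →ᵇ ℝ) (p := 1) (by norm_num) a

/-- An absolutely summable sequence as an element of `EllOne`. -/
def mk (f : ℕ → (ℝ →ᵇ ℝ)) (hf : Summable fun n => ‖f n‖) : EllOne :=
  (⟨f, by
    refine memℓp_gen ?_
    simpa using hf⟩ : lp (fun _ : ℕ => ℝ →ᵇ ℝ) 1)

@[simp] theorem mk_apply (f : ℕ → (ℝ →ᵇ ℝ)) (hf : Summable fun n => ‖f n‖) (n : ℕ) :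
    mk f hf n = f n := rfl

/-- The inclusion of the `n`-th coordinate. -/
noncomputable def singleCLM (n : ℕ) : (ℝ →ᵇ ℝ) →L[ℝ] EllOne :=
  LinearMap.mkContinuous
    { toFun := fun c => single n c
      map_add' := fun a b => lp.single_add (E := fun _ : ℕ => ℝ →ᵇ ℝ) 1 n a b
      map_smul' := fun c a => lp.single_smul (E := fun _ : ℕ => ℝ →ᵇ ℝ) 1 n c a } 1
    (fun c => by rw [one_mul]; exact (norm_single n c).le)

theorem singleCLM_apply (n : ℕ) (c : ℝ →ᵇ ℝ) : singleCLM n c = single n c := rfl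

section lift

variable {F : Type*} [NormedAddCommGroup F] [NormedSpace ℝ F]
    (L : ℕ → (ℝ →ᵇ ℝ) →L[ℝ] F) (C : ℝ) (h : ∀ n c, ‖L n c‖ ≤ C * ‖c‖)

theorem summable_norm_lift (h : ∀ n c, ‖L n c‖ ≤ C * ‖c‖) (a : EllOne) : Summable fun n => ‖L n (a n)‖ :=
  Summable.of_nonneg_of_le (fun _ => norm_nonneg _) (fun n => h n _) ((summable_norm a).mul_left C)

variable [CompleteSpace F]

/-- The bounded linear map on `EllOne` determined by a bounded family of maps on the entries. -/
noncomputable def lift : EllOne →L[ℝ] F :=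
  LinearMap.mkContinuous
    { toFun := fun a => ∑' n, L n (a n)
      map_add' := fun a b => by
        rw [← ((summable_norm_lift L C h a).of_norm).tsum_add
          ((summable_norm_lift L C h b).of_norm)]
        simp
      map_smul' := fun c a => by
        rw [RingHom.id_apply, ← ((summable_norm_lift L C h a).of_norm).tsum_const_smul c]
        simp } C
    (fun a => by
      have h2 : ‖∑' n, L n (a n)‖ ≤ ∑' n, C * ‖a n‖ :=
        tsum_of_norm_bounded ((summable_norm a).mul_left C).hasSum (fun n => h n _)
      rw [tsum_mul_left, ← norm_eq] at h2
      exact h2)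

theorem hasSum_lift (a : EllOne) : HasSum (fun n => L n (a n)) (lift L C h a) :=
  (summable_norm_lift L C h a).of_norm.hasSum

theorem norm_lift_le (a : EllOne) : ‖lift L C h a‖ ≤ C * ‖a‖ := by
  rw [norm_eq, ← tsum_mul_left]
  rw [← (hasSum_lift L C h a).tsum_eq]
  exact tsum_of_norm_bounded ((summable_norm a).mul_left C).hasSum (fun n => h n _)

end lift

end EllOne

/-- The value at `z` of the `n`-th Chebyshev polynomial of the first kind. -/
noncomputable def chebT (n : ℕ) (z : ℝ) : ℝ := (Polynomial.Chebyshev.T ℝ n).eval z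

theorem two_mul_chebT_mul_chebT (m n : ℕ) (z : ℝ) :
    2 * (chebT m z * chebT n z) = chebT (m + n) z + chebT (Nat.dist m n) z := by
  have h := congrArg (Polynomial.eval z) (Polynomial.Chebyshev.T_mul_T ℝ (m : ℤ) (n : ℤ))
  have hd : Polynomial.Chebyshev.T ℝ ((m : ℤ) - n) = Polynomial.Chebyshev.T ℝ (Nat.dist m n) := by
    rw [← Polynomial.Chebyshev.T_natAbs]
    congr 2
    unfold Nat.dist
    omega
  rw [hd] at h
  simp only [Polynomial.eval_mul, Polynomial.eval_add, Polynomial.eval_ofNat] at h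
  unfold chebT
  push_cast
  linarith

/-- A family of positive continuous time-dependent weights, one for each frequency. -/
structure Wt where
  /-- the underlying functions -/
  toFun : ℕ → ℝ → ℝ
  cont : ∀ n, Continuous (toFun n)
  pos : ∀ n t, 0 < toFun n t

instance : CoeFun Wt fun _ => ℕ → ℝ → ℝ := ⟨Wt.toFun⟩

/-- The weights `w` are small enough for evaluation at `z` to be bounded. -/
def EvBound (w : Wt) (z : ℝ) : Prop := ∀ n t, w n t * |chebT n z| ≤ 1

/-- The value at time `t` and at the point `z` of the Chebyshev series encoded by `a`. -/
noncomputable def ev (w : Wt) (t z : ℝ) (a : EllOne) : ℝ := ∑' n, w n t * a n t * chebT n z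

namespace EllOne

theorem norm_evTerm_le {w : Wt} {t z : ℝ} (h : EvBound w z) (n : ℕ) (c : ℝ →ᵇ ℝ) :
    ‖((w n t * chebT n z) • (BoundedContinuousFunction.evalCLM ℝ t : (ℝ →ᵇ ℝ) →L[ℝ] ℝ)) c‖
      ≤ 1 * ‖c‖ := by
  have h2 := h n t
  simp only [_root_.smul_apply, BoundedContinuousFunction.evalCLM_apply, smul_eq_mul,
    norm_mul, Real.norm_eq_abs]
  rw [abs_of_pos (w.pos n t)]
  exact mul_le_mul h2 (c.norm_coe_le_norm t) (abs_nonneg _) zero_le_one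

/-- Evaluation as a bounded linear functional. -/
noncomputable def evCLM (w : Wt) (t z : ℝ) (h : EvBound w z) : EllOne →L[ℝ] ℝ :=
  lift (fun n => (w n t * chebT n z) • BoundedContinuousFunction.evalCLM ℝ t) 1
    (norm_evTerm_le h)

theorem hasSum_evCLM {w : Wt} {t z : ℝ} (h : EvBound w z) (a : EllOne) :
    HasSum (fun n => w n t * a n t * chebT n z) (evCLM w t z h a) := by
  have := hasSum_lift _ 1 (norm_evTerm_le (t := t) h) a
  refine this.congr_fun ?_ 
  intro n
  simp [mul_right_comm]

theorem evCLM_apply {w : Wt} {t z : ℝ} (h : EvBound w z) (a : EllOne) :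
    evCLM w t z h a = ev w t z a := (hasSum_evCLM h a).tsum_eq.symm

theorem hasSum_ev {w : Wt} {t z : ℝ} (h : EvBound w z) (a : EllOne) :
    HasSum (fun n => w n t * a n t * chebT n z) (ev w t z a) := by
  rw [← evCLM_apply h]; exact hasSum_evCLM h a

theorem abs_ev_le {w : Wt} {t z : ℝ} (h : EvBound w z) (a : EllOne) : |ev w t z a| ≤ ‖a‖ := by
  rw [← evCLM_apply h, ← Real.norm_eq_abs]
  have := norm_lift_le _ 1 (norm_evTerm_le (t := t) h) a
  rwa [one_mul] at this

theorem ev_single {w : Wt} {t z : ℝ} (n : ℕ) (c : ℝ →ᵇ ℝ) :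
    ev w t z (single n c) = w n t * c t * chebT n z := by
  unfold ev
  rw [tsum_eq_single n (fun m hm => by rw [single_ne _ hm]; simp), single_self]

theorem ev_add {w : Wt} {t z : ℝ} (h : EvBound w z) (a b : EllOne) :
    ev w t z (a + b) = ev w t z a + ev w t z b := by
  simp only [← evCLM_apply h, map_add]

theorem ev_sub {w : Wt} {t z : ℝ} (h : EvBound w z) (a b : EllOne) :
    ev w t z (a - b) = ev w t z a - ev w t z b := by
  simp only [← evCLM_apply h, map_sub]

theorem ev_smul {w : Wt} {t z : ℝ} (h : EvBound w z) (c : ℝ) (a : EllOne) :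
    ev w t z (c • a) = c * ev w t z a := by
  simp only [← evCLM_apply h, map_smul, smul_eq_mul]

/-- Multiplication by a fixed bounded continuous function. -/
noncomputable def mulB (c : ℝ →ᵇ ℝ) : (ℝ →ᵇ ℝ) →L[ℝ] (ℝ →ᵇ ℝ) := ContinuousLinearMap.mul ℝ _ c

/-- A bounded multiple of the quotient of two weights. -/
noncomputable def quot (w w' : Wt) (d : ℝ) (n k : ℕ) (e : ℝ)
    (h : ∀ t, |d| * w n t ≤ e * w' k t) : ℝ →ᵇ ℝ :=
  BoundedContinuousFunction.ofNormedAddCommGroup (fun t => d * w n t / w' k t)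
    ((continuous_const.mul (w.cont n)).div (w'.cont k) (fun t => (w'.pos k t).ne')) e
    (fun t => by
      rw [Real.norm_eq_abs, abs_div, abs_mul, abs_of_pos (w.pos n t), abs_of_pos (w'.pos k t),
        div_le_iff₀ (w'.pos k t)]
      exact h t)

theorem quot_apply (w w' : Wt) (d : ℝ) (n k : ℕ) (e : ℝ)
    (h : ∀ t, |d| * w n t ≤ e * w' k t) (t : ℝ) :
    quot w w' d n k e h t = d * w n t / w' k t := rfl

theorem norm_quot_le (w w' : Wt) (d : ℝ) (n k : ℕ) (e : ℝ)
    (h : ∀ t, |d| * w n t ≤ e * w' k t) : ‖quot w w' d n k e h‖ ≤ e := by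
  refine BoundedContinuousFunction.norm_ofNormedAddCommGroup_le _ ?_ _
  have h0 := h 0
  have h1 : 0 ≤ |d| * w n 0 := mul_nonneg (abs_nonneg _) (w.pos n 0).le
  by_contra hc
  push Not at hc
  nlinarith [w'.pos k 0]

theorem norm_matTerm_le {w w' : Wt} {d e : ℕ → ℕ → ℝ} {C : ℝ}
    (h : ∀ n k t, |d n k| * w n t ≤ e n k * w' k t)
    (hC : ∀ n, ∑ k ∈ Finset.range (n + 1), e n k ≤ C) (n : ℕ) (c : ℝ →ᵇ ℝ) :
    ‖(∑ k ∈ Finset.range (n + 1),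
      (singleCLM k).comp (mulB (quot w w' (d n k) n k (e n k) (h n k)))) c‖ ≤ C * ‖c‖ := by
  rw [_root_.sum_apply]
  refine (norm_sum_le _ _).trans ?_
  refine le_trans ?_ (mul_le_mul_of_nonneg_right (hC n) (norm_nonneg c))
  rw [Finset.sum_mul]
  refine Finset.sum_le_sum fun k _ => ?_
  rw [ContinuousLinearMap.comp_apply, singleCLM_apply, norm_single]
  exact (norm_mul_le _ _).trans
    (mul_le_mul_of_nonneg_right (norm_quot_le _ _ _ _ _ _ _) (norm_nonneg _))

/-- The map sending `T n` to `∑ k ≤ n, d n k • T k` on Chebyshev series, between two weights. -/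
noncomputable def matOp (w w' : Wt) (d e : ℕ → ℕ → ℝ) (C : ℝ)
    (h : ∀ n k t, |d n k| * w n t ≤ e n k * w' k t)
    (hC : ∀ n, ∑ k ∈ Finset.range (n + 1), e n k ≤ C) : EllOne →L[ℝ] EllOne :=
  lift (fun n => ∑ k ∈ Finset.range (n + 1),
    (singleCLM k).comp (mulB (quot w w' (d n k) n k (e n k) (h n k)))) C (norm_matTerm_le h hC)

section matOp

variable {w w' : Wt} {d e : ℕ → ℕ → ℝ} {C : ℝ}
    (h : ∀ n k t, |d n k| * w n t ≤ e n k * w' k t)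
    (hC : ∀ n, ∑ k ∈ Finset.range (n + 1), e n k ≤ C)

theorem norm_matOp_le (a : EllOne) : ‖matOp w w' d e C h hC a‖ ≤ C * ‖a‖ := norm_lift_le _ _ _ a

theorem hasSum_ev_matOp {t z : ℝ} (hw : EvBound w' z) (a : EllOne) :
    HasSum (fun n => w n t * a n t * ∑ k ∈ Finset.range (n + 1), d n k * chebT k z)
      (ev w' t z (matOp w w' d e C h hC a)) := by
  rw [← evCLM_apply hw]
  have h1 := (hasSum_lift _ C (norm_matTerm_le h hC) a).mapL (evCLM w' t z hw)
  refine h1.congr_fun fun n => ?_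
  simp only [_root_.sum_apply, map_sum, ContinuousLinearMap.comp_apply,
    singleCLM_apply, evCLM_apply, ev_single, mulB, ContinuousLinearMap.mul_apply']
  rw [Finset.mul_sum]
  refine Finset.sum_congr rfl fun k _ => ?_
  have := (w'.pos k t).ne'
  rw [BoundedContinuousFunction.coe_mul, Pi.mul_apply, quot_apply]
  field_simp

end matOp

end EllOne

/-- Products of series with the first two weights are series with the third weights. -/
def MulOK (w w' w'' : Wt) : Prop :=
  ∀ m n t, w m t * w' n t ≤ w'' (m + n) t ∧ w m t * w' n t ≤ w'' (Nat.dist m n) t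

namespace EllOne

/-- The bounded function given by half the quotient of the product of two weights by a third. -/
noncomputable def quot₂ (w w' w'' : Wt) (m n k : ℕ) (h : ∀ t, w m t * w' n t ≤ w'' k t) : ℝ →ᵇ ℝ :=
  BoundedContinuousFunction.ofNormedAddCommGroup (fun t => w m t * w' n t / (2 * w'' k t))
    (((w.cont m).mul (w'.cont n)).div (continuous_const.mul (w''.cont k))
      (fun t => (mul_pos two_pos (w''.pos k t)).ne')) (1 / 2)
    (fun t => by
      have := w''.pos k t
      have h1 := mul_pos (w.pos m t) (w'.pos n t)
      rw [Real.norm_eq_abs, abs_of_pos (by positivity), div_le_div_iff₀ (by positivity) two_pos]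
      linarith [h t])

theorem quot₂_apply (w w' w'' : Wt) (m n k : ℕ) (h : ∀ t, w m t * w' n t ≤ w'' k t) (t : ℝ) :
    quot₂ w w' w'' m n k h t = w m t * w' n t / (2 * w'' k t) := rfl

variable {w w' w'' : Wt} (H : MulOK w w' w'')

theorem norm_quot₂_le (w w' w'' : Wt) (m n k : ℕ) (h : ∀ t, w m t * w' n t ≤ w'' k t) :
    ‖quot₂ w w' w'' m n k h‖ ≤ 1 / 2 :=
  BoundedContinuousFunction.norm_ofNormedAddCommGroup_le _ (by norm_num) _

/-- One term of the product of two Chebyshev series. -/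
noncomputable def mulTerm (a b : EllOne) (p : ℕ × ℕ) : EllOne :=
  singleCLM (p.1 + p.2) (quot₂ w w' w'' p.1 p.2 _ (fun t => (H p.1 p.2 t).1) * (a p.1 * b p.2))
    + singleCLM (Nat.dist p.1 p.2)
      (quot₂ w w' w'' p.1 p.2 _ (fun t => (H p.1 p.2 t).2) * (a p.1 * b p.2))

theorem norm_mulTerm_le (a b : EllOne) (p : ℕ × ℕ) :
    ‖mulTerm H a b p‖ ≤ ‖a p.1‖ * ‖b p.2‖ := by
  refine (norm_add_le _ _).trans ?_
  have key : ∀ (k : ℕ) (h : ∀ t, w p.1 t * w' p.2 t ≤ w'' k t),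
      ‖singleCLM k (quot₂ w w' w'' p.1 p.2 k h * (a p.1 * b p.2))‖
        ≤ 1 / 2 * (‖a p.1‖ * ‖b p.2‖) := fun k h => by
    rw [singleCLM_apply, norm_single]
    exact (norm_mul_le _ _).trans (mul_le_mul (norm_quot₂_le _ _ _ _ _ _ _) (norm_mul_le _ _)
      (norm_nonneg _) (by norm_num))
  have h1 := key _ (fun t => (H p.1 p.2 t).1)
  have h2 := key _ (fun t => (H p.1 p.2 t).2)
  linarith

theorem summable_norm_mul (a b : EllOne) : Summable fun p : ℕ × ℕ => ‖a p.1‖ * ‖b p.2‖ :=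
  (summable_norm a).mul_of_nonneg (summable_norm b) (fun _ => norm_nonneg _) (fun _ => norm_nonneg _)

theorem summable_mulTerm (a b : EllOne) : Summable (mulTerm H a b) :=
  (Summable.of_nonneg_of_le (fun _ => norm_nonneg _) (norm_mulTerm_le H a b)
    (summable_norm_mul a b)).of_norm

/-- The product of Chebyshev series, as a bilinear map. -/
noncomputable def mulAux : EllOne →ₗ[ℝ] EllOne →ₗ[ℝ] EllOne :=
  LinearMap.mk₂ ℝ (fun a b => ∑' p, mulTerm H a b p)
    (fun a a' b => by
      rw [← (summable_mulTerm H a b).tsum_add (summable_mulTerm H a' b)]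
      refine tsum_congr fun p => ?_
      simp only [mulTerm, add_apply, add_mul, mul_add, map_add]
      abel)
    (fun c a b => by
      rw [← (summable_mulTerm H a b).tsum_const_smul c]
      refine tsum_congr fun p => ?_
      simp only [mulTerm, smul_apply, smul_mul_assoc, mul_smul_comm, map_smul, smul_add])
    (fun a b b' => by
      rw [← (summable_mulTerm H a b).tsum_add (summable_mulTerm H a b')]
      refine tsum_congr fun p => ?_
      simp only [mulTerm, add_apply, mul_add, map_add]
      abel)
    (fun c a b => by
      rw [← (summable_mulTerm H a b).tsum_const_smul c]
      refine tsum_congr fun p => ?_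
      simp only [mulTerm, smul_apply, mul_smul_comm, map_smul, smul_add])

theorem norm_mulAux_le (a b : EllOne) : ‖mulAux H a b‖ ≤ 1 * ‖a‖ * ‖b‖ := by
  rw [one_mul, norm_eq a, norm_eq b,
    (summable_norm a).tsum_mul_tsum (summable_norm b) (summable_norm_mul a b)]
  exact tsum_of_norm_bounded (summable_norm_mul a b).hasSum (norm_mulTerm_le H a b)

/-- The product of Chebyshev series. -/
noncomputable def mul : EllOne →L[ℝ] EllOne →L[ℝ] EllOne :=
  LinearMap.mkContinuous₂ (mulAux H) 1 (norm_mulAux_le H)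

theorem hasSum_mul (a b : EllOne) : HasSum (mulTerm H a b) (mul H a b) :=
  (summable_mulTerm H a b).hasSum

theorem norm_mul_le' (a b : EllOne) : ‖mul H a b‖ ≤ ‖a‖ * ‖b‖ := by
  have h := norm_mulAux_le H a b
  rwa [one_mul] at h

theorem ev_mul {t z : ℝ} (hw : EvBound w z) (hw' : EvBound w' z) (hw'' : EvBound w'' z)
    (a b : EllOne) : ev w'' t z (mul H a b) = ev w t z a * ev w' t z b := by
  have h1 := (hasSum_mul H a b).mapL (evCLM w'' t z hw'')
  rw [evCLM_apply] at h1
  have ha := hasSum_ev (t := t) hw a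
  have hb := hasSum_ev (t := t) hw' b
  have h2 := ha.mul hb (summable_mul_of_summable_norm ha.summable.norm hb.summable.norm)
  refine h1.unique ?_
  refine h2.congr_fun fun p => ?_
  have h3 := two_mul_chebT_mul_chebT p.1 p.2 z
  have h4 := (w''.pos (p.1 + p.2) t).ne'
  have h5 := (w''.pos (Nat.dist p.1 p.2) t).ne'
  simp only [mulTerm, map_add, evCLM_apply, singleCLM_apply, ev_single,
    BoundedContinuousFunction.coe_mul, Pi.mul_apply, quot₂_apply]
  field_simp
  linear_combination (-(w p.1 t * w' p.2 t * a p.1 t * b p.2 t)) * h3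

end EllOne

section AnalyticBounds

open scoped NNReal ENNReal

variable {E : Type*} [NormedAddCommGroup E] [NormedSpace ℝ E]

theorem HasFPowerSeriesOnBall.norm_iteratedFDeriv_le_factorial {G : E → ℝ}
    {p : FormalMultilinearSeries ℝ E ℝ} {c : E} {r : ℝ≥0∞} (h : HasFPowerSeriesOnBall G p c r)
    (m : ℕ) : ‖iteratedFDeriv ℝ m G c‖ ≤ m.factorial * ‖p m‖ := by
  refine ContinuousMultilinearMap.opNorm_le_bound (by positivity) fun v => ?_
  rw [h.iteratedFDeriv_eq_sum_of_completeSpace v]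
  refine (norm_sum_le _ _).trans ?_
  have : ∀ σ ∈ (Finset.univ : Finset (Equiv.Perm (Fin m))),
      ‖p m (fun i => v (σ i))‖ ≤ ‖p m‖ * ∏ i, ‖v i‖ := fun σ _ => by
    refine ((p m).le_opNorm _).trans (le_of_eq ?_)
    rw [Equiv.prod_comp σ (fun i => ‖v i‖)]
  refine (Finset.sum_le_sum this).trans (le_of_eq ?_)
  rw [Finset.sum_const, Finset.card_univ, Fintype.card_perm, Fintype.card_fin, nsmul_eq_mul]
  ring

theorem FormalMultilinearSeries.exists_norm_changeOrigin_le (p : FormalMultilinearSeries ℝ E ℝ)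
    {r r' : ℝ≥0} (hr : (r + r' : ℝ≥0∞) < p.radius) (hr' : 0 < r') :
    ∃ S : ℝ≥0, ∀ y : E, ‖y‖₊ ≤ r → ∀ k, ‖p.changeOrigin y k‖₊ ≤ S * (r' ^ k)⁻¹ := by
  have hs := p.changeOriginSeries_summable_aux₁ hr
  refine ⟨∑' (k : ℕ) (s : Σ l : ℕ, { s : Finset (Fin (k + l)) // s.card = l }),
    ‖p (k + s.1)‖₊ * r ^ s.1 * r' ^ k, fun y hy k => ?_⟩
  have hlt : (r : ℝ≥0∞) < p.radius := lt_of_le_of_lt le_self_add hr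
  have hyr : (‖y‖₊ : ℝ≥0∞) < p.radius := lt_of_le_of_lt (by exact_mod_cast hy) hlt
  refine (p.nnnorm_changeOrigin_le k hyr).trans ?_
  rw [← div_eq_mul_inv, le_div_iff₀ (pow_pos hr' k), ← NNReal.tsum_mul_right]
  have h1 := (NNReal.summable_sigma.1 hs).1 k
  have h2 := (NNReal.summable_sigma.1 hs).2
  calc _ ≤ ∑' s : Σ l : ℕ, { s : Finset (Fin (k + l)) // s.card = l },
        ‖p (k + s.1)‖₊ * r ^ s.1 * r' ^ k := by
        refine Summable.tsum_le_tsum (fun s => ?_) ?_ h1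
        · gcongr
        · refine NNReal.summable_of_le (fun s => ?_) h1
          gcongr
    _ ≤ _ := h2.le_tsum k (fun _ _ => zero_le)

/-- Uniform Cauchy estimates and Taylor expansions along a compact set. -/
theorem IsCompact.exists_uniform_taylor {G : E → ℝ} {K : Set E} (hK : IsCompact K)
    (hG : ∀ x ∈ K, AnalyticAt ℝ G x) :
    ∃ C A δ : ℝ, 0 < C ∧ 0 < A ∧ 0 < δ ∧ ∀ x ∈ K,
      (∀ m, ‖iteratedFDeriv ℝ m G x‖ ≤ C * A ^ m * m.factorial) ∧
      ∀ Z, ‖Z‖ < δ → HasSum (fun m : ℕ => ((m.factorial : ℝ))⁻¹ •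
        iteratedFDeriv ℝ m G x (fun _ => Z)) (G (x + Z)) := by
  refine hK.induction_on (p := fun K => ∃ C A δ : ℝ, 0 < C ∧ 0 < A ∧ 0 < δ ∧ ∀ x ∈ K,
      (∀ m, ‖iteratedFDeriv ℝ m G x‖ ≤ C * A ^ m * m.factorial) ∧
      ∀ Z, ‖Z‖ < δ → HasSum (fun m : ℕ => ((m.factorial : ℝ))⁻¹ •
        iteratedFDeriv ℝ m G x (fun _ => Z)) (G (x + Z)))
    ⟨1, 1, 1, one_pos, one_pos, one_pos, by simp⟩ ?_ ?_ ?_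
  · rintro s t hst ⟨C, A, δ, hC, hA, hδ, h⟩
    exact ⟨C, A, δ, hC, hA, hδ, fun x hx => h x (hst hx)⟩
  · rintro s t ⟨C, A, δ, hC, hA, hδ, h⟩ ⟨C', A', δ', hC', hA', hδ', h'⟩
    refine ⟨max C C', max A A', min δ δ', lt_max_of_lt_left hC, lt_max_of_lt_left hA,
      lt_min hδ hδ', ?_⟩
    rintro x (hx | hx)
    · refine ⟨fun m => ((h x hx).1 m).trans ?_,
        fun Z hZ => (h x hx).2 Z (hZ.trans_le (min_le_left _ _))⟩
      gcongr <;> exact le_max_left _ _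
    · refine ⟨fun m => ((h' x hx).1 m).trans ?_,
        fun Z hZ => (h' x hx).2 Z (hZ.trans_le (min_le_right _ _))⟩
      gcongr <;> exact le_max_right _ _
  · intro c hc
    obtain ⟨p, R, hp⟩ := hG c hc
    obtain ⟨ρ, hρ0, hρR⟩ := ENNReal.lt_iff_exists_nnreal_btwn.1 hp.r_pos
    have hρ0' : 0 < ρ := by exact_mod_cast hρ0
    set r : ℝ≥0 := ρ / 2 with hr
    have hr0 : 0 < r := half_pos hρ0'
    have hrr : ((r + r : ℝ≥0) : ℝ≥0∞) = ρ := by rw [hr, add_halves]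
    have hlt : (r + r : ℝ≥0∞) < p.radius := by
      refine lt_of_lt_of_le ?_ hp.r_le
      rw [← ENNReal.coe_add, hrr]; exact hρR
    obtain ⟨S, hS⟩ := p.exists_norm_changeOrigin_le hlt hr0
    refine ⟨Metric.ball c r, mem_nhdsWithin_of_mem_nhds (Metric.ball_mem_nhds c hr0),
      S + 1, (r : ℝ)⁻¹, r, by positivity, by positivity, by positivity, fun x hx => ?_⟩
    have hy : ‖x - c‖₊ < r := by
      rw [← NNReal.coe_lt_coe, coe_nnnorm, ← dist_eq_norm]; exact hx
    have hyR : (‖x - c‖₊ : ℝ≥0∞) < R := by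
      refine lt_trans ?_ hρR
      rw [← hrr]
      exact_mod_cast hy.trans (lt_add_of_pos_left _ hr0)
    have hq := hp.changeOrigin hyR
    rw [add_sub_cancel] at hq
    refine ⟨fun m => ?_, fun Z hZ => ?_⟩
    · refine (hq.norm_iteratedFDeriv_le_factorial m).trans ?_
      have h1 : ‖p.changeOrigin (x - c) m‖ ≤ S * ((r : ℝ) ^ m)⁻¹ := by
        exact_mod_cast hS _ hy.le m
      rw [mul_comm]
      gcongr
      refine h1.trans ?_
      rw [inv_pow]
      gcongr
      linarith
    · refine hq.hasSum_iteratedFDeriv ?_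
      rw [mem_eball_zero_iff]
      have hZ' : ‖Z‖₊ < r := by rw [← NNReal.coe_lt_coe]; exact hZ
      rw [enorm_eq_nnnorm, lt_tsub_iff_right]
      refine lt_trans ?_ hρR
      rw [← hrr]
      exact_mod_cast add_lt_add hZ' hy

end AnalyticBounds

section Fourier

open scoped NNReal ENNReal

theorem norm_fourierCoeffOn_le {a b : ℝ} (hab : a < b) {f : ℝ → ℂ} {C : ℝ}
    (hf : ∀ x ∈ Icc a b, ‖f x‖ ≤ C) (n : ℤ) : ‖fourierCoeffOn hab f n‖ ≤ C := by
  have hpos : 0 < b - a := sub_pos.2 hab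
  rw [fourierCoeffOn_eq_integral, norm_smul, Real.norm_eq_abs,
    abs_of_pos (one_div_pos.2 hpos), one_div, inv_mul_le_iff₀ hpos]
  have := intervalIntegral.norm_integral_le_of_norm_le_const (a := a) (b := b) (C := C)
    (f := fun x => fourier (-n) (x : AddCircle (b - a)) • f x) (fun x hx => by
      rw [uIoc_of_le hab.le] at hx
      have : ‖(fourier (-n) (x : AddCircle (b - a)) : ℂ)‖ = 1 := by
        rw [fourier_apply]; exact Circle.norm_coe _
      rw [norm_smul, this, one_mul]
      exact hf x (Ioc_subset_Icc_self hx))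
  rwa [abs_of_pos hpos, mul_comm] at this

/-- Fourier coefficients of a function with Cauchy estimates on its derivatives decay
exponentially. -/
theorem norm_fourierCoeffOn_le_exp {u : ℕ → ℝ → ℝ} {C A : ℝ} (hA : 0 < A)
    (hu : ∀ l φ, HasDerivAt (u l) (u (l + 1) φ) φ) (hper : ∀ l, u l (2 * π) = u l 0)
    (hb : ∀ l, ∀ φ ∈ Icc 0 (2 * π), |u l φ| ≤ C * A ^ l * l.factorial) (n : ℤ) :
    ‖fourierCoeffOn Real.two_pi_pos (fun φ => (u 0 φ : ℂ)) n‖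
      ≤ 2 * C * Real.exp (-(1 / (2 * A))) ^ n.natAbs := by
  have hbound : ∀ l, ‖fourierCoeffOn Real.two_pi_pos (fun φ => (u l φ : ℂ)) n‖
      ≤ C * A ^ l * l.factorial := fun l =>
    norm_fourierCoeffOn_le _ (fun φ hφ => by
      rw [Complex.norm_real]; exact hb l φ hφ) n
  have hstep : ∀ l, (n.natAbs : ℝ) * ‖fourierCoeffOn Real.two_pi_pos (fun φ => (u l φ : ℂ)) n‖
      ≤ ‖fourierCoeffOn Real.two_pi_pos (fun φ => (u (l + 1) φ : ℂ)) n‖ := by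
    intro l
    rcases eq_or_ne n 0 with rfl | hn
    · simp
    have hc : Continuous (u (l + 1)) :=
      continuous_iff_continuousAt.2 fun x => (hu (l + 1) x).continuousAt
    rw [fourierCoeffOn_of_hasDerivAt Real.two_pi_pos hn
      (fun x _ => (hu l x).ofReal_comp)
      ((Complex.continuous_ofReal.comp hc).intervalIntegrable _ _)]
    rw [hper l, sub_self, mul_zero, zero_sub, norm_mul, norm_neg, norm_mul]
    have h1 : ‖((2 * π : ℝ) : ℂ) - ((0 : ℝ) : ℂ)‖ = 2 * π := by
      rw [Complex.ofReal_zero, sub_zero, Complex.norm_real, Real.norm_eq_abs,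
        abs_of_pos Real.two_pi_pos]
    have h2 : ‖(1 : ℂ) / (-2 * (π : ℂ) * Complex.I * n)‖ = 1 / (2 * π * n.natAbs) := by
      simp [Complex.norm_intCast, abs_of_pos Real.pi_pos, Nat.cast_natAbs]
    rw [h1, h2]
    have hn' : (n.natAbs : ℝ) ≠ 0 := by
      exact_mod_cast Int.natAbs_ne_zero.2 hn
    have := Real.pi_pos.ne'
    apply le_of_eq
    field_simp
  have hpow : ∀ l, (n.natAbs : ℝ) ^ l * ‖fourierCoeffOn Real.two_pi_pos (fun φ => (u 0 φ : ℂ)) n‖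
      ≤ ‖fourierCoeffOn Real.two_pi_pos (fun φ => (u l φ : ℂ)) n‖ := by
    intro l
    induction l with
    | zero => simp
    | succ l ih =>
      refine le_trans ?_ (hstep l)
      rw [pow_succ', mul_assoc]
      gcongr
  set a := ‖fourierCoeffOn Real.two_pi_pos (fun φ => (u 0 φ : ℂ)) n‖ with ha
  have hs1 : HasSum (fun l : ℕ => ((n.natAbs : ℝ) / (2 * A)) ^ l / l.factorial * a)
      (Real.exp ((n.natAbs : ℝ) / (2 * A)) * a) := by
    rw [Real.exp_eq_exp_ℝ]
    exact (NormedSpace.expSeries_div_hasSum_exp ((n.natAbs : ℝ) / (2 * A))).mul_right a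
  have hs2 : HasSum (fun l : ℕ => C * (1 / 2 : ℝ) ^ l) (C * 2) := hasSum_geometric_two.mul_left C
  have hle := hasSum_le (fun l => by
    have h := (hpow l).trans (hbound l)
    have hf : (0 : ℝ) < l.factorial := by positivity
    rw [div_pow, mul_pow, one_div, inv_pow, div_div, div_mul_eq_mul_div, div_le_iff₀ (by positivity)]
    calc _ ≤ _ := h
      _ = _ := by field_simp) hs1 hs2
  have he : Real.exp (-(1 / (2 * A))) ^ n.natAbs * Real.exp ((n.natAbs : ℝ) / (2 * A)) = 1 := by
    rw [← Real.exp_nat_mul, ← Real.exp_add]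
    convert Real.exp_zero using 2
    ring
  have hp : 0 < Real.exp (-(1 / (2 * A))) ^ n.natAbs := by positivity
  calc a = Real.exp (-(1 / (2 * A))) ^ n.natAbs * (Real.exp ((n.natAbs : ℝ) / (2 * A)) * a) := by
        rw [← mul_assoc, he, one_mul]
    _ ≤ Real.exp (-(1 / (2 * A))) ^ n.natAbs * (C * 2) := by gcongr
    _ = _ := by ring

/-- Exponentially convergent cosine series of an even periodic function with Cauchy estimates. -/
theorem exists_cos_series {A : ℝ} (hA : 0 < A) {u : ℕ → ℝ → ℝ} {C : ℝ}
    (hu : ∀ l φ, HasDerivAt (u l) (u (l + 1) φ) φ) (hper : ∀ l, Function.Periodic (u l) (2 * π))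
    (heven : ∀ φ, u 0 (-φ) = u 0 φ)
    (hb : ∀ l, ∀ φ ∈ Icc 0 (2 * π), |u l φ| ≤ C * A ^ l * l.factorial) :
    ∃ c : ℕ → ℝ, (∀ n, |c n| ≤ 6 * C * Real.exp (-(1 / (2 * A))) ^ n) ∧
      ∀ φ, HasSum (fun n => c n * Real.cos (n * φ)) (u 0 φ) := by
  have : Fact (0 < 2 * π - 0) := ⟨by simpa using Real.pi_pos⟩
  set q := Real.exp (-(1 / (2 * A))) with hq
  have hq0 : 0 < q := Real.exp_pos _
  have hq1 : q < 1 := by rw [hq, Real.exp_lt_one_iff, neg_lt_zero]; positivity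
  set a : ℤ → ℂ := fourierCoeffOn Real.two_pi_pos (fun φ => (u 0 φ : ℂ)) with ha
  have hab : ∀ n, ‖a n‖ ≤ 2 * C * q ^ n.natAbs :=
    norm_fourierCoeffOn_le_exp hA hu (fun l => by simpa using hper l 0) hb
  have hper' : Function.Periodic (fun φ => (u 0 φ : ℂ)) (2 * π - 0) := fun φ => by
    simp only [sub_zero]; rw [hper 0 φ]
  have hcont : Continuous (fun φ => (u 0 φ : ℂ)) :=
    Complex.continuous_ofReal.comp (continuous_iff_continuousAt.2 fun x => (hu 0 x).continuousAt)
  set f : C(AddCircle (2 * π - 0), ℂ) := ⟨hper'.lift, continuous_coinduced_dom.mpr hcont⟩ with hf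
  have hfc : ∀ n, fourierCoeff f n = a n := by
    intro n
    rw [fourierCoeff_eq_intervalIntegral _ _ 0, ha, fourierCoeffOn_eq_integral, zero_add]
    simp only [sub_zero]
    rfl
  have hsum : Summable a := by
    refine Summable.of_norm_bounded (g := fun n : ℤ => 2 * C * q ^ n.natAbs) ?_ hab
    refine Summable.mul_left _ ?_
    refine Summable.of_nat_of_neg ?_ ?_
    · simpa using summable_geometric_of_lt_one hq0.le hq1
    · simpa using summable_geometric_of_lt_one hq0.le hq1
  have hpt : ∀ φ : ℝ, HasSum (fun n : ℤ => (a n).re * Real.cos (n * φ)) (u 0 φ) := by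
    intro φ
    have h1 : ∀ φ : ℝ, HasSum (fun n : ℤ => a n * Complex.exp (Complex.I * (n * φ))) (u 0 φ : ℂ) := by
      intro φ
      have := has_pointwise_sum_fourier_series_of_summable (f := f)
        (by simpa only [funext hfc] using hsum) (φ : AddCircle (2 * π - 0))
      refine this.congr_fun fun n => ?_
      rw [hfc, fourier_coe_apply, smul_eq_mul]
      congr 2
      have : (π : ℂ) ≠ 0 := by exact_mod_cast Real.pi_ne_zero
      simp only [sub_zero]
      push_cast
      field_simp
    have h2 := (h1 φ).add (h1 (-φ))
    rw [heven φ] at h2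
    have h3 := (h2.mul_left (1 / 2)).mapL Complex.reCLM
    have h4 : Complex.reCLM (1 / 2 * ((u 0 φ : ℂ) + (u 0 φ : ℂ))) = u 0 φ := by
      rw [show (1 / 2 * ((u 0 φ : ℂ) + (u 0 φ : ℂ))) = (u 0 φ : ℂ) by ring]
      simp
    rw [h4] at h3
    refine h3.congr_fun fun n => ?_
    have h5 : (1 / 2 : ℂ) * (a n * Complex.exp (Complex.I * (n * φ))
        + a n * Complex.exp (Complex.I * (n * ((-φ : ℝ) : ℂ)))) = a n * ((Real.cos (n * φ) : ℝ) : ℂ) := by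
      push_cast
      rw [Complex.cos]
      ring_nf
    rw [h5, Complex.reCLM_apply, Complex.re_mul_ofReal]
  refine ⟨fun n => (a n).re + (a (-n)).re - if n = 0 then (a 0).re else 0, fun n => ?_, fun φ => ?_⟩
  · have h1 : |(a n).re| ≤ 2 * C * q ^ n := by
      simpa using (Complex.abs_re_le_norm _).trans (hab n)
    have h2 : |(a (-n)).re| ≤ 2 * C * q ^ n := by
      simpa using (Complex.abs_re_le_norm _).trans (hab (-n))
    have h3 : |if n = 0 then (a 0).re else 0| ≤ 2 * C * q ^ n := by
      split_ifs with h
      · subst h; simpa using (Complex.abs_re_le_norm _).trans (hab 0)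
      · rw [abs_zero]; exact (abs_nonneg _).trans h1
    rw [abs_le] at *
    constructor <;> linarith
  · have h1 := (hpt φ).nat_add_neg
    have h2 : HasSum (fun n : ℕ => if n = 0 then (a 0).re else 0) (a 0).re := hasSum_ite_eq 0 _
    have h3 := h1.sub h2
    simp only [Int.cast_zero, zero_mul, Real.cos_zero, mul_one, add_sub_cancel_right] at h3
    refine h3.congr_fun fun n => ?_
    rcases eq_or_ne n 0 with rfl | hn
    · simp
    · simp [hn]; ring

end Fourier

section Expansion

open scoped NNReal ENNReal

variable {ι : Type} [Fintype ι]

theorem summable_words {a : ℕ → ℝ} (ha : ∀ k, 0 ≤ a k)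
    (h : Summable fun k => (Fintype.card ι : ℝ) ^ k * a k) :
    Summable fun σ : Σ k : ℕ, Fin k → ι => a σ.1 := by
  rw [summable_sigma_of_nonneg (fun σ => ha σ.1)]
  refine ⟨fun k => (hasSum_fintype _).summable, h.congr fun k => ?_⟩
  simp

variable [DecidableEq ι]

/-- `k` unit vectors in the second factor, preceded by `l` unit vectors in the first one. -/
noncomputable def dirs (k : ℕ) (w : Fin k → ι) : ∀ l : ℕ, Fin (k + l) → ℝ × (ι → ℝ)
  | 0 => fun i => (0, Pi.single (w i) 1)
  | l + 1 => Fin.cons (1, 0) (dirs k w l)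

theorem norm_dirs_le (k : ℕ) (w : Fin k → ι) (l : ℕ) (i : Fin (k + l)) : ‖dirs k w l i‖ ≤ 1 := by
  induction l with
  | zero =>
    simp only [dirs, Prod.norm_mk, norm_zero]
    refine max_le zero_le_one ?_
    rw [pi_norm_le_iff_of_nonneg zero_le_one]
    intro j
    by_cases h : j = w i
    · subst h; simp
    · simp [h]
  | succ l ih =>
    refine Fin.cases ?_ (fun i => ?_) i
    · simp [dirs]
    · simpa [dirs] using ih i

theorem factorial_add_le (k l : ℕ) : ((k + l).factorial : ℝ) ≤ 2 ^ (k + l) * (k.factorial * l.factorial) := by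
  have h2 : (((k + l).choose l : ℕ) : ℝ) ≤ 2 ^ (k + l) := by
    exact_mod_cast Nat.choose_le_two_pow (k + l) l
  rw [← Nat.add_choose_mul_factorial_mul_factorial k l]
  push_cast
  rw [mul_assoc]
  gcongr

variable {G : ℝ × (ι → ℝ) → ℝ}

/-- Derivatives in the first variable of the Taylor coefficients with respect to the second. -/
noncomputable def tayCoef (G : ℝ × (ι → ℝ) → ℝ) (k : ℕ) (w : Fin k → ι) (l : ℕ) (φ : ℝ) : ℝ :=
  (k.factorial : ℝ)⁻¹ * iteratedFDeriv ℝ (k + l) G (φ, 0) (dirs k w l)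

theorem hasDerivAt_tayCoef (hG : ∀ φ : ℝ, AnalyticAt ℝ G (φ, 0)) (k : ℕ) (w : Fin k → ι) (l : ℕ)
    (φ : ℝ) : HasDerivAt (tayCoef G k w l) (tayCoef G k w (l + 1) φ) φ := by
  have h1 : DifferentiableAt ℝ (iteratedFDeriv ℝ (k + l) G) (φ, 0) := 
    ((hG φ).contDiffAt (n := ⊤)).differentiableAt_iteratedFDeriv
      (by exact_mod_cast WithTop.coe_lt_top _)
  have h2 : HasDerivAt (fun s : ℝ => (s, (0 : ι → ℝ))) (1, 0) φ :=
    (hasDerivAt_id φ).prodMk (hasDerivAt_const φ 0)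
  have h3 := h1.hasFDerivAt.comp_hasDerivAt φ h2
  have h4 := (ContinuousMultilinearMap.apply ℝ (fun _ : Fin (k + l) => ℝ × (ι → ℝ)) ℝ
    (dirs k w l)).hasFDerivAt.comp_hasDerivAt φ h3
  exact h4.const_mul _

theorem tayCoef_periodic {c : ℝ} (hper : ∀ φ Y, G (φ + c, Y) = G (φ, Y)) (k : ℕ) (w : Fin k → ι)
    (l : ℕ) : Function.Periodic (tayCoef G k w l) c := fun φ => by
  have h : (fun p => G (p + (c, 0))) = G := by
    funext p; obtain ⟨a, b⟩ := p; simpa using hper a b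
  have h2 := iteratedFDeriv_comp_add_right (𝕜 := ℝ) (f := G) (k + l) (c, 0) (φ, 0)
  rw [h] at h2
  simp only [tayCoef, h2, Prod.mk_add_mk, add_zero]

theorem tayCoef_even (heven : ∀ φ Y, G (-φ, Y) = G (φ, Y)) (k : ℕ) (w : Fin k → ι)
    (φ : ℝ) : tayCoef G k w 0 (-φ) = tayCoef G k w 0 φ := by
  set σ : (ℝ × (ι → ℝ)) ≃L[ℝ] (ℝ × (ι → ℝ)) :=
    (ContinuousLinearEquiv.neg ℝ).prodCongr (ContinuousLinearEquiv.refl ℝ _) with hσ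
  have h : G ∘ σ = G := by
    funext p; obtain ⟨a, b⟩ := p; simpa [hσ] using heven a b
  have h2 := σ.iteratedFDerivWithin_comp_right G uniqueDiffOn_univ (x := (φ, 0)) (mem_univ _) (k + 0)
  rw [preimage_univ, iteratedFDerivWithin_univ, iteratedFDerivWithin_univ] at h2
  rw [h] at h2
  simp only [tayCoef, h2, ContinuousMultilinearMap.compContinuousLinearMap_apply]
  have h3 : σ (φ, 0) = (-φ, 0) := by simp [hσ]
  rw [h3]
  congr 3
  funext i
  simp [hσ, dirs]

theorem abs_tayCoef_le {C A φ : ℝ} (hC : 0 < C) (hA : 0 < A)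
    (h : ∀ m, ‖iteratedFDeriv ℝ m G (φ, 0)‖ ≤ C * A ^ m * m.factorial) (k : ℕ) (w : Fin k → ι)
    (l : ℕ) : |tayCoef G k w l φ| ≤ C * (2 * A) ^ k * (2 * A) ^ l * l.factorial := by
  have h1 : |iteratedFDeriv ℝ (k + l) G (φ, 0) (dirs k w l)|
      ≤ C * A ^ (k + l) * (k + l).factorial := by
    refine ((iteratedFDeriv ℝ (k + l) G (φ, 0)).le_opNorm _).trans ?_
    refine (mul_le_of_le_one_right (norm_nonneg _) ?_).trans (h _)
    exact Finset.prod_le_one (fun _ _ => norm_nonneg _) (fun i _ => norm_dirs_le k w l i)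
  have hk : (0 : ℝ) < k.factorial := by positivity
  rw [tayCoef, abs_mul, abs_inv, abs_of_pos hk, inv_mul_le_iff₀ hk]
  calc _ ≤ _ := h1
    _ ≤ C * A ^ (k + l) * (2 ^ (k + l) * (k.factorial * l.factorial)) := by
      gcongr; exact factorial_add_le k l
    _ = _ := by rw [mul_pow, mul_pow, pow_add, pow_add]; ring

theorem tayCoef_sum (φ : ℝ) (Y : ι → ℝ) (k : ℕ) :
    ((k.factorial : ℝ))⁻¹ • iteratedFDeriv ℝ k G (φ, 0) (fun _ => ((0 : ℝ), Y))
      = ∑ w : Fin k → ι, tayCoef G k w 0 φ * ∏ i, Y (w i) := by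
  have h : ((0 : ℝ), Y) = ∑ i, Y i • ((0 : ℝ), (Pi.single i 1 : ι → ℝ)) := by
    ext j
    · simp [Prod.fst_sum]
    · simp [Prod.snd_sum, Finset.sum_apply, Pi.single_apply]
  rw [h, ContinuousMultilinearMap.map_sum, Finset.smul_sum]
  refine Finset.sum_congr rfl fun w _ => ?_
  rw [ContinuousMultilinearMap.map_smul_univ, tayCoef]
  simp only [smul_eq_mul]
  rw [mul_assoc, mul_comm (∏ i, Y (w i))]
  rfl

/-- Expansion of a function analytic near `[0, 1] × {0}` in Chebyshev polynomials of
the first variable and monomials in the second one. -/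
theorem exists_chebyshev_taylor {F : ℝ → (ι → ℝ) → ℝ}
    (hF : ∀ x ∈ Icc (0 : ℝ) 1, AnalyticAt ℝ (fun p : ℝ × (ι → ℝ) => F p.1 p.2) (x, 0)) :
    ∃ C B q δ : ℝ, 0 < C ∧ 0 < B ∧ 0 < q ∧ q < 1 ∧ 0 < δ ∧
      ∃ h : ∀ k : ℕ, (Fin k → ι) → ℕ → ℝ,
        (∀ k w n, |h k w n| ≤ C * B ^ k * q ^ n) ∧
        (∀ x ∈ Icc (0 : ℝ) 1, ∀ Y : ι → ℝ, ‖Y‖ < δ →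
          HasSum (fun p : (Σ k : ℕ, Fin k → ι) × ℕ =>
            h p.1.1 p.1.2 p.2 * chebT p.2 (1 - 2 * x) * ∏ i, Y (p.1.2 i)) (F x Y)) ∧
        ((∀ x ∈ Icc (0 : ℝ) 1, F x 0 = 0) → ∀ w n, h 0 w n = 0) ∧
        ((∀ x ∈ Icc (0 : ℝ) 1, ∀ i, deriv (fun s => F x (Pi.single i s)) 0 = 0) →
          ∀ w n, h 1 w n = 0) := by
  set G : ℝ × (ι → ℝ) → ℝ := fun p => F ((1 - Real.cos p.1) / 2) p.2 with hGdef
  have hx01 : ∀ φ : ℝ, (1 - Real.cos φ) / 2 ∈ Icc (0 : ℝ) 1 := fun φ =>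
    ⟨by linarith [Real.cos_le_one φ], by linarith [Real.neg_one_le_cos φ]⟩
  have hG : ∀ φ : ℝ, AnalyticAt ℝ G (φ, 0) := fun φ => by
    have h1 : AnalyticAt ℝ (fun p : ℝ × (ι → ℝ) => ((1 - Real.cos p.1) / 2, p.2)) (φ, 0) := by
      refine AnalyticAt.prod ?_ analyticAt_snd
      have : AnalyticAt ℝ (fun p : ℝ × (ι → ℝ) => Real.cos p.1) (φ, 0) :=
        (Real.analyticAt_cos (x := φ)).comp_of_eq analyticAt_fst rfl
      exact (analyticAt_const.sub this).div analyticAt_const two_ne_zero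
    exact (hF _ (hx01 φ)).comp_of_eq h1 rfl
  obtain ⟨C, A, δ, hC, hA, hδ, hK⟩ := (isCompact_Icc (a := (0 : ℝ)) (b := 2 * π)).prod
    (isCompact_singleton (x := (0 : ι → ℝ))) |>.exists_uniform_taylor (G := G) (by
      rintro ⟨φ, Y⟩ ⟨_, hY⟩
      rw [mem_singleton_iff] at hY
      subst hY
      exact hG φ)
  have hK1 : ∀ φ ∈ Icc (0 : ℝ) (2 * π), _ := fun φ hφ => hK (φ, 0) ⟨hφ, rfl⟩
  set q := Real.exp (-(1 / (2 * (2 * A)))) with hq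
  have hq0 : 0 < q := Real.exp_pos _
  have hq1 : q < 1 := by rw [hq, Real.exp_lt_one_iff, neg_lt_zero]; positivity
  have hex : ∀ (k : ℕ) (w : Fin k → ι), ∃ c : ℕ → ℝ,
      (∀ n, |c n| ≤ 6 * (C * (2 * A) ^ k) * q ^ n) ∧
      (∀ φ, HasSum (fun n => c n * Real.cos (n * φ)) (tayCoef G k w 0 φ)) ∧
      ((∀ φ, tayCoef G k w 0 φ = 0) → ∀ n, c n = 0) := by
    intro k w
    by_cases h0 : ∀ φ, tayCoef G k w 0 φ = 0
    · exact ⟨fun _ => 0, fun n => by rw [abs_zero]; positivity, fun φ => by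
        rw [h0 φ]; simp, fun _ _ => rfl⟩
    · obtain ⟨c, hc1, hc2⟩ := exists_cos_series (A := 2 * A) (by positivity)
        (u := tayCoef G k w) (C := C * (2 * A) ^ k) (hasDerivAt_tayCoef hG k w)
        (tayCoef_periodic (fun φ Y => by simp [hGdef]) k w)
        (tayCoef_even (fun φ Y => by simp [hGdef]) k w)
        (fun l φ hφ => abs_tayCoef_le hC hA (hK1 φ hφ).1 k w l)
      exact ⟨c, hc1, hc2, fun h => absurd h h0⟩
  choose h hb hs hz using hex
  refine ⟨6 * C, 2 * A, q, min δ (1 / (2 * A * (Fintype.card ι + 1))), by positivity, by positivity,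
    hq0, hq1, by positivity, h, fun k w n => (hb k w n).trans (le_of_eq (by ring)), ?_, ?_, ?_⟩
  · intro x hx Y hY
    set φ := Real.arccos (1 - 2 * x) with hφ
    have hcos : Real.cos φ = 1 - 2 * x :=
      Real.cos_arccos (by linarith [hx.2]) (by linarith [hx.1])
    have hxφ : (1 - Real.cos φ) / 2 = x := by rw [hcos]; ring
    have hφm : φ ∈ Icc (0 : ℝ) (2 * π) :=
      ⟨Real.arccos_nonneg _, (Real.arccos_le_pi _).trans (by linarith [Real.pi_pos])⟩
    have hT : ∀ n : ℕ, chebT n (1 - 2 * x) = Real.cos (n * φ) := fun n => by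
      rw [chebT, ← hcos, Polynomial.Chebyshev.T_real_cos]; simp
    have hYδ : ‖Y‖ < δ := hY.trans_le (min_le_left _ _)
    have hY2 : ‖Y‖ < 1 / (2 * A * (Fintype.card ι + 1)) := hY.trans_le (min_le_right _ _)
    have hsum : Summable (fun p : (Σ k : ℕ, Fin k → ι) × ℕ =>
            h p.1.1 p.1.2 p.2 * chebT p.2 (1 - 2 * x) * ∏ i, Y (p.1.2 i)) := by
      have h1 : Summable fun σ : Σ k : ℕ, Fin k → ι => (2 * A * ‖Y‖) ^ σ.1 := by
        refine summable_words (a := fun k => (2 * A * ‖Y‖) ^ k) (fun k => by positivity) ?_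
        simp only [← mul_pow]
        refine summable_geometric_of_lt_one (by positivity) ?_
        rw [lt_div_iff₀ (by positivity)] at hY2
        nlinarith [mul_nonneg hA.le (norm_nonneg Y)]
      have h2 := (h1.mul_of_nonneg (summable_geometric_of_lt_one hq0.le hq1)
        (fun _ => by positivity) (fun _ => by positivity)).mul_left (6 * C)
      refine Summable.of_norm_bounded h2 fun p => ?_
      rw [norm_mul, norm_mul, hT, Real.norm_eq_abs, Real.norm_eq_abs, norm_prod]
      calc _ ≤ (6 * (C * (2 * A) ^ p.1.1) * q ^ p.2) * 1 * ∏ i : Fin p.1.1, ‖Y‖ := by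
            gcongr
            · exact hb _ _ _
            · exact Real.abs_cos_le_one _
            · exact norm_le_pi_norm Y _
        _ = _ := by rw [Finset.prod_const, Finset.card_univ, Fintype.card_fin, mul_pow]; ring
    have hin : ∀ σ : Σ k : ℕ, Fin k → ι, HasSum (fun n =>
        h σ.1 σ.2 n * chebT n (1 - 2 * x) * ∏ i, Y (σ.2 i))
        (tayCoef G σ.1 σ.2 0 φ * ∏ i, Y (σ.2 i)) := fun σ => by
      simp only [hT]
      exact (hs σ.1 σ.2 φ).mul_right _
    have h3 := hsum.hasSum.prod_fiberwise hin
    have h4 := h3.sigma (fun k => hasSum_fintype _)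
    have h5 := (hK1 φ hφm).2 (0, Y) (by simpa [Prod.norm_mk] using hYδ)
    simp only [tayCoef_sum] at h5
    have h6 := h4.unique h5
    have h7 : G ((φ, 0) + (0, Y)) = F x Y := by simp [hGdef, hxφ]
    rw [h7] at h6
    rw [← h6]
    exact hsum.hasSum
  · intro h0 w
    refine hz 0 w fun φ => ?_
    simp only [tayCoef, Nat.factorial_zero]
    rw [show iteratedFDeriv ℝ (0 + 0) G (φ, 0) (dirs 0 w 0) = G (φ, 0) from
      iteratedFDeriv_zero_apply _]
    simp [hGdef, h0 _ (hx01 φ)]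
  · intro h0 w
    refine hz 1 w fun φ => ?_
    simp only [tayCoef, Nat.factorial_one]
    rw [show iteratedFDeriv ℝ (1 + 0) G (φ, 0) (dirs 1 w 0)
      = fderiv ℝ G (φ, 0) (0, Pi.single (w 0) 1) from iteratedFDeriv_one_apply _]
    have h1 : HasDerivAt (fun s : ℝ => ((φ, Pi.single (w 0) s) : ℝ × (ι → ℝ)))
        (0, Pi.single (w 0) 1) 0 := by
      refine (hasDerivAt_const _ φ).prodMk ?_
      rw [hasDerivAt_pi]
      intro j
      by_cases hj : j = w 0
      · subst hj; simpa using hasDerivAt_id' (0 : ℝ)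
      · simpa [hj] using hasDerivAt_const (0 : ℝ) (0 : ℝ)
    have h2 : HasFDerivAt G (fderiv ℝ G (φ, 0)) (φ, Pi.single (w 0) 0) := by
      rw [Pi.single_zero]; exact (hG φ).differentiableAt.hasFDerivAt
    have h3 := (h2.comp_hasDerivAt (0 : ℝ) h1).deriv
    rw [← h3]
    have h4 := h0 _ (hx01 φ) (w 0)
    simp only [Nat.cast_one, inv_one, one_mul]
    exact h4

end Expansion

theorem norm_cos_le_exp_abs_im (u : ℂ) : ‖Complex.cos u‖ ≤ Real.exp |u.im| := by
  rw [Complex.cos, norm_div]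
  have h1 : ‖Complex.exp (u * Complex.I)‖ ≤ Real.exp |u.im| := by
    rw [Complex.norm_exp]
    refine Real.exp_le_exp.2 ?_
    simpa using neg_le_abs u.im
  have h2 : ‖Complex.exp (-u * Complex.I)‖ ≤ Real.exp |u.im| := by
    rw [Complex.norm_exp]
    refine Real.exp_le_exp.2 ?_
    simpa using le_abs_self u.im
  have h3 := norm_add_le (Complex.exp (u * Complex.I)) (Complex.exp (-u * Complex.I))
  rw [Complex.norm_ofNat, div_le_iff₀ two_pos]
  linarith

theorem norm_cos_sq_add_norm_sin_sq (u : ℂ) :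
    ‖Complex.cos u‖ ^ 2 + ‖Complex.sin u‖ ^ 2 = 1 + 2 * Real.sinh u.im ^ 2 := by
  have hc : ‖Complex.cos u‖ ^ 2
      = (Real.cos u.re * Real.cosh u.im) ^ 2 + (Real.sin u.re * Real.sinh u.im) ^ 2 := by
    rw [Complex.sq_norm, Complex.normSq_apply, Complex.cos_eq, ← Complex.ofReal_cos,
      ← Complex.ofReal_sin, ← Complex.ofReal_cosh, ← Complex.ofReal_sinh]
    simp only [Complex.sub_re, Complex.mul_re, Complex.ofReal_re, Complex.ofReal_im, Complex.I_re,
      Complex.I_im, Complex.sub_im, Complex.mul_im]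
    ring
  have hs : ‖Complex.sin u‖ ^ 2
      = (Real.sin u.re * Real.cosh u.im) ^ 2 + (Real.cos u.re * Real.sinh u.im) ^ 2 := by
    rw [Complex.sq_norm, Complex.normSq_apply, Complex.sin_eq, ← Complex.ofReal_cos,
      ← Complex.ofReal_sin, ← Complex.ofReal_cosh, ← Complex.ofReal_sinh]
    simp only [Complex.add_re, Complex.mul_re, Complex.ofReal_re, Complex.ofReal_im, Complex.I_re,
      Complex.I_im, Complex.add_im, Complex.mul_im]
    ring
  rw [hc, hs]
  have h1 := Real.sin_sq_add_cos_sq u.re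
  have h2 := Real.cosh_sq u.im
  linear_combination (Real.cosh u.im ^ 2 + Real.sinh u.im ^ 2) * h1 + h2

/-- A complex ellipse around `[-1, 1]`. -/
def ellipse (σ : ℝ) : Set ℂ := {z | ‖z‖ ^ 2 + ‖1 - z ^ 2‖ < 1 + 2 * σ ^ 2}

theorem isOpen_ellipse (σ : ℝ) : IsOpen (ellipse σ) :=
  isOpen_lt (by fun_prop) continuous_const

theorem norm_eval_T_le {σ : ℝ} (hσ : 0 < σ) {z : ℂ} (hz : z ∈ ellipse σ) (n : ℕ) :
    ‖(Polynomial.Chebyshev.T ℂ n).eval z‖ ≤ Real.exp (σ * n) := by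
  obtain ⟨u, rfl⟩ := Complex.cos_surjective z
  rw [Polynomial.Chebyshev.T_complex_cos]
  refine (norm_cos_le_exp_abs_im _).trans (Real.exp_le_exp.2 ?_)
  have h1 : ‖Complex.cos u‖ ^ 2 + ‖1 - Complex.cos u ^ 2‖ < 1 + 2 * σ ^ 2 := hz
  have h2 : (1 : ℂ) - Complex.cos u ^ 2 = Complex.sin u ^ 2 := by
    rw [← Complex.sin_sq_add_cos_sq u]; ring
  rw [h2, norm_pow, norm_cos_sq_add_norm_sin_sq] at h1
  have h3 : |Real.sinh u.im| < σ := abs_lt_of_sq_lt_sq (by linarith) hσ.le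
  have h4 : |u.im| ≤ |Real.sinh u.im| := by
    rw [Real.abs_sinh]
    exact Real.self_le_sinh_iff.2 (abs_nonneg _)
  have h5 : (((n : ℤ) : ℂ) * u).im = n * u.im := by simp
  rw [h5, abs_mul, Nat.abs_cast, mul_comm]
  exact mul_le_mul_of_nonneg_right (h4.trans h3.le) (Nat.cast_nonneg n)

/-- A real neighborhood of `[0, 1]`. -/
def nhdI (σ : ℝ) : Set ℝ := {x | (1 - 2 * x) ^ 2 < 1 + σ ^ 2}

theorem isOpen_nhdI (σ : ℝ) : IsOpen (nhdI σ) := isOpen_lt (by fun_prop) continuous_const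

theorem ofReal_mem_ellipse {σ x : ℝ} (hσ : 0 < σ) (hx : x ∈ nhdI σ) :
    ((1 - 2 * x : ℝ) : ℂ) ∈ ellipse σ := by
  have hx : (1 - 2 * x) ^ 2 < 1 + σ ^ 2 := hx
  have h : (1 : ℂ) - ((1 - 2 * x : ℝ) : ℂ) ^ 2 = ((1 - (1 - 2 * x) ^ 2 : ℝ) : ℂ) := by push_cast; ring
  simp only [ellipse, mem_ofPred_eq]
  rw [h, Complex.norm_real, Complex.norm_real, Real.norm_eq_abs, Real.norm_eq_abs, sq_abs]
  have := pow_pos hσ 2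
  rcases abs_cases (1 - (1 - 2 * x) ^ 2) with h | h <;> linarith

theorem ofReal_chebT (n : ℕ) (z : ℝ) :
    (chebT n z : ℂ) = (Polynomial.Chebyshev.T ℂ n).eval (z : ℂ) :=
  Polynomial.Chebyshev.algebraMap_eval_T (R' := ℂ) z n

theorem abs_chebT_le {σ x : ℝ} (hσ : 0 < σ) (hx : x ∈ nhdI σ) (n : ℕ) :
    |chebT n (1 - 2 * x)| ≤ Real.exp (σ * n) := by
  have h := norm_eval_T_le hσ (ofReal_mem_ellipse hσ hx) n
  rwa [← ofReal_chebT, Complex.norm_real, Real.norm_eq_abs] at h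

theorem Icc_subset_nhdI {σ : ℝ} (hσ : 0 < σ) : Icc 0 1 ⊆ nhdI σ := by
  intro x hx
  have := pow_pos hσ 2
  simp only [nhdI, mem_ofPred_eq]
  nlinarith [hx.1, hx.2]

theorem convex_nhdI (σ : ℝ) : Convex ℝ (nhdI σ) := by
  have h : nhdI σ = Ioo ((1 - √(1 + σ ^ 2)) / 2) ((1 + √(1 + σ ^ 2)) / 2) := by
    ext x
    simp only [nhdI, mem_ofPred_eq, mem_Ioo]
    rw [Real.sq_lt]
    constructor <;> rintro ⟨h1, h2⟩ <;> constructor <;> linarith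
  rw [h]; exact convex_Ioo _ _

theorem exists_nhdI_subset {V : Set ℝ} (hV : IsOpen V) (h : Icc 0 1 ⊆ V) :
    ∃ σ₀ > 0, ∀ σ, 0 < σ → σ ≤ σ₀ → nhdI σ ⊆ V := by
  obtain ⟨δ, hδ, hδV⟩ := isCompact_Icc.exists_thickening_subset_open hV h
  refine ⟨min δ 1, by positivity, fun σ hσ hσ' x hx => hδV ?_⟩
  have hx : (1 - 2 * x) ^ 2 < 1 + σ ^ 2 := hx
  have h1 := hσ'.trans (min_le_left _ _)
  have h2 := hσ'.trans (min_le_right _ _)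
  have h3 : |1 - 2 * x| < 1 + σ := abs_lt_of_sq_lt_sq (by nlinarith) (by linarith)
  rw [abs_lt] at h3
  rw [Metric.mem_thickening_iff]
  refine ⟨max 0 (min x 1), ⟨le_max_left _ _, max_le zero_le_one (min_le_right _ _)⟩, ?_⟩
  rw [Real.dist_eq]
  rcases le_total x 1 with h4 | h4
  · rw [min_eq_left h4]
    rcases le_total 0 x with h5 | h5
    · rw [max_eq_right h5]; simpa using hδ
    · rw [max_eq_left h5, sub_zero, abs_of_nonpos h5]; linarith
  · rw [min_eq_right h4, max_eq_right zero_le_one, abs_of_nonneg (by linarith)]; linarith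

theorem analyticAt_chebyshev_series {σ : ℝ} (hσ : 0 < σ) {c : ℕ → ℝ}
    (hc : Summable fun n => |c n| * Real.exp (σ * n)) {x : ℝ} (hx : x ∈ nhdI σ) :
    AnalyticAt ℝ (fun x => ∑' n, c n * chebT n (1 - 2 * x)) x := by
  have h1 : DifferentiableOn ℂ
      (fun z : ℂ => ∑' n, (c n : ℂ) * (Polynomial.Chebyshev.T ℂ n).eval z) (ellipse σ) := by
    refine Complex.differentiableOn_tsum_of_summable_norm hc (fun n => ?_) (isOpen_ellipse σ)
      (fun n z hz => ?_)
    · exact (differentiableOn_const _).mul (Polynomial.differentiable _).differentiableOn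
    · rw [norm_mul, Complex.norm_real, Real.norm_eq_abs]
      exact mul_le_mul_of_nonneg_left (norm_eval_T_le hσ hz n) (abs_nonneg _)
  have h2 := (h1.analyticAt ((isOpen_ellipse σ).mem_nhds (ofReal_mem_ellipse hσ hx))).restrictScalars
    (𝕜 := ℝ)
  have h3 : AnalyticAt ℝ (fun x : ℝ => ((1 - 2 * x : ℝ) : ℂ)) x :=
    (Complex.ofRealCLM.analyticAt _).comp (analyticAt_const.sub (analyticAt_const.mul analyticAt_id))
  have h4 := AnalyticAt.fun_comp (Complex.reCLM.analyticAt _) (AnalyticAt.fun_comp (x := x) (f := fun x : ℝ => ((1 - 2 * x : ℝ) : ℂ)) h2 h3)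
  refine h4.congr (Eventually.of_forall fun y => ?_)
  simp only
  have : ∀ n, (c n : ℂ) * (Polynomial.Chebyshev.T ℂ n).eval ((1 - 2 * y : ℝ) : ℂ)
      = ((c n * chebT n (1 - 2 * y) : ℝ) : ℂ) := fun n => by
    rw [Complex.ofReal_mul, ofReal_chebT]
  simp_rw [this]
  rw [← Complex.ofReal_tsum]
  simp

theorem exists_U_eq_sum_T (n : ℕ) : ∃ u : ℕ → ℝ, (∀ k, |u k| ≤ 2) ∧
    Polynomial.Chebyshev.U ℝ n
      = ∑ k ∈ Finset.range (n + 1), Polynomial.C (u k) * Polynomial.Chebyshev.T ℝ k := by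
  induction n using Nat.strong_induction_on with
  | _ n ih =>
    match n with
    | 0 => exact ⟨fun _ => 1, fun _ => by norm_num, by simp⟩
    | 1 => exact ⟨fun k => if k = 1 then 2 else 0, fun k => by dsimp only; split_ifs <;> norm_num, by
        simp [Finset.sum_range_succ]
        rfl⟩
    | n + 2 =>
      obtain ⟨u, hu, hU⟩ := ih n (by omega)
      refine ⟨fun k => if k = n + 2 then 2 else if k < n + 1 then u k else 0, fun k => ?_, ?_⟩
      · dsimp only
        split_ifs
        · norm_num
        · exact hu k
        · norm_num
      · have h := Polynomial.Chebyshev.U_eq_two_mul_T_add_U ℝ n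
        push_cast at h ⊢
        rw [h, hU, Finset.sum_range_succ _ (n + 2), Finset.sum_range_succ _ (n + 1), add_comm]
        congr 1
        · rw [if_neg (by omega), if_neg (by omega), map_zero, zero_mul, add_zero]
          refine Finset.sum_congr rfl fun k hk => ?_
          have := Finset.mem_range.1 hk
          rw [if_neg (by omega), if_pos this]
        · rw [if_pos rfl, Polynomial.C_ofNat]
          push_cast
          rfl

/-- The Chebyshev polynomials shifted to `[0, 1]`. -/
noncomputable def chebP (n : ℕ) : Polynomial ℝ :=
  (Polynomial.Chebyshev.T ℝ n).comp (1 - 2 * Polynomial.X)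

theorem eval_chebP (n : ℕ) (x : ℝ) : (chebP n).eval x = chebT n (1 - 2 * x) := by
  simp [chebP, chebT]

theorem derivative_chebP (n : ℕ) : Polynomial.derivative (chebP n)
    = -2 * (Polynomial.derivative (Polynomial.Chebyshev.T ℝ n)).comp (1 - 2 * Polynomial.X) := by
  rw [chebP, Polynomial.derivative_comp]
  simp

theorem exists_derivative_chebP : ∃ d : ℕ → ℕ → ℝ, (∀ n k, |d n k| ≤ 4 * n) ∧
    ∀ n, Polynomial.derivative (chebP n)
      = ∑ k ∈ Finset.range (n + 1), Polynomial.C (d n k) * chebP k := by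
  have h : ∀ n : ℕ, ∃ d : ℕ → ℝ, (∀ k, |d k| ≤ 4 * n) ∧ Polynomial.derivative (chebP n)
      = ∑ k ∈ Finset.range (n + 1), Polynomial.C (d k) * chebP k := by
    intro n
    cases n with
    | zero => exact ⟨fun _ => 0, fun _ => by simp, by simp [chebP]⟩
    | succ n =>
      obtain ⟨u, hu, hU⟩ := exists_U_eq_sum_T n
      refine ⟨fun k => if k < n + 1 then -2 * (n + 1) * u k else 0, fun k => ?_, ?_⟩
      · dsimp only
        split_ifs
        · rw [abs_mul, abs_mul, abs_neg, abs_of_pos (by norm_num : (0:ℝ) < 2),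
            abs_of_pos (by positivity : (0:ℝ) < n + 1)]
          push_cast
          nlinarith [hu k, abs_nonneg (u k), (Nat.cast_nonneg n : (0:ℝ) ≤ n)]
        · simp; positivity
      · dsimp only
        have h := Polynomial.Chebyshev.T_derivative_eq_U (R := ℝ) ((n + 1 : ℕ) : ℤ)
        rw [show (((n + 1 : ℕ) : ℤ) - 1) = (n : ℤ) by push_cast; ring, hU] at h
        rw [derivative_chebP, h, Finset.sum_range_succ _ (n + 1), if_neg (lt_irrefl _), map_zero, zero_mul,
          add_zero, Polynomial.mul_comp,
          show (∑ k ∈ Finset.range (n + 1), Polynomial.C (u k) * Polynomial.Chebyshev.T ℝ k).comp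
              (1 - 2 * Polynomial.X) = ∑ k ∈ Finset.range (n + 1), (Polynomial.C (u k) *
                Polynomial.Chebyshev.T ℝ k).comp (1 - 2 * Polynomial.X) from
            Polynomial.eval₂_finsetSum _ _ _ _, Finset.mul_sum, Finset.mul_sum]
        refine Finset.sum_congr rfl fun k hk => ?_
        rw [if_pos (Finset.mem_range.1 hk)]
        simp only [Polynomial.mul_comp, Polynomial.C_comp, chebP, map_mul, map_add, map_neg,
          Polynomial.C_ofNat]
        simp
        ring
  choose d h1 h2 using h
  exact ⟨d, h1, h2⟩

theorem chebP_ode (n : ℕ) (x : ℝ) : (n : ℝ) ^ 2 * (chebP n).eval x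
    = -(x * (1 - x) * (Polynomial.derivative^[2] (chebP n)).eval x)
      - (1 / 2) * (1 - 2 * x) * (Polynomial.derivative (chebP n)).eval x := by
  have h := congrArg (Polynomial.eval (1 - 2 * x))
    (Polynomial.Chebyshev.one_sub_X_sq_mul_derivative_derivative_T_eq_poly_in_T (R := ℝ) (n : ℤ))
  have h2 : Polynomial.derivative^[2] (chebP n)
    = 4 * (Polynomial.derivative^[2] (Polynomial.Chebyshev.T ℝ n)).comp (1 - 2 * Polynomial.X) := by
    simp only [Function.iterate_succ, Function.iterate_zero, Function.comp, id]
    rw [derivative_chebP, Polynomial.derivative_mul, Polynomial.derivative_comp]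
    simp
    ring
  rw [h2, derivative_chebP]
  simp at h
  simp [chebP]
  linear_combination h

namespace EllOne

section diag

variable (K : ℕ → (ℝ →ᵇ ℝ) →L[ℝ] (ℝ →ᵇ ℝ)) (C : ℝ) (h : ∀ n c, ‖K n c‖ ≤ C * ‖c‖)

theorem norm_singleCLM_comp_le (h : ∀ n c, ‖K n c‖ ≤ C * ‖c‖) (n : ℕ) (c : ℝ →ᵇ ℝ) :
    ‖((singleCLM n).comp (K n)) c‖ ≤ C * ‖c‖ := by
  rw [ContinuousLinearMap.comp_apply, singleCLM_apply, norm_single]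
  exact h n c

/-- The operator acting on the entries separately. -/
noncomputable def diagLift : EllOne →L[ℝ] EllOne :=
  lift (fun n => (singleCLM n).comp (K n)) C (norm_singleCLM_comp_le K C h)

theorem norm_diagLift_le (a : EllOne) : ‖diagLift K C h a‖ ≤ C * ‖a‖ := norm_lift_le _ _ _ a

theorem diagLift_apply (a : EllOne) (n : ℕ) : diagLift K C h a n = K n (a n) := by
  have h1 : Summable fun n => ‖K n (a n)‖ := summable_norm_lift K C h a
  have h2 : diagLift K C h a = mk (fun n => K n (a n)) h1 :=
    (hasSum_lift _ C (norm_singleCLM_comp_le K C h) a).unique (hasSum_single (mk _ h1))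
  rw [h2, mk_apply]

end diag

section diagOp

variable {w w' : Wt} {c : ℕ → ℝ} {C : ℝ}

theorem norm_mulB_quot_le (h : ∀ n t, |c n| * w n t ≤ C * w' n t) (n : ℕ) (b : ℝ →ᵇ ℝ) :
    ‖mulB (quot w w' (c n) n n C (h n)) b‖ ≤ C * ‖b‖ :=
  (norm_mul_le _ _).trans
    (mul_le_mul_of_nonneg_right (norm_quot_le _ _ _ _ _ _ _) (norm_nonneg _))

/-- The Fourier multiplier with symbol `c`. -/
noncomputable def diagOp (w w' : Wt) (c : ℕ → ℝ) (C : ℝ)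
    (h : ∀ n t, |c n| * w n t ≤ C * w' n t) : EllOne →L[ℝ] EllOne :=
  diagLift (fun n => mulB (quot w w' (c n) n n C (h n))) C (norm_mulB_quot_le h)

variable (h : ∀ n t, |c n| * w n t ≤ C * w' n t)

theorem norm_diagOp_le (a : EllOne) : ‖diagOp w w' c C h a‖ ≤ C * ‖a‖ := norm_diagLift_le _ _ _ a

theorem mul_diagOp_apply (a : EllOne) (n : ℕ) (t : ℝ) :
    w' n t * diagOp w w' c C h a n t = c n * (w n t * a n t) := by
  have h1 := (w'.pos n t).ne'
  rw [diagOp, diagLift_apply, mulB, ContinuousLinearMap.mul_apply', BoundedContinuousFunction.coe_mul,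
    Pi.mul_apply, quot_apply]
  field_simp

end diagOp

end EllOne

/-- Derivatives of the shifted Chebyshev polynomials. -/
noncomputable def chebD (j n : ℕ) (x : ℝ) : ℝ := (Polynomial.derivative^[j] (chebP n)).eval x

theorem chebD_zero (n : ℕ) (x : ℝ) : chebD 0 n x = chebT n (1 - 2 * x) := eval_chebP n x

theorem hasDerivAt_chebD (j n : ℕ) (x : ℝ) : HasDerivAt (chebD j n) (chebD (j + 1) n x) x := by
  have h := (Polynomial.derivative^[j] (chebP n)).hasDerivAt x
  rwa [← Function.iterate_succ_apply' Polynomial.derivative j] at h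

theorem abs_chebD_le {σ x : ℝ} (hσ : 0 < σ) (hx : x ∈ nhdI σ) (j n : ℕ) :
    |chebD j n x| ≤ (4 * ((n : ℝ) + 1) ^ 2) ^ j * Real.exp (σ * n) := by
  obtain ⟨d, hd, hD⟩ := exists_derivative_chebP
  induction j generalizing n with
  | zero => rw [chebD_zero, pow_zero, one_mul]; exact abs_chebT_le hσ hx n
  | succ j ih =>
    have h1 : chebD (j + 1) n x = ∑ k ∈ Finset.range (n + 1), d n k * chebD j k x := by
      rw [chebD, Function.iterate_succ_apply, hD, Polynomial.iterate_derivative_sum,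
        Polynomial.eval_finsetSum]
      simp [Polynomial.iterate_derivative_C_mul, chebD]
    have h2 : ∀ k ∈ Finset.range (n + 1), |d n k * chebD j k x|
        ≤ 4 * (n + 1) * ((4 * ((n : ℝ) + 1) ^ 2) ^ j * Real.exp (σ * n)) := by
      intro k hk
      have hk : (k : ℝ) ≤ n := by exact_mod_cast Nat.lt_succ_iff.1 (Finset.mem_range.1 hk)
      rw [abs_mul]
      refine mul_le_mul ((hd n k).trans (by linarith)) ((ih k).trans ?_) (abs_nonneg _) (by positivity)
      gcongr
    rw [h1]
    refine (Finset.abs_sum_le_sum_abs _ _).trans ((Finset.sum_le_sum h2).trans (le_of_eq ?_))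
    rw [Finset.sum_const, Finset.card_range, nsmul_eq_mul, pow_succ]
    push_cast
    ring

theorem pow_mul_exp_neg_le {σ : ℝ} (hσ : 0 < σ) (j n : ℕ) :
    (4 * ((n : ℝ) + 1) ^ 2) ^ j * Real.exp (-(σ * n))
      ≤ 4 ^ j * ((2 * j).factorial / σ ^ (2 * j)) * Real.exp σ := by
  have h := Real.pow_div_factorial_le_exp (σ * (n + 1)) (by positivity) (2 * j)
  rw [div_le_iff₀ (by positivity), mul_pow] at h
  have h2 : ((n : ℝ) + 1) ^ (2 * j)
      ≤ (2 * j).factorial / σ ^ (2 * j) * Real.exp (σ * (n + 1)) := by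
    rw [div_mul_eq_mul_div, le_div_iff₀ (by positivity)]
    linarith
  rw [mul_pow, ← pow_mul, mul_assoc, mul_assoc]
  refine mul_le_mul_of_nonneg_left ?_ (by positivity)
  refine (mul_le_mul_of_nonneg_right h2 (Real.exp_pos _).le).trans (le_of_eq ?_)
  rw [mul_assoc, ← Real.exp_add]
  congr 2
  ring

/-- The weights decay exponentially. -/
def Decays (w : Wt) (σ : ℝ) : Prop := ∀ n t, w n t ≤ Real.exp (-(2 * σ * n))

theorem Decays.evBound {w : Wt} {σ x : ℝ} (hw : Decays w σ) (hσ : 0 < σ) (hx : x ∈ nhdI σ) :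
    EvBound w (1 - 2 * x) := by
  intro n t
  refine (mul_le_mul (hw n t) (abs_chebT_le hσ hx n) (abs_nonneg _) (Real.exp_pos _).le).trans ?_
  rw [← Real.exp_add, Real.exp_le_one_iff]
  have : 0 ≤ σ * n := by positivity
  linarith

theorem Decays.exists_bound {w : Wt} {σ : ℝ} (hw : Decays w σ) (hσ : 0 < σ) (j : ℕ) :
    ∃ C, 0 ≤ C ∧ ∀ x ∈ nhdI σ, ∀ n t, w n t * |chebD j n x| ≤ C := by
  refine ⟨4 ^ j * ((2 * j).factorial / σ ^ (2 * j)) * Real.exp σ, by positivity,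
    fun x hx n t => le_trans ?_ (pow_mul_exp_neg_le hσ j n)⟩
  refine (mul_le_mul (hw n t) (abs_chebD_le hσ hx j n) (abs_nonneg _) (Real.exp_pos _).le).trans
    (le_of_eq ?_)
  rw [mul_left_comm, ← Real.exp_add]
  congr 2
  ring

/-- The `j`-th space derivative of a Chebyshev series. -/
noncomputable def evD (j : ℕ) (w : Wt) (t x : ℝ) (a : EllOne) : ℝ :=
  ∑' n, w n t * a n t * chebD j n x

theorem evD_zero (w : Wt) (t x : ℝ) (a : EllOne) : evD 0 w t x a = ev w t (1 - 2 * x) a := by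
  simp only [evD, ev, chebD_zero]

theorem abs_evD_term_le {w : Wt} {σ : ℝ} {C : ℝ} {j : ℕ} (hC : ∀ x ∈ nhdI σ, ∀ n t, w n t * |chebD j n x| ≤ C)
    (a : EllOne) (n : ℕ) (t : ℝ) {x : ℝ} (hx : x ∈ nhdI σ) :
    ‖w n t * a n t * chebD j n x‖ ≤ C * ‖a n‖ := by
  rw [Real.norm_eq_abs, abs_mul, abs_mul, abs_of_pos (w.pos n t), mul_right_comm]
  exact mul_le_mul (hC x hx n t) ((a n).norm_coe_le_norm t) (abs_nonneg _)
    ((mul_nonneg (w.pos n t).le (abs_nonneg _)).trans (hC x hx n t))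

theorem hasSum_evD {w : Wt} {σ : ℝ} (hw : Decays w σ) (hσ : 0 < σ)
    (j : ℕ) (t : ℝ) {x : ℝ} (hx : x ∈ nhdI σ) (a : EllOne) :
    HasSum (fun n => w n t * a n t * chebD j n x) (evD j w t x a) := by
  obtain ⟨C, -, hC⟩ := hw.exists_bound hσ j
  exact (Summable.of_norm_bounded ((EllOne.summable_norm a).mul_left C)
    (fun n => abs_evD_term_le hC a n t hx)).hasSum

theorem hasDerivAt_evD {w : Wt} {σ : ℝ} (hw : Decays w σ) (hσ : 0 < σ)
    (j : ℕ) (t : ℝ) {x : ℝ} (hx : x ∈ nhdI σ) (a : EllOne) :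
    HasDerivAt (fun x => evD j w t x a) (evD (j + 1) w t x a) x := by
  obtain ⟨C, -, hC⟩ := hw.exists_bound hσ (j + 1)
  exact hasDerivAt_tsum_of_isPreconnected ((EllOne.summable_norm a).mul_left C) (isOpen_nhdI σ)
    (convex_nhdI σ).isPreconnected (fun n y _ => (hasDerivAt_chebD j n y).const_mul _)
    (fun n y hy => abs_evD_term_le hC a n t hy) hx (hasSum_evD hw hσ j t hx a).summable hx

theorem continuousOn_evD {w : Wt} {σ : ℝ} (hw : Decays w σ) (hσ : 0 < σ)
    (j : ℕ) (a : EllOne) :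
    ContinuousOn (fun p : ℝ × ℝ => evD j w p.1 p.2 a) (univ ×ˢ nhdI σ) := by
  obtain ⟨C, -, hC⟩ := hw.exists_bound hσ j
  refine continuousOn_tsum (fun n => Continuous.continuousOn ?_)
    ((EllOne.summable_norm a).mul_left C) (fun n p hp => abs_evD_term_le hC a n p.1 hp.2)
  have h1 := w.cont n
  have h2 := (a n).continuous
  have h3 : Continuous (chebD j n) := Polynomial.continuous _
  fun_prop

theorem hasDerivAt_evD_time {w : Wt} {σ : ℝ} (hw : Decays w σ) (hσ : 0 < σ)
    {w' : Wt} (hw' : Decays w' σ) {S : ℝ} {a b : EllOne}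
    (hab : ∀ n, ∀ t ∈ Ioo (-S) S, HasDerivAt (fun t => w n t * a n t) (w' n t * b n t) t)
    (j : ℕ) {t x : ℝ} (ht : t ∈ Ioo (-S) S) (hx : x ∈ nhdI σ) :
    HasDerivAt (fun t => evD j w t x a) (evD j w' t x b) t := by
  obtain ⟨C, -, hC⟩ := hw'.exists_bound hσ j
  exact hasDerivAt_tsum_of_isPreconnected ((EllOne.summable_norm b).mul_left C) isOpen_Ioo
    isPreconnected_Ioo (fun n y hy => (hab n y hy).mul_const _)
    (fun n y hy => abs_evD_term_le hC b n y hx) ht (hasSum_evD hw hσ j t hx a).summable ht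

/-- Time truncated at `S`, up to sign. -/
noncomputable def trunc (S t : ℝ) : ℝ := min |t| S

theorem trunc_nonneg {S : ℝ} (hS : 0 < S) (t : ℝ) : 0 ≤ trunc S t := le_min (abs_nonneg t) hS.le

theorem trunc_le (S t : ℝ) : trunc S t ≤ S := min_le_right _ _

theorem continuous_trunc (S : ℝ) : Continuous (trunc S) := by unfold trunc; fun_prop

/-- The decay rate of the weights. -/
noncomputable def rate (σ S t : ℝ) : ℝ := 4 * σ - 2 * σ / S * trunc S t

theorem two_mul_le_rate {σ S : ℝ} (hσ : 0 < σ) (hS : 0 < S) (t : ℝ) : 2 * σ ≤ rate σ S t := by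
  have h : 2 * σ / S * trunc S t ≤ 2 * σ / S * S :=
    mul_le_mul_of_nonneg_left (trunc_le S t) (by positivity)
  rw [div_mul_cancel₀ _ hS.ne'] at h
  unfold rate
  linarith

theorem rate_le {σ S : ℝ} (hσ : 0 < σ) (hS : 0 < S) (t : ℝ) : rate σ S t ≤ 4 * σ := by
  have := trunc_nonneg hS t
  have h : 0 ≤ 2 * σ / S * trunc S t := by positivity
  unfold rate
  linarith

/-- Weights on a time-dependent scale of analytic functions. -/
noncomputable def wt (σ S M : ℝ) (j : ℕ) : Wt where
  toFun n t := Real.exp (M * (trunc S t - S) - rate σ S t * n) / ((n : ℝ) + 1) ^ j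
  cont n := by
    have := continuous_trunc S
    unfold rate
    fun_prop
  pos n t := by positivity

theorem wt_apply (σ S M : ℝ) (j n : ℕ) (t : ℝ) :
    wt σ S M j n t = Real.exp (M * (trunc S t - S) - rate σ S t * n) / ((n : ℝ) + 1) ^ j := rfl

section wt

variable {σ S M : ℝ}

theorem decays_wt (hσ : 0 < σ) (hS : 0 < S) (hM : 0 ≤ M) (j : ℕ) : Decays (wt σ S M j) σ := by
  intro n t
  rw [wt_apply]
  have h1 : (1 : ℝ) ≤ ((n : ℝ) + 1) ^ j := one_le_pow₀ (by linarith [n.cast_nonneg (α := ℝ)])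
  refine (div_le_self (Real.exp_pos _).le h1).trans (Real.exp_le_exp.2 ?_)
  have h2 : M * (trunc S t - S) ≤ 0 :=
    mul_nonpos_of_nonneg_of_nonpos hM (by linarith [trunc_le S t])
  have h3 := mul_le_mul_of_nonneg_right (two_mul_le_rate hσ hS t) (Nat.cast_nonneg (α := ℝ) n)
  linarith

theorem wt_mulOK (hσ : 0 < σ) (hS : 0 < S) {M₁ M₂ M₃ : ℝ} {j₁ j₂ j₃ : ℕ} (hM : M₃ ≤ M₁ + M₂)
    (h₁ : j₃ ≤ j₁) (h₂ : j₃ ≤ j₂) : MulOK (wt σ S M₁ j₁) (wt σ S M₂ j₂) (wt σ S M₃ j₃) := by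
  have key : ∀ m n k : ℕ, k ≤ m + n → ∀ t,
      wt σ S M₁ j₁ m t * wt σ S M₂ j₂ n t ≤ wt σ S M₃ j₃ k t := by
    intro m n k hk t
    have hk' : (k : ℝ) ≤ m + n := by exact_mod_cast hk
    rw [wt_apply, wt_apply, wt_apply, div_mul_div_comm, ← Real.exp_add]
    refine div_le_div₀ (Real.exp_pos _).le (Real.exp_le_exp.2 ?_) (by positivity) ?_
    · have h1 := mul_le_mul_of_nonneg_right hM (sub_nonneg.2 (trunc_le S t))
      have h2 := mul_le_mul_of_nonneg_left hk' ((by positivity : 0 ≤ 2 * σ).trans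
        (two_mul_le_rate hσ hS t))
      linarith
    · have hm : (1 : ℝ) ≤ (m : ℝ) + 1 := by linarith [m.cast_nonneg (α := ℝ)]
      have hn : (1 : ℝ) ≤ (n : ℝ) + 1 := by linarith [n.cast_nonneg (α := ℝ)]
      calc ((k : ℝ) + 1) ^ j₃ ≤ (((m : ℝ) + 1) * ((n : ℝ) + 1)) ^ j₃ := by
            gcongr
            nlinarith [mul_nonneg (m.cast_nonneg (α := ℝ)) (n.cast_nonneg (α := ℝ))]
        _ = ((m : ℝ) + 1) ^ j₃ * ((n : ℝ) + 1) ^ j₃ := mul_pow _ _ _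
        _ ≤ _ := mul_le_mul (pow_le_pow_right₀ hm h₁) (pow_le_pow_right₀ hn h₂) (by positivity)
            (by positivity)
  intro m n t
  exact ⟨key m n _ le_rfl t, key m n _ (by unfold Nat.dist; omega) t⟩

theorem inv_wt_le (hσ : 0 < σ) (hS : 0 < S) (hM : 0 ≤ M) (j n : ℕ) (t : ℝ) :
    (wt σ S M j n t)⁻¹ ≤ Real.exp (M * S) * (((n : ℝ) + 1) ^ j * Real.exp (4 * σ * n)) := by
  rw [wt_apply, inv_div, div_eq_mul_inv, ← Real.exp_neg, mul_left_comm, ← Real.exp_add]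
  refine mul_le_mul_of_nonneg_left (Real.exp_le_exp.2 ?_) (by positivity)
  have h1 := mul_le_mul_of_nonneg_right (rate_le hσ hS t) (Nat.cast_nonneg (α := ℝ) n)
  have h2 := mul_nonneg hM (trunc_nonneg hS t)
  linarith

theorem wt_succ_le (hσ : 0 < σ) (hS : 0 < S) (j n k : ℕ) (hk : k ≤ n) (t : ℝ) :
    (4 * n : ℝ) * wt σ S M (j + 1) n t ≤ 4 * Real.exp (-(2 * σ)) ^ (n - k) * wt σ S M j k t := by
  have hk' : (k : ℝ) ≤ n := by exact_mod_cast hk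
  rw [wt_apply, wt_apply, ← Real.exp_nat_mul, Nat.cast_sub hk, mul_div_assoc', mul_div_assoc',
    div_le_div_iff₀ (by positivity) (by positivity), mul_assoc, mul_assoc, mul_assoc, mul_assoc]
  refine mul_le_mul_of_nonneg_left ?_ (by norm_num)
  rw [← mul_assoc (Real.exp _) (Real.exp _), ← Real.exp_add, mul_left_comm]
  refine mul_le_mul (Real.exp_le_exp.2 ?_) ?_ (by positivity) (Real.exp_pos _).le
  · have h := mul_le_mul_of_nonneg_right (two_mul_le_rate hσ hS t) (sub_nonneg.2 hk')
    linarith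
  · rw [pow_succ, mul_comm (n : ℝ)]
    exact mul_le_mul (by gcongr) (by linarith) (by positivity) (by positivity)

theorem wt_anti {i j : ℕ} (h : i ≤ j) (n : ℕ) (t : ℝ) : wt σ S M j n t ≤ wt σ S M i n t := by
  rw [wt_apply, wt_apply]
  gcongr
  linarith [n.cast_nonneg (α := ℝ)]

theorem wt_succ_eq (j n : ℕ) (t : ℝ) :
    ((n : ℝ) + 1) * wt σ S M (j + 1) n t = wt σ S M j n t := by
  rw [wt_apply, wt_apply, pow_succ]
  field_simp

end wt

namespace EllOne

variable {σ S M : ℝ}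

/-- Inclusions in the scale. -/
noncomputable def incl (σ S M : ℝ) {i j : ℕ} (h : i ≤ j) : EllOne →L[ℝ] EllOne :=
  diagOp (wt σ S M j) (wt σ S M i) (fun _ => 1) 1
    (fun n t => by rw [abs_one, one_mul, one_mul]; exact wt_anti h n t)

theorem norm_incl_le {i j : ℕ} (h : i ≤ j) (a : EllOne) : ‖incl σ S M h a‖ ≤ ‖a‖ := by
  have := norm_diagOp_le (w := wt σ S M j) (w' := wt σ S M i) (c := fun _ => 1) (C := 1)
    (fun n t => by rw [abs_one, one_mul, one_mul]; exact wt_anti h n t) a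
  rwa [one_mul] at this

theorem wt_mul_incl {i j : ℕ} (h : i ≤ j) (a : EllOne) (n : ℕ) (t : ℝ) :
    wt σ S M i n t * incl σ S M h a n t = wt σ S M j n t * a n t := by
  rw [incl, mul_diagOp_apply, one_mul]

theorem ev_incl {i j : ℕ} (h : i ≤ j) (a : EllOne) (t z : ℝ) :
    ev (wt σ S M i) t z (incl σ S M h a) = ev (wt σ S M j) t z a := by
  simp only [ev, wt_mul_incl]

/-- The matrix of the derivative in the Chebyshev basis. -/
noncomputable def dcoef : ℕ → ℕ → ℝ := exists_derivative_chebP.choose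

theorem abs_dcoef_le (n k : ℕ) : |dcoef n k| ≤ 4 * n := exists_derivative_chebP.choose_spec.1 n k

theorem chebD_one (n : ℕ) (x : ℝ) :
    chebD 1 n x = ∑ k ∈ Finset.range (n + 1), dcoef n k * chebT k (1 - 2 * x) := by
  have h := exists_derivative_chebP.choose_spec.2 n
  rw [chebD, Function.iterate_one, h, Polynomial.eval_finsetSum]
  simp [dcoef, eval_chebP]

theorem derivOp_bound (hσ : 0 < σ) (hS : 0 < S) (M : ℝ) (j n k : ℕ) (t : ℝ) :
    |(if k ≤ n then dcoef n k else 0)| * wt σ S M (j + 1) n t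
      ≤ 4 * Real.exp (-(2 * σ)) ^ (n - k) * wt σ S M j k t := by
  have h1 := (wt σ S M j).pos k t
  have h2 := (wt σ S M (j + 1)).pos n t
  split_ifs with hk
  · exact (mul_le_mul_of_nonneg_right (abs_dcoef_le n k) h2.le).trans (wt_succ_le hσ hS j n k hk t)
  · rw [abs_zero, zero_mul]; positivity

theorem derivOp_sum (hσ : 0 < σ) (n : ℕ) :
    ∑ k ∈ Finset.range (n + 1), 4 * Real.exp (-(2 * σ)) ^ (n - k)
      ≤ 4 * (1 - Real.exp (-(2 * σ)))⁻¹ := by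
  have h1 : Real.exp (-(2 * σ)) < 1 := by rw [Real.exp_lt_one_iff]; linarith
  rw [← Finset.mul_sum]
  refine mul_le_mul_of_nonneg_left ?_ (by norm_num)
  rw [← Finset.sum_range_reflect]
  rw [← tsum_geometric_of_lt_one (Real.exp_pos _).le h1]
  refine le_trans (le_of_eq ?_) ((summable_geometric_of_lt_one (Real.exp_pos _).le h1).sum_le_tsum
    (Finset.range (n + 1)) (fun _ _ => by positivity))
  refine Finset.sum_congr rfl fun k hk => ?_
  have := Finset.mem_range.1 hk
  congr 1
  omega

/-- The space derivative. -/
noncomputable def derivOp (hσ : 0 < σ) (hS : 0 < S) (M : ℝ) (j : ℕ) : EllOne →L[ℝ] EllOne :=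
  matOp (wt σ S M (j + 1)) (wt σ S M j) _ _ _ (derivOp_bound hσ hS M j) (derivOp_sum hσ)

theorem norm_derivOp_le (hσ : 0 < σ) (hS : 0 < S) (M : ℝ) (j : ℕ) (a : EllOne) :
    ‖derivOp hσ hS M j a‖ ≤ 4 * (1 - Real.exp (-(2 * σ)))⁻¹ * ‖a‖ := norm_matOp_le _ _ a

theorem ev_derivOp (hσ : 0 < σ) (hS : 0 < S) (hM : 0 ≤ M) (j : ℕ) (a : EllOne) (t : ℝ) {x : ℝ}
    (hx : x ∈ nhdI σ) :
    ev (wt σ S M j) t (1 - 2 * x) (derivOp hσ hS M j a) = evD 1 (wt σ S M (j + 1)) t x a := by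
  refine (hasSum_ev_matOp (derivOp_bound hσ hS M j) (derivOp_sum hσ)
    ((decays_wt hσ hS hM j).evBound hσ hx) a).unique ?_
  refine (hasSum_evD (decays_wt hσ hS hM (j + 1)) hσ 1 t hx a).congr_fun fun n => ?_
  rw [chebD_one]
  congr 1
  refine Finset.sum_congr rfl fun k hk => ?_
  rw [if_pos (Nat.lt_succ_iff.1 (Finset.mem_range.1 hk))]

/-- The reciprocal of a weight, as a bounded function. -/
noncomputable def invWt (hσ : 0 < σ) (hS : 0 < S) (hM : 0 ≤ M) (j n : ℕ) : ℝ →ᵇ ℝ :=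
  BoundedContinuousFunction.ofNormedAddCommGroup (fun t => (wt σ S M j n t)⁻¹)
    (((wt σ S M j).cont n).inv₀ fun t => ((wt σ S M j).pos n t).ne')
    (Real.exp (M * S) * (((n : ℝ) + 1) ^ j * Real.exp (4 * σ * n)))
    (fun t => by
      rw [Real.norm_eq_abs, abs_of_pos (inv_pos.2 ((wt σ S M j).pos n t))]
      exact inv_wt_le hσ hS hM j n t)

theorem norm_invWt_le (hσ : 0 < σ) (hS : 0 < S) (hM : 0 ≤ M) (j n : ℕ) :
    ‖invWt hσ hS hM j n‖ ≤ Real.exp (M * S) * (((n : ℝ) + 1) ^ j * Real.exp (4 * σ * n)) :=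
  BoundedContinuousFunction.norm_ofNormedAddCommGroup_le _ (by positivity) _

theorem wt_mul_invWt (hσ : 0 < σ) (hS : 0 < S) (hM : 0 ≤ M) (j n : ℕ) (t : ℝ) :
    wt σ S M j n t * invWt hσ hS hM j n t = 1 :=
  mul_inv_cancel₀ ((wt σ S M j).pos n t).ne'

theorem summable_coef {c : ℕ → ℝ} {j : ℕ}
    (hc : Summable fun n => |c n| * (((n : ℝ) + 1) ^ j * Real.exp (4 * σ * n)))
    (hσ : 0 < σ) (hS : 0 < S) (hM : 0 ≤ M) (θ : ℝ →ᵇ ℝ) :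
    Summable fun n => ‖c n • (invWt hσ hS hM j n * θ)‖ := by
  refine Summable.of_nonneg_of_le (fun _ => norm_nonneg _) (fun n => ?_)
    (hc.mul_left (Real.exp (M * S) * ‖θ‖))
  rw [norm_smul, Real.norm_eq_abs]
  have h1 := (norm_mul_le (invWt hσ hS hM j n) θ).trans
    (mul_le_mul_of_nonneg_right (norm_invWt_le hσ hS hM j n) (norm_nonneg _))
  calc _ ≤ |c n| * _ := mul_le_mul_of_nonneg_left h1 (abs_nonneg _)
    _ = _ := by ring

/-- The element with Chebyshev coefficients `θ(t) c n`. -/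
noncomputable def ofCoef {c : ℕ → ℝ} {j : ℕ}
    (hc : Summable fun n => |c n| * (((n : ℝ) + 1) ^ j * Real.exp (4 * σ * n)))
    (hσ : 0 < σ) (hS : 0 < S) (hM : 0 ≤ M) (θ : ℝ →ᵇ ℝ) : EllOne :=
  mk _ (summable_coef hc hσ hS hM θ)

theorem wt_mul_ofCoef {c : ℕ → ℝ} {j : ℕ}
    (hc : Summable fun n => |c n| * (((n : ℝ) + 1) ^ j * Real.exp (4 * σ * n)))
    (hσ : 0 < σ) (hS : 0 < S) (hM : 0 ≤ M) (θ : ℝ →ᵇ ℝ) (n : ℕ) (t : ℝ) :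
    wt σ S M j n t * ofCoef hc hσ hS hM θ n t = c n * θ t := by
  have h := wt_mul_invWt hσ hS hM j n t
  simp only [ofCoef, mk_apply, BoundedContinuousFunction.coe_smul, BoundedContinuousFunction.coe_mul,
    Pi.mul_apply, smul_eq_mul]
  linear_combination (c n * θ t) * h

theorem ev_ofCoef {c : ℕ → ℝ} {j : ℕ}
    (hc : Summable fun n => |c n| * (((n : ℝ) + 1) ^ j * Real.exp (4 * σ * n)))
    (hσ : 0 < σ) (hS : 0 < S) (hM : 0 ≤ M) (θ : ℝ →ᵇ ℝ) (t z : ℝ) :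
    ev (wt σ S M j) t z (ofCoef hc hσ hS hM θ) = θ t * ∑' n, c n * chebT n z := by
  simp only [ev, wt_mul_ofCoef]
  rw [← tsum_mul_left]
  exact tsum_congr fun n => by ring

end EllOne

theorem abs_integral_exp_abs_le {a : ℝ} (ha : 0 < a) (t : ℝ) :
    |∫ s in (0 : ℝ)..t, Real.exp (a * |s|)| ≤ Real.exp (a * |t|) / a := by
  have key : ∀ t : ℝ, 0 ≤ t → |∫ s in (0 : ℝ)..t, Real.exp (a * |s|)| ≤ Real.exp (a * |t|) / a := by
    intro t ht
    have h1 : ∫ s in (0 : ℝ)..t, Real.exp (a * |s|) = ∫ s in (0 : ℝ)..t, Real.exp (a * s) := by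
      refine intervalIntegral.integral_congr fun s hs => ?_
      rw [uIcc_of_le ht] at hs
      simp only [abs_of_nonneg hs.1]
    have h2 : ∫ s in (0 : ℝ)..t, Real.exp (a * s) = (Real.exp (a * t) - 1) / a := by
      rw [intervalIntegral.integral_comp_mul_left _ ha.ne', integral_exp]
      simp
      field_simp
    have h3 : 1 ≤ Real.exp (a * t) := Real.one_le_exp (by positivity)
    rw [h1, h2, abs_of_nonneg ht, abs_of_nonneg (div_nonneg (by linarith) ha.le)]
    gcongr
    linarith
  rcases le_total 0 t with ht | ht
  · exact key t ht
  · have h := key (-t) (by linarith)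
    have h2 := intervalIntegral.integral_comp_neg (a := t) (b := 0) (fun s => Real.exp (a * |s|))
    simp only [abs_neg, neg_zero] at h2 h
    rwa [intervalIntegral.integral_symm, abs_neg, h2]

/-- Time restricted to `[-S, S]`. -/
noncomputable def clamp (S t : ℝ) : ℝ := max (-S) (min t S)

theorem continuous_clamp (S : ℝ) : Continuous (clamp S) := by unfold clamp; fun_prop

theorem clamp_of_mem {S t : ℝ} (ht : t ∈ Ioo (-S) S) : clamp S t = t := by
  rw [clamp, min_eq_left ht.2.le, max_eq_right ht.1.le]

theorem abs_clamp {S : ℝ} (hS : 0 < S) (t : ℝ) : |clamp S t| = trunc S t := by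
  unfold clamp trunc
  rcases le_total t S with h | h
  · rw [min_eq_left h]
    rcases le_total (-S) t with h' | h'
    · rw [max_eq_right h', min_eq_left (abs_le.2 ⟨h', h⟩)]
    · rw [max_eq_left h', abs_neg, abs_of_pos hS, min_eq_right]
      rw [abs_of_nonpos (by linarith)]; linarith
  · rw [min_eq_right h, max_eq_right (by linarith), abs_of_pos hS, min_eq_right]
    exact h.trans (le_abs_self t)

/-- A Duhamel integral at frequency `ω`. -/
noncomputable def osc (ω : ℝ) (a b F : ℝ → ℝ) (t : ℝ) : ℝ :=
  a t * (∫ s in (0 : ℝ)..t, Real.cos (ω * s) * F s)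
    + b t * (∫ s in (0 : ℝ)..t, Real.sin (ω * s) * F s)

section osc

variable {ω : ℝ} {a b F G : ℝ → ℝ}

theorem continuous_osc (ha : Continuous a) (hb : Continuous b) (hF : Continuous F) :
    Continuous (osc ω a b F) := by
  have h1 : Continuous fun t => ∫ s in (0 : ℝ)..t, Real.cos (ω * s) * F s :=
    intervalIntegral.continuous_primitive (fun x y => (by fun_prop :
      Continuous fun s => Real.cos (ω * s) * F s).intervalIntegrable x y) 0
  have h2 : Continuous fun t => ∫ s in (0 : ℝ)..t, Real.sin (ω * s) * F s :=
    intervalIntegral.continuous_primitive (fun x y => (by fun_prop :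
      Continuous fun s => Real.sin (ω * s) * F s).intervalIntegrable x y) 0
  exact (ha.mul h1).add (hb.mul h2)

theorem hasDerivAt_osc {a' b' t : ℝ} (ha : HasDerivAt a a' t) (hb : HasDerivAt b b' t)
    (hF : Continuous F) : HasDerivAt (osc ω a b F)
      (a' * (∫ s in (0 : ℝ)..t, Real.cos (ω * s) * F s)
        + b' * (∫ s in (0 : ℝ)..t, Real.sin (ω * s) * F s)
        + (a t * Real.cos (ω * t) + b t * Real.sin (ω * t)) * F t) t := by
  have h1 : HasDerivAt (fun t => ∫ s in (0 : ℝ)..t, Real.cos (ω * s) * F s)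
      (Real.cos (ω * t) * F t) t :=
    (by fun_prop : Continuous fun s => Real.cos (ω * s) * F s).integral_hasStrictDerivAt 0 t
      |>.hasDerivAt
  have h2 : HasDerivAt (fun t => ∫ s in (0 : ℝ)..t, Real.sin (ω * s) * F s)
      (Real.sin (ω * t) * F t) t :=
    (by fun_prop : Continuous fun s => Real.sin (ω * s) * F s).integral_hasStrictDerivAt 0 t
      |>.hasDerivAt
  refine ((ha.mul h1).add (hb.mul h2)).congr_deriv ?_
  ring

theorem osc_add (hF : Continuous F) (hG : Continuous G) (t : ℝ) :
    osc ω a b (F + G) t = osc ω a b F t + osc ω a b G t := by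
  unfold osc
  simp only [Pi.add_apply, mul_add]
  rw [intervalIntegral.integral_add, intervalIntegral.integral_add]
  · ring
  all_goals exact Continuous.intervalIntegrable (by fun_prop) _ _

theorem osc_smul (c : ℝ) (t : ℝ) : osc ω a b (c • F) t = c * osc ω a b F t := by
  unfold osc
  simp only [Pi.smul_apply, smul_eq_mul, mul_left_comm _ c]
  rw [intervalIntegral.integral_const_mul, intervalIntegral.integral_const_mul]
  ring

theorem abs_osc_le {e t A B : ℝ} (hF : Continuous F) (hA : 0 < A)
    (he : ∀ s, |a t * Real.cos (ω * s) + b t * Real.sin (ω * s)| ≤ e)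
    (hFB : ∀ s, |s| ≤ |t| → |F s| ≤ B * Real.exp (A * |s|)) :
    |osc ω a b F t| ≤ e * B * (Real.exp (A * |t|) / A) := by
  have he0 : 0 ≤ e := (abs_nonneg _).trans (he 0)
  have hB0 : 0 ≤ B := by
    have h := (abs_nonneg _).trans (hFB 0 (by simp))
    simpa using h
  have h1 : osc ω a b F t
      = ∫ s in (0 : ℝ)..t, (a t * Real.cos (ω * s) + b t * Real.sin (ω * s)) * F s := by
    unfold osc
    rw [← intervalIntegral.integral_const_mul, ← intervalIntegral.integral_const_mul,
      ← intervalIntegral.integral_add]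
    · refine intervalIntegral.integral_congr fun s _ => ?_
      ring
    all_goals exact Continuous.intervalIntegrable (by fun_prop) _ _
  rw [h1]
  have h2 : ‖∫ s in (0 : ℝ)..t, (a t * Real.cos (ω * s) + b t * Real.sin (ω * s)) * F s‖
      ≤ |∫ s in (0 : ℝ)..t, e * B * Real.exp (A * |s|)| := by
    refine intervalIntegral.norm_integral_le_abs_of_norm_le ?_
      (Continuous.intervalIntegrable (by fun_prop) _ _)
    refine (MeasureTheory.ae_restrict_iff' measurableSet_uIoc).2
      (Filter.Eventually.of_forall fun s hs => ?_)
    have hst : |s| ≤ |t| := by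
      have h := abs_sub_left_of_mem_uIcc (uIoc_subset_uIcc hs)
      simpa using h
    rw [Real.norm_eq_abs, abs_mul, mul_assoc]
    exact mul_le_mul (he s) (hFB s hst) (abs_nonneg _) he0
  rw [intervalIntegral.integral_const_mul, abs_mul, abs_of_nonneg (mul_nonneg he0 hB0)] at h2
  exact h2.trans (mul_le_mul_of_nonneg_left (abs_integral_exp_abs_le hA t) (mul_nonneg he0 hB0))

end osc

namespace EllOne

variable {σ S M : ℝ}

theorem abs_osc_wt_le (hσ : 0 < σ) (hS : 0 < S) (hM : 0 < M) {i j n : ℕ} {ω e C : ℝ} {a b : ℝ → ℝ}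
    (he : ∀ t s, |a t * Real.cos (ω * s) + b t * Real.sin (ω * s)| ≤ e)
    (hC : e * ((n : ℝ) + 1) ^ j ≤ C * ((M + 2 * σ / S * n) * ((n : ℝ) + 1) ^ i))
    (c : ℝ →ᵇ ℝ) (t : ℝ) :
    |osc ω a b (fun s => wt σ S M i n s * c s) (clamp S t)| ≤ C * ‖c‖ * wt σ S M j n t := by
  have hA : 0 < M + 2 * σ / S * n := by positivity
  have htr : ∀ s, |s| ≤ |clamp S t| → trunc S s = |s| := fun s hs => by
    rw [abs_clamp hS] at hs
    exact min_eq_left (hs.trans (trunc_le S t))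
  have hexp : ∀ s, M * (trunc S s - S) - rate σ S s * n
      = (M + 2 * σ / S * n) * trunc S s + -(M * S + 4 * σ * n) := fun s => by unfold rate; ring
  refine (abs_osc_le (A := M + 2 * σ / S * n)
    (B := ‖c‖ * Real.exp (-(M * S + 4 * σ * n)) / ((n : ℝ) + 1) ^ i)
    (((wt σ S M i).cont n).mul c.continuous) hA (he _) fun s hs => ?_).trans ?_
  · show |wt σ S M i n s * c s| ≤ _
    rw [abs_mul, abs_of_pos ((wt σ S M i).pos n s), wt_apply, hexp, htr s hs, Real.exp_add]
    refine (mul_le_mul_of_nonneg_left (c.norm_coe_le_norm s) (by positivity)).trans (le_of_eq ?_)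
    ring
  · rw [wt_apply, hexp, abs_clamp hS, Real.exp_add]
    have h1 : e / ((M + 2 * σ / S * n) * ((n : ℝ) + 1) ^ i) ≤ C / ((n : ℝ) + 1) ^ j := by
      rw [div_le_div_iff₀ (by positivity) (by positivity)]
      exact hC
    have h2 := mul_le_mul_of_nonneg_right h1 (by positivity : 0 ≤ ‖c‖ *
      (Real.exp ((M + 2 * σ / S * n) * trunc S t) * Real.exp (-(M * S + 4 * σ * n))))
    refine le_trans (le_of_eq ?_) (h2.trans (le_of_eq ?_))
    · field_simp
    · ring

/-- A Duhamel integral at one frequency, in weighted form. -/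
noncomputable def oscCLM (hσ : 0 < σ) (hS : 0 < S) (hM : 0 < M) (i j n : ℕ) {ω e C : ℝ}
    {a b : ℝ → ℝ} (ha : Continuous a) (hb : Continuous b)
    (he : ∀ t s, |a t * Real.cos (ω * s) + b t * Real.sin (ω * s)| ≤ e)
    (hC : e * ((n : ℝ) + 1) ^ j ≤ C * ((M + 2 * σ / S * n) * ((n : ℝ) + 1) ^ i)) :
    (ℝ →ᵇ ℝ) →L[ℝ] (ℝ →ᵇ ℝ) :=
  have hbd : ∀ (c : ℝ →ᵇ ℝ) (t : ℝ),
      ‖osc ω a b (fun s => wt σ S M i n s * c s) (clamp S t) / wt σ S M j n t‖ ≤ C * ‖c‖ :=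
    fun c t => by
      rw [norm_div, Real.norm_eq_abs, Real.norm_eq_abs, abs_of_pos ((wt σ S M j).pos n t),
        div_le_iff₀ ((wt σ S M j).pos n t)]
      exact abs_osc_wt_le hσ hS hM he hC c t
  LinearMap.mkContinuous
    { toFun := fun c => BoundedContinuousFunction.ofNormedAddCommGroup
        (fun t => osc ω a b (fun s => wt σ S M i n s * c s) (clamp S t) / wt σ S M j n t)
        (((continuous_osc ha hb (((wt σ S M i).cont n).mul c.continuous)).comp
          (continuous_clamp S)).div ((wt σ S M j).cont n) fun t => ((wt σ S M j).pos n t).ne')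
        (C * ‖c‖) (hbd c)
      map_add' := fun c c' => by
        ext t
        have h := osc_add (ω := ω) (a := a) (b := b) (((wt σ S M i).cont n).mul c.continuous)
          (((wt σ S M i).cont n).mul c'.continuous) (clamp S t)
        have h2 : (fun s => wt σ S M i n s * (c + c') s)
            = (fun s => wt σ S M i n s * c s) + fun s => wt σ S M i n s * c' s := by
          ext s; simp [mul_add]
        show osc ω a b (fun s => wt σ S M i n s * (c + c') s) (clamp S t) / _ = _ / _ + _ / _
        rw [h2, ← add_div]
        exact congrArg (· / _) h
      map_smul' := fun r c => by
        ext t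
        have h2 : (fun s => wt σ S M i n s * (r • c) s) = r • fun s => wt σ S M i n s * c s := by
          ext s; simp [mul_left_comm]
        show osc ω a b (fun s => wt σ S M i n s * (r • c) s) (clamp S t) / _ = r • (_ / _)
        rw [h2, osc_smul, smul_eq_mul, mul_div_assoc] } C
    (fun c => BoundedContinuousFunction.norm_ofNormedAddCommGroup_le _
      ((norm_nonneg _).trans (hbd c 0)) (hbd c))

theorem oscCLM_apply (hσ : 0 < σ) (hS : 0 < S) (hM : 0 < M) (i j n : ℕ) {ω e C : ℝ}
    {a b : ℝ → ℝ} (ha : Continuous a) (hb : Continuous b)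
    (he : ∀ t s, |a t * Real.cos (ω * s) + b t * Real.sin (ω * s)| ≤ e)
    (hC : e * ((n : ℝ) + 1) ^ j ≤ C * ((M + 2 * σ / S * n) * ((n : ℝ) + 1) ^ i))
    (c : ℝ →ᵇ ℝ) (t : ℝ) : wt σ S M j n t * oscCLM hσ hS hM i j n ha hb he hC c t
      = osc ω a b (fun s => wt σ S M i n s * c s) (clamp S t) :=
  mul_div_cancel₀ _ ((wt σ S M j).pos n t).ne'

theorem norm_oscCLM_le (hσ : 0 < σ) (hS : 0 < S) (hM : 0 < M) (i j n : ℕ) {ω e C : ℝ}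
    {a b : ℝ → ℝ} (ha : Continuous a) (hb : Continuous b)
    (he : ∀ t s, |a t * Real.cos (ω * s) + b t * Real.sin (ω * s)| ≤ e)
    (hC : e * ((n : ℝ) + 1) ^ j ≤ C * ((M + 2 * σ / S * n) * ((n : ℝ) + 1) ^ i))
    (c : ℝ →ᵇ ℝ) : ‖oscCLM hσ hS hM i j n ha hb he hC c‖ ≤ C * ‖c‖ := by
  have hC0 : 0 ≤ C := by
    have h0 : 0 ≤ e := (abs_nonneg _).trans (he 0 0)
    by_contra hneg
    push Not at hneg
    have : C * ((M + 2 * σ / S * n) * ((n : ℝ) + 1) ^ i) < 0 :=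
      mul_neg_of_neg_of_pos hneg (by positivity)
    have : 0 ≤ e * ((n : ℝ) + 1) ^ j := by positivity
    linarith
  refine (BoundedContinuousFunction.norm_le (by positivity)).2 fun t => ?_
  have hw := (wt σ S M j).pos n t
  refine le_of_mul_le_mul_left ?_ hw
  rw [Real.norm_eq_abs, ← abs_of_pos hw, ← abs_mul, oscCLM_apply, abs_of_pos hw, mul_comm]
  exact abs_osc_wt_le hσ hS hM he hC c t

end EllOne

theorem exists_chebyshev_coef {f : ℝ → ℝ} (hf : AnalyticOnNhd ℝ f (Icc 0 1)) :
    ∃ σ₀ > 0, ∀ σ, 0 < σ → σ ≤ σ₀ → (∀ x ∈ nhdI σ, AnalyticAt ℝ f x) ∧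
      ∃ c : ℕ → ℝ, (∀ j : ℕ, Summable fun n => |c n| * (((n : ℝ) + 1) ^ j * Real.exp (4 * σ * n))) ∧
        ∀ x ∈ nhdI σ, f x = ∑' n, c n * chebT n (1 - 2 * x) := by
  obtain ⟨C, B, q, δ, hC, hB, hq0, hq1, hδ, h, hb, hs, -, -⟩ :=
    exists_chebyshev_taylor (ι := Fin 0) (F := fun x _ => f x)
      (fun x hx => (hf x hx).comp_of_eq analyticAt_fst rfl)
  obtain ⟨σ₁, hσ₁, hV⟩ := exists_nhdI_subset (isOpen_analyticAt ℝ f) hf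
  have hlog : 0 < -Real.log q := by
    have := Real.log_neg hq0 hq1
    linarith
  refine ⟨min σ₁ (-Real.log q / 8), by positivity, fun σ hσ hσ' => ?_⟩
  have h1 := hσ'.trans (min_le_left _ _)
  have h2 := hσ'.trans (min_le_right _ _)
  refine ⟨fun x hx => hV σ hσ h1 hx, fun n => h 0 Fin.elim0 n, ?_⟩
  have hqe : q * Real.exp (4 * σ) < 1 := by
    rw [← Real.exp_log hq0, ← Real.exp_add, Real.exp_lt_one_iff]
    linarith
  have hsum : ∀ j : ℕ, Summable fun n : ℕ => |h 0 Fin.elim0 n| *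
      (((n : ℝ) + 1) ^ j * Real.exp (4 * σ * n)) := fun j => by
    have h3 : Summable fun n : ℕ => ((n : ℝ) + 1) ^ j * (q * Real.exp (4 * σ)) ^ (n + 1) := by
      have h4 := summable_pow_mul_geometric_of_norm_lt_one j (r := q * Real.exp (4 * σ))
        (by rwa [Real.norm_eq_abs, abs_of_pos (by positivity)])
      have h5 := (summable_nat_add_iff 1).2 h4
      simpa using h5
    refine Summable.of_nonneg_of_le (fun n => by positivity) (fun n => ?_)
      (h3.mul_left (C * (q * Real.exp (4 * σ))⁻¹))
    have h4 := hb 0 Fin.elim0 n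
    calc _ ≤ C * B ^ 0 * q ^ n * (((n : ℝ) + 1) ^ j * Real.exp (4 * σ * n)) := by gcongr
      _ = _ := by
        rw [show 4 * σ * n = n * (4 * σ) by ring, Real.exp_nat_mul, pow_succ, mul_pow]
        have : q * Real.exp (4 * σ) ≠ 0 := by positivity
        field_simp
  refine ⟨hsum, fun x hx => ?_⟩
  have hσsum : Summable fun n => |h 0 Fin.elim0 n| * Real.exp (σ * n) := by
    refine Summable.of_nonneg_of_le (fun n => by positivity) (fun n => ?_) (hsum 0)
    rw [pow_zero, one_mul]
    gcongr
    nlinarith [mul_nonneg hσ.le (n.cast_nonneg (α := ℝ))]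
  refine AnalyticOnNhd.eqOn_of_preconnected_of_eventuallyEq (𝕜 := ℝ) (z₀ := 1 / 2)
    (fun y hy => hV σ hσ h1 hy)
    (fun y hy => analyticAt_chebyshev_series hσ hσsum hy) (convex_nhdI σ).isPreconnected
    (Icc_subset_nhdI hσ ⟨by norm_num, by norm_num⟩) ?_ hx
  filter_upwards [Icc_mem_nhds (by norm_num : (0 : ℝ) < 1 / 2) (by norm_num : (1 / 2 : ℝ) < 1)]
    with y hy
  have h6 := hs y hy 0 (by rw [norm_zero]; exact hδ)
  have hinj : Function.Injective fun n : ℕ =>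
      ((⟨0, Fin.elim0⟩, n) : (Σ k : ℕ, Fin k → Fin 0) × ℕ) := fun m n hmn => (Prod.ext_iff.1 hmn).2
  have h7 := (hinj.hasSum_iff (f := fun p : (Σ k : ℕ, Fin k → Fin 0) × ℕ =>
    h p.1.1 p.1.2 p.2 * chebT p.2 (1 - 2 * y) * ∏ i, (0 : Fin 0 → ℝ) (p.1.2 i)) ?_).2 h6
  · refine h7.tsum_eq.symm.trans (tsum_congr fun n => ?_)
    simp
  · rintro ⟨⟨k, w⟩, n⟩ hp
    rcases k with - | k
    · refine absurd ⟨n, ?_⟩ hp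
      have : w = Fin.elim0 := Subsingleton.elim _ _
      subst this
      rfl
    · exact (w 0).elim0

namespace EllOne

section mono

variable {ι : Type*} {w : Wt} (H : MulOK w w w) (Y Y' : ι → EllOne) (e : EllOne)

/-- A product of entries of `Y`, times `e`. -/
noncomputable def mono (l : List ι) : EllOne := l.foldr (fun i a => mul H (Y i) a) e

theorem norm_mono_le {r : ℝ} (hr : ∀ i, ‖Y i‖ ≤ r) (l : List ι) :
    ‖mono H Y e l‖ ≤ r ^ l.length * ‖e‖ := by
  induction l with
  | nil => simp [mono]
  | cons i l ih =>
    refine (norm_mul_le' H _ _).trans ?_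
    rw [List.length_cons, pow_succ', mul_assoc]
    exact mul_le_mul (hr i) ih (norm_nonneg _) ((norm_nonneg _).trans (hr i))

theorem norm_mono_sub_le {r δ : ℝ} (hr : ∀ i, ‖Y i‖ ≤ r) (hr' : ∀ i, ‖Y' i‖ ≤ r)
    (hδ : ∀ i, ‖Y i - Y' i‖ ≤ δ) (l : List ι) :
    ‖mono H Y e l - mono H Y' e l‖ ≤ l.length * r ^ (l.length - 1) * δ * ‖e‖ := by
  induction l with
  | nil => simp [mono]
  | cons i l ih =>
    have h1 : mono H Y e (i :: l) - mono H Y' e (i :: l)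
        = mul H (Y i - Y' i) (mono H Y e l) + mul H (Y' i) (mono H Y e l - mono H Y' e l) := by
      simp only [mono, List.foldr_cons, map_sub, _root_.sub_apply]
      abel
    have hr0 := (norm_nonneg _).trans (hr i)
    rw [h1]
    refine (norm_add_le _ _).trans ((add_le_add
      ((norm_mul_le' H _ _).trans (mul_le_mul (hδ i) (norm_mono_le H Y e hr l) (norm_nonneg _)
        ((norm_nonneg _).trans (hδ i))))
      ((norm_mul_le' H _ _).trans (mul_le_mul (hr' i) ih (norm_nonneg _) hr0))).trans
        (le_of_eq ?_))
    rcases l with - | ⟨m, l⟩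
    · simp
    · simp only [List.length_cons, Nat.add_sub_cancel]
      push_cast
      ring

theorem ev_mono {t z : ℝ} (hw : EvBound w z) (l : List ι) :
    ev w t z (mono H Y e l) = (l.map fun i => ev w t z (Y i)).prod * ev w t z e := by
  induction l with
  | nil => simp [mono]
  | cons i l ih =>
    rw [List.map_cons, List.prod_cons, mul_assoc, ← ih, ← ev_mul H hw hw hw]
    rfl

end mono

variable {σ S M : ℝ}

/-- The element whose value is a Chebyshev polynomial. -/
noncomputable def chebEl (hσ : 0 < σ) (hS : 0 < S) (hM : 0 ≤ M) (j n : ℕ) : EllOne :=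
  single n (invWt hσ hS hM j n)

theorem ev_chebEl (hσ : 0 < σ) (hS : 0 < S) (hM : 0 ≤ M) (j n : ℕ) (t z : ℝ) :
    ev (wt σ S M j) t z (chebEl hσ hS hM j n) = chebT n z := by
  rw [chebEl, ev_single, wt_mul_invWt, one_mul]

theorem summable_norm_chebEl (hσ : 0 < σ) (hS : 0 < S) (hM : 0 ≤ M) (j : ℕ) {q : ℝ} (hq0 : 0 < q)
    (hqe : q * Real.exp (4 * σ) < 1) : Summable fun n => q ^ n * ‖chebEl hσ hS hM j n‖ := by
  have h3 : Summable fun n : ℕ => ((n : ℝ) + 1) ^ j * (q * Real.exp (4 * σ)) ^ (n + 1) := by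
    have h4 := summable_pow_mul_geometric_of_norm_lt_one j (r := q * Real.exp (4 * σ))
      (by rwa [Real.norm_eq_abs, abs_of_pos (by positivity)])
    have h5 := (summable_nat_add_iff 1).2 h4
    simpa using h5
  refine Summable.of_nonneg_of_le (fun n => by positivity) (fun n => ?_)
    (h3.mul_left (Real.exp (M * S) * (q * Real.exp (4 * σ))⁻¹))
  rw [chebEl, norm_single]
  calc _ ≤ q ^ n * (Real.exp (M * S) * (((n : ℝ) + 1) ^ j * Real.exp (4 * σ * n))) := by
        gcongr
        exact norm_invWt_le hσ hS hM j n
    _ = _ := by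
      rw [show 4 * σ * n = n * (4 * σ) by ring, Real.exp_nat_mul, pow_succ, mul_pow]
      have : q * Real.exp (4 * σ) ≠ 0 := by positivity
      field_simp

end EllOne

section words

variable {ι : Type} [Fintype ι] {C B q r : ℝ} {h : ∀ k : ℕ, (Fin k → ι) → ℕ → ℝ}

theorem summable_words_prod {E : ℕ → ℝ} (hE0 : ∀ n, 0 ≤ E n)
    (hE : Summable fun n => q ^ n * E n) (hC : 0 ≤ C) (hB : 0 ≤ B) (hq : 0 ≤ q) (hr : 0 ≤ r)
    (hr1 : Fintype.card ι * (B * r) < 1) (hb : ∀ k w n, |h k w n| ≤ C * B ^ k * q ^ n) (s : ℕ) :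
    Summable fun p : (Σ k : ℕ, Fin k → ι) × ℕ =>
      |h p.1.1 p.1.2 p.2| * ((p.1.1 : ℝ) ^ s * r ^ p.1.1) * E p.2 := by
  have h1 : Summable fun k : ℕ => (Fintype.card ι : ℝ) ^ k * ((k : ℝ) ^ s * (B * r) ^ k) := by
    refine (summable_pow_mul_geometric_of_norm_lt_one s (r := Fintype.card ι * (B * r)) ?_).congr
      fun k => ?_
    · rwa [Real.norm_eq_abs, abs_of_nonneg (by positivity)]
    · rw [mul_pow]; ring
  have h2 := ((summable_words (ι := ι) (a := fun k => (k : ℝ) ^ s * (B * r) ^ k)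
    (fun k => by positivity) h1).mul_of_nonneg hE
    (fun _ => by dsimp only; positivity)
    (fun n => mul_nonneg (pow_nonneg hq n) (hE0 n))).mul_left C
  refine Summable.of_nonneg_of_le (fun p => mul_nonneg (by positivity) (hE0 _)) (fun p => ?_) h2
  have h3 := hb p.1.1 p.1.2 p.2
  have h4 := hE0 p.2
  calc _ ≤ C * B ^ p.1.1 * q ^ p.2 * ((p.1.1 : ℝ) ^ s * r ^ p.1.1) * E p.2 := by gcongr
    _ = _ := by rw [mul_pow]; ring

theorem analyticAt_chebyshev_double_series {W : Type*} {σ : ℝ} (hσ : 0 < σ) {g : W → ℕ → ℝ}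
    (hg : Summable fun p : W × ℕ => |g p.1 p.2| * Real.exp (σ * p.2)) {x : ℝ} (hx : x ∈ nhdI σ) :
    AnalyticAt ℝ (fun x => ∑' p : W × ℕ, g p.1 p.2 * chebT p.2 (1 - 2 * x)) x := by
  have hswap : Summable fun a : ℕ × W => |g a.2 a.1| * Real.exp (σ * a.1) :=
    (Equiv.prodComm ℕ W).summable_iff.2 hg
  have hn : ∀ n, Summable fun p => |g p n| := fun n =>
    (summable_mul_right_iff (Real.exp_pos (σ * n)).ne').1 (hswap.prod_factor n)
  have hprod : Summable fun n : ℕ => (∑' p, |g p n|) * Real.exp (σ * n) := by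
    simpa only [tsum_mul_right] using hswap.prod
  have hc : Summable fun n : ℕ => |∑' p, g p n| * Real.exp (σ * n) := by
    refine Summable.of_nonneg_of_le (fun n => by positivity) (fun n => ?_) hprod
    have h1 : |∑' p, g p n| ≤ ∑' p, |g p n| := by
      have := norm_tsum_le_tsum_norm (f := fun p => g p n) (hn n)
      simpa only [Real.norm_eq_abs] using this
    gcongr
  refine (analyticAt_chebyshev_series hσ hc hx).congr ?_
  filter_upwards [(isOpen_nhdI σ).mem_nhds hx] with y hy
  have hs : Summable fun a : ℕ × W => g a.2 a.1 * chebT a.1 (1 - 2 * y) := by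
    refine Summable.of_norm_bounded hswap fun a => ?_
    rw [norm_mul]
    exact mul_le_mul_of_nonneg_left (abs_chebT_le hσ hy _) (norm_nonneg _)
  rw [← (Equiv.prodComm ℕ W).tsum_eq]
  simp only [Equiv.prodComm_apply, Prod.swap]
  rw [hs.tsum_prod]
  exact tsum_congr fun n => tsum_mul_right.symm

theorem analyticAt_words {σ : ℝ} (hσ : 0 < σ) (hC : 0 ≤ C) (hB : 0 ≤ B) (hq : 0 ≤ q) (hr : 0 ≤ r)
    (hqe : q * Real.exp σ < 1)
    (hr1 : Fintype.card ι * (B * r) < 1) (hb : ∀ k w n, |h k w n| ≤ C * B ^ k * q ^ n)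
    {Y : ι → ℝ} (hY : ‖Y‖ ≤ r) {x : ℝ} (hx : x ∈ nhdI σ) :
    AnalyticAt ℝ (fun x => ∑' p : (Σ k : ℕ, Fin k → ι) × ℕ,
      h p.1.1 p.1.2 p.2 * chebT p.2 (1 - 2 * x) * ∏ i, Y (p.1.2 i)) x := by
  have hYr : ∀ p : Σ k : ℕ, Fin k → ι, |∏ i, Y (p.2 i)| ≤ r ^ p.1 := fun p => by
    rw [Finset.abs_prod]
    refine (Finset.prod_le_prod (fun _ _ => abs_nonneg _)
      (fun i _ => (norm_le_pi_norm Y (p.2 i)).trans hY)).trans (le_of_eq ?_)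
    simp
  have hsum : Summable fun p : (Σ k : ℕ, Fin k → ι) × ℕ =>
      |h p.1.1 p.1.2 p.2| * r ^ p.1.1 * Real.exp (σ * p.2) := by
    have hE : Summable fun n : ℕ => q ^ n * Real.exp (σ * n) := by
      refine (summable_geometric_of_lt_one (by positivity) hqe).congr fun n => ?_
      rw [mul_pow, mul_comm σ, Real.exp_nat_mul]
    simpa using summable_words_prod (E := fun n => Real.exp (σ * n)) (fun n => (Real.exp_pos _).le)
      hE hC hB hq hr hr1 hb 0
  have hcs : Summable fun p : (Σ k : ℕ, Fin k → ι) × ℕ =>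
      |h p.1.1 p.1.2 p.2 * ∏ i, Y (p.1.2 i)| * Real.exp (σ * p.2) := by
    refine Summable.of_nonneg_of_le (fun p => by positivity) (fun p => ?_) hsum
    rw [abs_mul]
    have := hYr p.1
    gcongr
  refine (analyticAt_chebyshev_double_series
    (g := fun (p : Σ k : ℕ, Fin k → ι) n => h p.1 p.2 n * ∏ i, Y (p.2 i)) hσ hcs hx).congr
    (Filter.Eventually.of_forall fun y => ?_)
  dsimp only
  exact tsum_congr fun a => mul_right_comm _ _ _

end words

open EllOne in
/-- Substitution of Chebyshev series into an analytic function vanishing to second order. -/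
theorem exists_substitution {ι : Type} [Fintype ι] [DecidableEq ι] {F : ℝ → (ι → ℝ) → ℝ}
    (hF : ∀ x ∈ Icc (0 : ℝ) 1, AnalyticAt ℝ (fun p : ℝ × (ι → ℝ) => F p.1 p.2) (x, 0))
    (hF0 : ∀ x ∈ Icc (0 : ℝ) 1, F x 0 = 0)
    (hF1 : ∀ x ∈ Icc (0 : ℝ) 1, ∀ i, deriv (fun s => F x (Pi.single i s)) 0 = 0) :
    ∃ σ₀ > 0, ∃ δ > 0, ∀ σ, 0 < σ → σ ≤ σ₀ →
      (∀ x ∈ nhdI σ, ∀ Y : ι → ℝ, ‖Y‖ < δ →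
        AnalyticAt ℝ (fun p : ℝ × (ι → ℝ) => F p.1 p.2) (x, Y)) ∧
      ∀ S > 0, ∀ M ≥ 0, ∀ j : ℕ, ∃ 𝒩 : (ι → EllOne) → EllOne, ∃ K > 0, ∃ r₀ > 0, r₀ < δ ∧
        𝒩 0 = 0 ∧
        (∀ r, 0 ≤ r → r ≤ r₀ → ∀ Y Y', ‖Y‖ ≤ r → ‖Y'‖ ≤ r → ‖𝒩 Y - 𝒩 Y'‖ ≤ K * r * ‖Y - Y'‖) ∧
        ∀ Y, ‖Y‖ ≤ r₀ → ∀ t, ∀ x ∈ nhdI σ, ev (wt σ S M j) t (1 - 2 * x) (𝒩 Y)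
          = F x fun i => ev (wt σ S M j) t (1 - 2 * x) (Y i) := by
  obtain ⟨C, B, q, δ, hC, hB, hq0, hq1, hδ, h, hb, hs, hh0, hh1⟩ := exists_chebyshev_taylor hF
  replace hh0 := hh0 hF0
  replace hh1 := hh1 hF1
  obtain ⟨u, v, hu, hv, hIu, h0v, huv⟩ := generalized_tube_lemma (isCompact_Icc (a := (0 : ℝ)) (b := 1))
    (isCompact_singleton (x := (0 : ι → ℝ)))
    (isOpen_analyticAt ℝ fun p : ℝ × (ι → ℝ) => F p.1 p.2) (fun p hp => by
      obtain ⟨x, Y⟩ := p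
      have hY : Y = 0 := hp.2
      subst hY
      exact hF x hp.1)
  obtain ⟨δ', hδ', hball⟩ := Metric.isOpen_iff.1 hv 0 (h0v rfl)
  obtain ⟨σ₁, hσ₁, hV⟩ := exists_nhdI_subset hu hIu
  have hlog : 0 < -Real.log q := by
    have := Real.log_neg hq0 hq1
    linarith
  refine ⟨min σ₁ (-Real.log q / 8), by positivity, min δ δ', by positivity,
    fun σ hσ hσ' => ?_⟩
  have hσ1 := hσ'.trans (min_le_left _ _)
  have hσ2 := hσ'.trans (min_le_right _ _)
  have hqe : q * Real.exp (4 * σ) < 1 := by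
    rw [← Real.exp_log hq0, ← Real.exp_add, Real.exp_lt_one_iff]
    linarith
  have hqe' : q * Real.exp σ < 1 :=
    (mul_le_mul_of_nonneg_left (Real.exp_le_exp.2 (by linarith)) hq0.le).trans_lt hqe
  have hFan : ∀ x ∈ nhdI σ, ∀ Y : ι → ℝ, ‖Y‖ < min δ δ' →
      AnalyticAt ℝ (fun p : ℝ × (ι → ℝ) => F p.1 p.2) (x, Y) := fun x hx Y hY =>
    huv ⟨hV σ hσ hσ1 hx, hball (by
      rw [mem_ball_zero_iff]
      exact hY.trans_le (min_le_right _ _))⟩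
  refine ⟨hFan, fun S hS M hM j => ?_⟩
  have H : MulOK (wt σ S M j) (wt σ S M j) (wt σ S M j) :=
    wt_mulOK hσ hS (by linarith) le_rfl le_rfl
  set r₀ : ℝ := min (min δ δ' / 2) (1 / (2 * (Fintype.card ι + 1) * B)) with hr₀
  have hr₀0 : 0 < r₀ := by positivity
  have hr₀δ : r₀ < min δ δ' := by
    have : 0 < min δ δ' := by positivity
    exact (min_le_left _ _).trans_lt (by linarith)
  have hr₀1 : Fintype.card ι * (B * r₀) < 1 := by
    have h1 : r₀ ≤ 1 / (2 * (Fintype.card ι + 1) * B) := min_le_right _ _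
    rw [le_div_iff₀ (by positivity)] at h1
    have h2 : 0 < B * r₀ := by positivity
    nlinarith
  set E : ℕ → EllOne := chebEl hσ hS hM j with hEdef
  have hE : Summable fun n => q ^ n * ‖E n‖ := summable_norm_chebEl hσ hS hM j hq0 hqe
  have hsum := fun s => summable_words_prod (fun n => norm_nonneg (E n)) hE hC.le hB.le hq0.le
    hr₀0.le hr₀1 hb s
  set term : (ι → EllOne) → (Σ k : ℕ, Fin k → ι) × ℕ → EllOne := fun Y p =>
    h p.1.1 p.1.2 p.2 • mono H Y (E p.2) (List.ofFn p.1.2) with hterm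
  have htsum : ∀ Y, ‖Y‖ ≤ r₀ → Summable (term Y) := fun Y hY => by
    refine Summable.of_norm_bounded (hsum 0) fun p => ?_
    have h1 := norm_mono_le H Y (E p.2) (fun i => (norm_le_pi_norm Y i).trans hY) (List.ofFn p.1.2)
    rw [List.length_ofFn] at h1
    rw [hterm, norm_smul, Real.norm_eq_abs, pow_zero, one_mul, mul_assoc]
    exact mul_le_mul_of_nonneg_left h1 (abs_nonneg _)
  refine ⟨fun Y => ∑' p, term Y p,
    (∑' p : (Σ k : ℕ, Fin k → ι) × ℕ,
      |h p.1.1 p.1.2 p.2| * ((p.1.1 : ℝ) ^ 1 * r₀ ^ p.1.1) * ‖E p.2‖) / r₀ ^ 2 + 1, ?_, r₀, hr₀0,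
    hr₀δ, ?_, ?_, ?_⟩
  · refine add_pos_of_nonneg_of_pos (div_nonneg (tsum_nonneg fun p => by positivity)
      (by positivity)) one_pos
  · refine (tsum_congr fun p => ?_).trans tsum_zero
    obtain ⟨⟨k, w⟩, n⟩ := p
    rcases k with - | k
    · simp only [hterm, hh0, zero_smul]
    · simp [hterm, mono]
  · intro r hr hrr₀ Y Y' hY hY'
    rw [← (htsum Y (hY.trans hrr₀)).tsum_sub (htsum Y' (hY'.trans hrr₀))]
    have key : ∀ p, ‖term Y p - term Y' p‖ ≤ |h p.1.1 p.1.2 p.2| *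
        ((p.1.1 : ℝ) ^ 1 * r₀ ^ p.1.1) * ‖E p.2‖ * (r / r₀ ^ 2 * ‖Y - Y'‖) := by
      rintro ⟨⟨k, w⟩, n⟩
      rcases k with - | - | k
      · simp [hterm, hh0]
      · simp [hterm, hh1]
      · have h1 := norm_mono_sub_le H Y Y' (E n) (fun i => (norm_le_pi_norm Y i).trans hY)
          (fun i => (norm_le_pi_norm Y' i).trans hY') (fun i => norm_le_pi_norm (Y - Y') i)
          (List.ofFn w)
        rw [List.length_ofFn] at h1
        simp only [hterm]
        rw [← smul_sub, norm_smul, Real.norm_eq_abs]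
        refine (mul_le_mul_of_nonneg_left h1 (abs_nonneg _)).trans ?_
        have h2 : r ^ (k + 1 + 1 - 1) ≤ r₀ ^ k * r := by
          rw [Nat.add_sub_cancel, pow_succ]
          gcongr
        calc _ ≤ |h (k + 1 + 1) w n| * (((k + 1 + 1 : ℕ) : ℝ) * (r₀ ^ k * r) * ‖Y - Y'‖ * ‖E n‖) := by
              gcongr
          _ = _ := by
              have e : r₀ ^ (k + 1 + 1) * (r / r₀ ^ 2 * ‖Y - Y'‖) = r₀ ^ k * r * ‖Y - Y'‖ := by
                have := hr₀0.ne'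
                field_simp
                ring
              linear_combination (-|h (k + 1 + 1) w n| * ((k + 1 + 1 : ℕ) : ℝ) * ‖E n‖) * e
    refine (tsum_of_norm_bounded ((hsum 1).mul_right _).hasSum key).trans ?_
    rw [tsum_mul_right]
    have : 0 ≤ r * ‖Y - Y'‖ := by positivity
    calc _ = (∑' p : (Σ k : ℕ, Fin k → ι) × ℕ,
          |h p.1.1 p.1.2 p.2| * ((p.1.1 : ℝ) ^ 1 * r₀ ^ p.1.1) * ‖E p.2‖) / r₀ ^ 2
            * (r * ‖Y - Y'‖) := by ring
      _ ≤ _ := by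
          rw [mul_assoc]
          exact mul_le_mul_of_nonneg_right (by linarith) this
  · intro Y hY t x hx
    have hev := fun {y : ℝ} (hy : y ∈ nhdI σ) => (decays_wt hσ hS hM j).evBound hσ hy
    have h1 := (htsum Y hY).hasSum.mapL (evCLM (wt σ S M j) t (1 - 2 * x) (hev hx))
    simp only [evCLM_apply] at h1
    set z : ι → ℝ := fun i => ev (wt σ S M j) t (1 - 2 * x) (Y i) with hz
    have hzr : ‖z‖ ≤ r₀ := (pi_norm_le_iff_of_nonneg hr₀0.le).2 fun i =>
      ((abs_ev_le (hev hx) (Y i)).trans (norm_le_pi_norm Y i)).trans hY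
    have hzδ : ‖z‖ < min δ δ' := hzr.trans_lt hr₀δ
    rw [← h1.tsum_eq]
    have h2 : ∀ p, ev (wt σ S M j) t (1 - 2 * x) (term Y p)
        = h p.1.1 p.1.2 p.2 * chebT p.2 (1 - 2 * x) * ∏ i, z (p.1.2 i) := fun p => by
      simp only [hterm]
      rw [ev_smul (hev hx), ev_mono H _ _ (hev hx), hEdef, ev_chebEl, List.map_ofFn,
        List.prod_ofFn]
      simp only [Function.comp_apply, hz]
      ring
    rw [tsum_congr h2]
    refine AnalyticOnNhd.eqOn_of_preconnected_of_eventuallyEq (𝕜 := ℝ) (z₀ := 1 / 2)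
      (U := nhdI σ) (g := fun x => F x z)
      (fun y hy => analyticAt_words hσ hC.le hB.le hq0.le hr₀0.le hqe' hr₀1 hb hzr hy)
      (fun y hy => ?_) (convex_nhdI σ).isPreconnected
      (Icc_subset_nhdI hσ ⟨by norm_num, by norm_num⟩) ?_ hx
    · exact (hFan y hy z hzδ).comp_of_eq (analyticAt_id.prod analyticAt_const) rfl
    · filter_upwards [Icc_mem_nhds (by norm_num : (0 : ℝ) < 1 / 2) (by norm_num : (1 / 2 : ℝ) < 1)]
        with y hy
      exact (hs y hy z (hzδ.trans_le (min_le_left _ _))).tsum_eq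

namespace EllOne

variable {σ S M : ℝ}

/-- Duhamel integrals at all frequencies. -/
noncomputable def oscOp (hσ : 0 < σ) (hS : 0 < S) (hM : 0 < M) (i j : ℕ) {e : ℕ → ℝ} {C : ℝ}
    {a b : ℕ → ℝ → ℝ} (ha : ∀ n, Continuous (a n)) (hb : ∀ n, Continuous (b n))
    (he : ∀ (n : ℕ) t s, |a n t * Real.cos ((n + 1) * s) + b n t * Real.sin ((n + 1) * s)| ≤ e n)
    (hC : ∀ n : ℕ, e n * ((n : ℝ) + 1) ^ j ≤ C * ((M + 2 * σ / S * n) * ((n : ℝ) + 1) ^ i)) :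
    EllOne →L[ℝ] EllOne :=
  diagLift (fun n => oscCLM hσ hS hM i j n (ha n) (hb n) (he n) (hC n)) C
    (fun n => norm_oscCLM_le hσ hS hM i j n (ha n) (hb n) (he n) (hC n))

theorem exists_duhamel (hσ : 0 < σ) (hS : 0 < S) (hM : 0 < M) (i j : ℕ) {e : ℕ → ℝ} {C : ℝ}
    {a b a' b' d : ℕ → ℝ → ℝ} (ha : ∀ n t, HasDerivAt (a n) (a' n t) t)
    (hb : ∀ n t, HasDerivAt (b n) (b' n t) t)
    (hd : ∀ (n : ℕ) t, a n t * Real.cos ((n + 1) * t) + b n t * Real.sin ((n + 1) * t) = d n t)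
    (he : ∀ (n : ℕ) t s, |a n t * Real.cos ((n + 1) * s) + b n t * Real.sin ((n + 1) * s)| ≤ e n)
    (hC : ∀ n : ℕ, e n * ((n : ℝ) + 1) ^ j ≤ C * ((M + 2 * σ / S * n) * ((n : ℝ) + 1) ^ i)) :
    ∃ P : EllOne →L[ℝ] EllOne, (∀ f, ‖P f‖ ≤ C * ‖f‖) ∧ (∀ f n, P f n 0 = 0) ∧
      ∀ f n, ∀ t ∈ Ioo (-S) S,
        wt σ S M j n t * P f n t = osc (n + 1) (a n) (b n) (fun s => wt σ S M i n s * f n s) t ∧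
        HasDerivAt (fun t => wt σ S M j n t * P f n t)
          (osc (n + 1) (a' n) (b' n) (fun s => wt σ S M i n s * f n s) t
            + d n t * (wt σ S M i n t * f n t)) t := by
  have ha0 : ∀ n, Continuous (a n) := fun n =>
    continuous_iff_continuousAt.2 fun t => (ha n t).continuousAt
  have hb0 : ∀ n, Continuous (b n) := fun n =>
    continuous_iff_continuousAt.2 fun t => (hb n t).continuousAt
  have key : ∀ f n t, wt σ S M j n t * oscOp hσ hS hM i j ha0 hb0 he hC f n t
      = osc (n + 1) (a n) (b n) (fun s => wt σ S M i n s * f n s) (clamp S t) := fun f n t => by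
    rw [oscOp, diagLift_apply, oscCLM_apply]
  refine ⟨oscOp hσ hS hM i j ha0 hb0 he hC, norm_diagLift_le _ _ _, fun f n => ?_,
    fun f n t ht => ⟨?_, ?_⟩⟩
  · have h := key f n 0
    rw [clamp_of_mem ⟨by linarith, hS⟩] at h
    simp only [osc, intervalIntegral.integral_same, mul_zero, add_zero] at h
    exact (mul_eq_zero.1 h).resolve_left ((wt σ S M j).pos n 0).ne'
  · rw [key, clamp_of_mem ht]
  · have h := hasDerivAt_osc (ω := n + 1) (ha n t) (hb n t)
      (((wt σ S M i).cont n).mul (f n).continuous)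
    rw [hd] at h
    refine h.congr_of_eventuallyEq ?_
    filter_upwards [isOpen_Ioo.mem_nhds ht] with s hs
    rw [key, clamp_of_mem hs]
    rfl

/-- The square of the frequency. -/
noncomputable def freqSq (σ S M : ℝ) : EllOne →L[ℝ] EllOne :=
  diagOp (wt σ S M 2) (wt σ S M 0) (fun n => ((n : ℝ) + 1) ^ 2) 1 (fun n t => by
    rw [abs_of_nonneg (by positivity), one_mul, wt_apply, wt_apply, pow_zero, div_one]
    exact (mul_div_cancel₀ _ (by positivity)).le)

theorem wt_mul_freqSq (a : EllOne) (n : ℕ) (t : ℝ) :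
    wt σ S M 0 n t * freqSq σ S M a n t = ((n : ℝ) + 1) ^ 2 * (wt σ S M 2 n t * a n t) := by
  rw [freqSq, mul_diagOp_apply]

theorem hasDerivAt_cos_mul (c t : ℝ) :
    HasDerivAt (fun t => Real.cos (c * t)) (-(c * Real.sin (c * t))) t := by
  refine ((Real.hasDerivAt_cos _).comp t ((hasDerivAt_id t).const_mul c)).congr_deriv ?_
  simp; ring

theorem hasDerivAt_sin_mul (c t : ℝ) :
    HasDerivAt (fun t => Real.sin (c * t)) (c * Real.cos (c * t)) t := by
  refine ((Real.hasDerivAt_sin _).comp t ((hasDerivAt_id t).const_mul c)).congr_deriv ?_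
  simp; ring

/-- Solution operators for the diagonal part of the linearised system. -/
theorem exists_propagator (hσ : 0 < σ) (hS : 0 < S) (hM : 2 * σ / S ≤ M) :
    ∃ Pf Pg Ph Qf Qg Qh : EllOne →L[ℝ] EllOne,
      (∀ a, ‖Pf a‖ ≤ S / (2 * σ) * ‖a‖) ∧ (∀ a, ‖Pg a‖ ≤ S / (2 * σ) * ‖a‖) ∧
      (∀ a, ‖Ph a‖ ≤ 1 / M * ‖a‖) ∧ (∀ a, ‖Qf a‖ ≤ S / (2 * σ) * ‖a‖) ∧
      (∀ a, ‖Qg a‖ ≤ S / (2 * σ) * ‖a‖) ∧ (∀ a, ‖Qh a‖ ≤ 1 / M * ‖a‖) ∧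
      ∀ f g h p q : EllOne, p = Pf f + Pg g + Ph h → q = Qf f + Qg g + Qh h →
        (∀ n, p n 0 = 0) ∧ (∀ n, q n 0 = 0) ∧
        ∀ n, ∀ t ∈ Ioo (-S) S,
          HasDerivAt (fun t => wt σ S M 2 n t * p n t) (wt σ S M 1 n t * (q + f) n t) t ∧
          HasDerivAt (fun t => wt σ S M 1 n t * q n t)
            (wt σ S M 0 n t * (g + incl σ S M zero_le_one h - freqSq σ S M p) n t) t := by
  have hκ : 0 < 2 * σ / S := by positivity
  have hM0 : 0 < M := hκ.trans_le hM
  have hSσ : S / (2 * σ) = 1 / (2 * σ / S) := by rw [one_div_div]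
  have hω : ∀ n : ℕ, (0 : ℝ) < n + 1 := fun n => by positivity
  have hc : ∀ (n : ℕ) t, HasDerivAt (fun t => Real.cos ((n + 1) * t))
    (-((n + 1) * Real.sin ((n + 1) * t))) t := fun n t => hasDerivAt_cos_mul _ _
  have hs : ∀ (n : ℕ) t, HasDerivAt (fun t => Real.sin ((n + 1) * t))
    ((n + 1) * Real.cos ((n + 1) * t)) t := fun n t => hasDerivAt_sin_mul _ _
  have hcc : ∀ ω t s : ℝ, |Real.cos (ω * t) * Real.cos (ω * s) + Real.sin (ω * t) * Real.sin (ω * s)|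
      ≤ 1 := fun ω t s => by rw [← Real.cos_sub]; exact Real.abs_cos_le_one _
  have hsc : ∀ ω t s : ℝ, |Real.sin (ω * t) * Real.cos (ω * s) - Real.cos (ω * t) * Real.sin (ω * s)|
      ≤ 1 := fun ω t s => by rw [← Real.sin_sub]; exact Real.abs_sin_le_one _
  have hκn : ∀ n : ℕ, 2 * σ / S * (n + 1) ≤ M + 2 * σ / S * n := fun n => by linarith
  have hMn : ∀ n : ℕ, M ≤ M + 2 * σ / S * n := fun n => by
    have : 0 ≤ 2 * σ / S * n := by positivity
    linarith
  have hd1 : ∀ (n : ℕ) (t : ℝ), Real.cos ((n + 1) * t) * Real.cos ((n + 1) * t)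
      + Real.sin ((n + 1) * t) * Real.sin ((n + 1) * t) = 1 := fun n t => by
    linear_combination Real.cos_sq_add_sin_sq ((n + 1) * t)
  -- kernels of the four types
  have kc := fun (i j : ℕ) (C : ℝ) hC => exists_duhamel hσ hS hM0 i j (e := fun _ => 1) (C := C)
    (d := fun _ _ => 1) hc hs hd1 (fun n t s => hcc _ t s) hC
  have ks := fun (i j : ℕ) (C : ℝ) hC => exists_duhamel hσ hS hM0 i j
    (e := fun n => 1 / ((n : ℝ) + 1)) (C := C) (d := fun _ _ => 0)
    (a := fun n t => Real.sin ((n + 1) * t) / (n + 1))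
    (b := fun n t => -(Real.cos ((n + 1) * t) / (n + 1)))
    (a' := fun n t => Real.cos ((n + 1) * t)) (b' := fun n t => Real.sin ((n + 1) * t))
    (fun n t => ((hs n t).div_const _).congr_deriv (by have := (hω n).ne'; field_simp))
    (fun n t => ((hc n t).div_const _).neg.congr_deriv (by have := (hω n).ne'; field_simp))
    (fun n t => by ring)
    (fun n t s => by
      have h1 : Real.sin ((n + 1) * t) / (n + 1) * Real.cos ((n + 1) * s)
          + -(Real.cos ((n + 1) * t) / (n + 1)) * Real.sin ((n + 1) * s)
          = (Real.sin ((n + 1) * t) * Real.cos ((n + 1) * s)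
            - Real.cos ((n + 1) * t) * Real.sin ((n + 1) * s)) / (n + 1) := by ring
      rw [h1, abs_div, abs_of_pos (hω n)]
      exact div_le_div_of_nonneg_right (hsc _ t s) (hω n).le) hC
  have kq := fun (i j : ℕ) (C : ℝ) hC => exists_duhamel hσ hS hM0 i j
    (e := fun n => (n : ℝ) + 1) (C := C) (d := fun _ _ => 0)
    (a := fun n t => -((n + 1) * Real.sin ((n + 1) * t)))
    (b := fun n t => (n + 1) * Real.cos ((n + 1) * t))
    (a' := fun n t => -((n + 1) ^ 2 * Real.cos ((n + 1) * t)))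
    (b' := fun n t => -((n + 1) ^ 2 * Real.sin ((n + 1) * t)))
    (fun n t => ((hs n t).const_mul _).neg.congr_deriv (by ring))
    (fun n t => ((hc n t).const_mul _).congr_deriv (by ring))
    (fun n t => by ring)
    (fun n t s => by
      have h1 : -((n + 1) * Real.sin ((n + 1) * t)) * Real.cos ((n + 1) * s)
          + (n + 1) * Real.cos ((n + 1) * t) * Real.sin ((n + 1) * s)
          = -((n + 1) * (Real.sin ((n + 1) * t) * Real.cos ((n + 1) * s)
            - Real.cos ((n + 1) * t) * Real.sin ((n + 1) * s))) := by ring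
      rw [h1, abs_neg, abs_mul, abs_of_pos (hω n)]
      exact mul_le_of_le_one_right (hω n).le (hsc _ t s)) hC
  obtain ⟨Pf, hPf, hPf0, hPfd⟩ := kc 1 2 (S / (2 * σ)) (fun n => by
    rw [hSσ, div_mul_eq_mul_div, le_div_iff₀ hκ]
    nlinarith [mul_le_mul_of_nonneg_right (hκn n) (hω n).le])
  obtain ⟨Qg, hQg, hQg0, hQgd⟩ := kc 0 1 (S / (2 * σ)) (fun n => by
    rw [hSσ, div_mul_eq_mul_div, le_div_iff₀ hκ]
    nlinarith [hκn n])
  obtain ⟨Qh, hQh, hQh0, hQhd⟩ := kc 1 1 (1 / M) (fun n => by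
    rw [div_mul_eq_mul_div, le_div_iff₀ hM0]
    nlinarith [mul_le_mul_of_nonneg_right (hMn n) (hω n).le])
  have he : ∀ n : ℕ, 1 / ((n : ℝ) + 1) * ((n : ℝ) + 1) ^ 2 = n + 1 := fun n => by
    have := (hω n).ne'
    field_simp
  obtain ⟨Pg, hPg, hPg0, hPgd⟩ := ks 0 2 (S / (2 * σ)) (fun n => by
    rw [he n, hSσ, div_mul_eq_mul_div, le_div_iff₀ hκ]
    nlinarith [hκn n])
  obtain ⟨Ph, hPh, hPh0, hPhd⟩ := ks 1 2 (1 / M) (fun n => by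
    rw [he n, div_mul_eq_mul_div, le_div_iff₀ hM0]
    nlinarith [mul_le_mul_of_nonneg_right (hMn n) (hω n).le])
  obtain ⟨Qf, hQf, hQf0, hQfd⟩ := kq 1 1 (S / (2 * σ)) (fun n => by
    rw [hSσ, div_mul_eq_mul_div, le_div_iff₀ hκ]
    nlinarith [mul_le_mul_of_nonneg_right (hκn n) (hω n).le])
  refine ⟨Pf, Pg, Ph, Qf, Qg, Qh, hPf, hPg, hPh, hQf, hQg, hQh, ?_⟩
  rintro f g h p q rfl rfl
  refine ⟨fun n => ?_, fun n => ?_, fun n t ht => ⟨?_, ?_⟩⟩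
  · simp [hPf0, hPg0, hPh0]
  · simp [hQf0, hQg0, hQh0]
  · have h1 := (((hPfd f n t ht).2.add (hPgd g n t ht).2).add (hPhd h n t ht).2)
    refine (h1.congr_of_eventuallyEq (Filter.Eventually.of_forall fun s => ?_)).congr_deriv ?_
    · simp only [add_apply, BoundedContinuousFunction.coe_add, Pi.add_apply]
      ring
    · have e1 := (hQfd f n t ht).1
      have e2 := (hQgd g n t ht).1
      have e3 := (hQhd h n t ht).1
      simp only [add_apply, BoundedContinuousFunction.coe_add, Pi.add_apply, mul_add, e1, e2, e3]
      simp only [osc]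
      ring
  · have h1 := (((hQfd f n t ht).2.add (hQgd g n t ht).2).add (hQhd h n t ht).2)
    refine (h1.congr_of_eventuallyEq (Filter.Eventually.of_forall fun s => ?_)).congr_deriv ?_
    · simp only [add_apply, BoundedContinuousFunction.coe_add, Pi.add_apply]
      ring
    · have e1 := (hPfd f n t ht).1
      have e2 := (hPgd g n t ht).1
      have e3 := (hPhd h n t ht).1
      simp only [sub_apply, BoundedContinuousFunction.coe_sub, Pi.sub_apply, add_apply,
        BoundedContinuousFunction.coe_add, Pi.add_apply, mul_add, mul_sub, wt_mul_incl,
        wt_mul_freqSq, e1, e2, e3]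
      simp only [osc]
      have := (hω n).ne'
      field_simp
      ring

end EllOne

namespace EllOne

theorem exists_mulOp {f : ℝ → ℝ} (hf : AnalyticOnNhd ℝ f (Icc 0 1)) :
    ∃ σ₀ > 0, ∀ σ, 0 < σ → σ ≤ σ₀ → (∀ x ∈ nhdI σ, AnalyticAt ℝ f x) ∧
      ∀ S > 0, ∀ j : ℕ, ∃ C ≥ 0, ∀ M ≥ 0, ∃ m : EllOne →L[ℝ] EllOne, (∀ a, ‖m a‖ ≤ C * ‖a‖) ∧
        ∀ a t, ∀ x ∈ nhdI σ,
          ev (wt σ S M j) t (1 - 2 * x) (m a) = f x * ev (wt σ S M j) t (1 - 2 * x) a := by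
  obtain ⟨σ₀, hσ₀, h⟩ := exists_chebyshev_coef hf
  refine ⟨σ₀, hσ₀, fun σ hσ hσ' => ?_⟩
  obtain ⟨ha, c, hc, hfc⟩ := h σ hσ hσ'
  refine ⟨ha, fun S hS j => ?_⟩
  set e := ofCoef (hc j) hσ hS le_rfl (1 : ℝ →ᵇ ℝ) with he
  refine ⟨‖e‖, norm_nonneg _, fun M hM => ?_⟩
  have H : MulOK (wt σ S 0 j) (wt σ S M j) (wt σ S M j) :=
    wt_mulOK hσ hS (by rw [zero_add]) le_rfl le_rfl
  refine ⟨mul H e, norm_mul_le' H e, fun a t x hx => ?_⟩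
  rw [ev_mul H ((decays_wt hσ hS le_rfl j).evBound hσ hx) ((decays_wt hσ hS hM j).evBound hσ hx)
    ((decays_wt hσ hS hM j).evBound hσ hx), he, ev_ofCoef, hfc x hx]
  simp

/-- The lower order part of the square of the frequency. -/
noncomputable def freqLow (σ S M : ℝ) : EllOne →L[ℝ] EllOne :=
  diagOp (wt σ S M 2) (wt σ S M 1) (fun n => -(2 * (n : ℝ) + 1)) 2 (fun n t => by
    have h := wt_succ_eq (σ := σ) (S := S) (M := M) 1 n t
    have h1 := (wt σ S M 2).pos n t
    have h2 : (0 : ℝ) ≤ n := n.cast_nonneg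
    rw [abs_neg, abs_of_nonneg (by positivity), ← h]
    nlinarith)

theorem norm_freqLow_le (σ S M : ℝ) (a : EllOne) : ‖freqLow σ S M a‖ ≤ 2 * ‖a‖ :=
  norm_diagOp_le _ a

theorem wt_mul_freqLow (σ S M : ℝ) (a : EllOne) (n : ℕ) (t : ℝ) :
    wt σ S M 1 n t * freqLow σ S M a n t = -(2 * (n : ℝ) + 1) * (wt σ S M 2 n t * a n t) := by
  rw [freqLow, mul_diagOp_apply]

theorem ev_freq {σ S M : ℝ} (hσ : 0 < σ) (hS : 0 < S) (hM : 0 ≤ M) (a : EllOne) (t : ℝ) {x : ℝ}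
    (hx : x ∈ nhdI σ) :
    ev (wt σ S M 0) t (1 - 2 * x) (freqSq σ S M a)
        + ev (wt σ S M 1) t (1 - 2 * x) (freqLow σ S M a)
      = -(x * (1 - x)) * evD 2 (wt σ S M 2) t x a
        - (1 / 2) * (1 - 2 * x) * evD 1 (wt σ S M 2) t x a := by
  have h0 := hasSum_ev (t := t) ((decays_wt hσ hS hM 0).evBound hσ hx) (freqSq σ S M a)
  have h1 := hasSum_ev (t := t) ((decays_wt hσ hS hM 1).evBound hσ hx) (freqLow σ S M a)
  have h2 := (hasSum_evD (decays_wt hσ hS hM 2) hσ 2 t hx a).mul_left (-(x * (1 - x)))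
  have h3 := (hasSum_evD (decays_wt hσ hS hM 2) hσ 1 t hx a).mul_left ((1 / 2) * (1 - 2 * x))
  refine (h0.add h1).unique ((h2.sub h3).congr_fun fun n => ?_)
  rw [wt_mul_freqSq, wt_mul_freqLow]
  have h := chebP_ode n x
  rw [eval_chebP] at h
  simp only [chebD, Function.iterate_one]
  linear_combination (wt σ S M 2 n t * a n t) * h

/-- A degenerate elliptic operator is the square of the frequency up to first order terms. -/
theorem exists_generator {b l : ℝ → ℝ} (hb : AnalyticOnNhd ℝ b (Icc 0 1))
    (hl : AnalyticOnNhd ℝ l (Icc 0 1)) :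
    ∃ σ₀ > 0, ∀ σ, 0 < σ → σ ≤ σ₀ → ∀ S > 0, ∃ C ≥ 0, ∀ M ≥ 0,
      ∃ R : EllOne →L[ℝ] EllOne, (∀ a, ‖R a‖ ≤ C * ‖a‖) ∧
        ∀ a t, ∀ x ∈ nhdI σ,
          ev (wt σ S M 0) t (1 - 2 * x) (freqSq σ S M a + incl σ S M zero_le_one (R a))
            = -(x * (1 - x)) * evD 2 (wt σ S M 2) t x a
              + (b x - (1 / 2) * (1 - 2 * x)) * evD 1 (wt σ S M 2) t x a
              + l x * evD 0 (wt σ S M 2) t x a := by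
  obtain ⟨σ₁, hσ₁, h1⟩ := exists_mulOp hb
  obtain ⟨σ₂, hσ₂, h2⟩ := exists_mulOp hl
  refine ⟨min σ₁ σ₂, lt_min hσ₁ hσ₂, fun σ hσ hσ' S hS => ?_⟩
  obtain ⟨C₁, hC₁, h1⟩ := (h1 σ hσ (hσ'.trans (min_le_left _ _))).2 S hS 1
  obtain ⟨C₂, hC₂, h2⟩ := (h2 σ hσ (hσ'.trans (min_le_right _ _))).2 S hS 1
  have hD : 0 ≤ 4 * (1 - Real.exp (-(2 * σ)))⁻¹ := by
    have : Real.exp (-(2 * σ)) < 1 := by rw [Real.exp_lt_one_iff]; linarith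
    have : 0 < 1 - Real.exp (-(2 * σ)) := by linarith
    positivity
  refine ⟨2 + C₁ * (4 * (1 - Real.exp (-(2 * σ)))⁻¹) + C₂, by positivity, fun M hM => ?_⟩
  obtain ⟨m₁, hm₁, e₁⟩ := h1 M hM
  obtain ⟨m₂, hm₂, e₂⟩ := h2 M hM
  refine ⟨freqLow σ S M + m₁.comp (derivOp hσ hS M 1) + m₂.comp (incl σ S M one_le_two),
    fun a => ?_, fun a t x hx => ?_⟩
  · simp only [_root_.add_apply, ContinuousLinearMap.comp_apply]
    have k1 := (hm₁ (derivOp hσ hS M 1 a)).trans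
      (mul_le_mul_of_nonneg_left (norm_derivOp_le hσ hS M 1 a) hC₁)
    have k2 := (hm₂ (incl σ S M one_le_two a)).trans
      (mul_le_mul_of_nonneg_left (norm_incl_le one_le_two a) hC₂)
    have k3 := norm_freqLow_le σ S M a
    refine (norm_add₃_le).trans ?_
    linarith
  · have w0 := (decays_wt hσ hS hM 0).evBound hσ hx
    have w1 := (decays_wt hσ hS hM 1).evBound hσ hx
    rw [ev_add w0, ev_incl]
    simp only [_root_.add_apply, ContinuousLinearMap.comp_apply]
    rw [ev_add w1, ev_add w1, e₁ _ _ _ hx, e₂ _ _ _ hx, ev_derivOp hσ hS hM 1 a t hx, ev_incl,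
      evD_zero]
    linear_combination ev_freq hσ hS hM a t hx

end EllOne

section smoothness

open scoped ContDiff

variable {Ω : Set (ℝ × ℝ)} {E F : Type} [NormedAddCommGroup E] [NormedSpace ℝ E]
  [NormedAddCommGroup F] [NormedSpace ℝ F]

/-- The first `n` derivatives in the second variable exist and are of class `C^k`. -/
def SpaceSmooth (Ω : Set (ℝ × ℝ)) (k : ℕ) {E : Type} [NormedAddCommGroup E] [NormedSpace ℝ E] :
    ℕ → (ℝ × ℝ → E) → Prop
  | 0, f => ContDiffOn ℝ k f Ω
  | n + 1, f => ContDiffOn ℝ k f Ω ∧ ∃ f' : ℝ × ℝ → E,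
      (∀ p ∈ Ω, HasDerivAt (fun x => f (p.1, x)) (f' p) p.2) ∧ SpaceSmooth Ω k n f'

theorem SpaceSmooth.of_succ {k n : ℕ} {f : ℝ × ℝ → E} (h : SpaceSmooth Ω k (n + 1) f) :
    SpaceSmooth Ω k n f := by
  induction n generalizing f with
  | zero => exact h.1
  | succ n ih =>
    obtain ⟨h0, f', hf', h1⟩ := h
    exact ⟨h0, f', hf', ih h1⟩

theorem SpaceSmooth.prodMk {k n : ℕ} {f : ℝ × ℝ → E} {g : ℝ × ℝ → F} (hf : SpaceSmooth Ω k n f)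
    (hg : SpaceSmooth Ω k n g) : SpaceSmooth Ω k n fun p => (f p, g p) := by
  induction n generalizing f g with
  | zero => exact ContDiffOn.prodMk hf hg
  | succ n ih =>
    obtain ⟨h0, f', hf', h1⟩ := hf
    obtain ⟨k0, g', hg', k1⟩ := hg
    exact ⟨h0.prodMk k0, fun p => (f' p, g' p), fun p hp => (hf' p hp).prodMk (hg' p hp), ih h1 k1⟩

theorem SpaceSmooth.comp {F : Type} [NormedAddCommGroup F] [NormedSpace ℝ F] {k n : ℕ}
    {f : ℝ × ℝ → E} (hf : SpaceSmooth Ω k n f) {W : Set E} (hW : IsOpen W)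
    {G : E → F} (hG : ContDiffOn ℝ ∞ G W) (hfW : MapsTo f Ω W) :
    SpaceSmooth Ω k n fun p => G (f p) := by
  have hk : ((k : ℕ) : WithTop ℕ∞) ≤ ∞ := by exact_mod_cast le_top
  induction n generalizing E F with
  | zero => exact (hG.of_le hk).comp hf hfW
  | succ n ih =>
    have h2 := hf.of_succ
    obtain ⟨h0, f', hf', h1⟩ := hf
    refine ⟨(hG.of_le hk).comp h0 hfW, fun p => fderiv ℝ G (f p) (f' p), fun p hp => ?_, ?_⟩
    · have h3 : HasFDerivAt G (fderiv ℝ G (f p)) (f (p.1, p.2)) :=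
        ((hG.contDiffAt (hW.mem_nhds (hfW hp))).differentiableAt (by simp)).hasFDerivAt
      exact h3.comp_hasDerivAt p.2 (hf' p hp)
    · refine ih (h2.prodMk h1) (W := W ×ˢ univ) (G := fun e : E × E => fderiv ℝ G e.1 e.2)
        (hW.prod isOpen_univ) ?_ fun p hp => ⟨hfW hp, mem_univ _⟩
      have h4 : ContDiffOn ℝ ∞ (fderiv ℝ G) W := hG.fderiv_of_isOpen hW (by simp)
      exact (h4.comp contDiffOn_fst fun e he => he.1).clm_apply contDiffOn_snd

theorem SpaceSmooth.const (k n : ℕ) (e : E) : SpaceSmooth Ω k n fun _ => e := by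
  induction n generalizing e with
  | zero => exact contDiffOn_const
  | succ n ih => exact ⟨contDiffOn_const, fun _ => 0, fun p _ => hasDerivAt_const _ _, ih 0⟩

theorem SpaceSmooth.snd (k n : ℕ) : SpaceSmooth Ω k n fun p => p.2 := by
  cases n with
  | zero => exact contDiffOn_snd
  | succ n => exact ⟨contDiffOn_snd, fun _ => 1, fun p _ => hasDerivAt_id _, .const k n 1⟩

theorem SpaceSmooth.of_ladder {k : ℕ} (n : ℕ) {u : ℕ → ℝ × ℝ → E}
    (hu : ∀ j, ∀ p ∈ Ω, HasDerivAt (fun x => u j (p.1, x)) (u (j + 1) p) p.2)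
    (hk : ∀ j, ContDiffOn ℝ k (u j) Ω) (j : ℕ) : SpaceSmooth Ω k n (u j) := by
  induction n generalizing j with
  | zero => exact hk j
  | succ n ih => exact ⟨hk j, u (j + 1), hu j, ih (j + 1)⟩

theorem SpaceSmooth.contDiffOn_ladder (hΩ : IsOpen Ω) {k : ℕ} {u : ℕ → ℝ × ℝ → E}
    (hu : ∀ j, ∀ p ∈ Ω, HasDerivAt (fun x => u j (p.1, x)) (u (j + 1) p) p.2) (n : ℕ) {i : ℕ}
    {g : ℝ × ℝ → E} (hg : SpaceSmooth Ω k n g) (h : EqOn (u i) g Ω) :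
    ContDiffOn ℝ k (u (i + n)) Ω := by
  induction n generalizing i g with
  | zero => exact ContDiffOn.congr hg h
  | succ n ih =>
    obtain ⟨-, g', hg', h1⟩ := hg
    rw [← add_assoc, add_right_comm]
    refine ih h1 fun p hp => ((hu i p hp).congr_of_eventuallyEq ?_).unique (hg' p hp)
    have h2 : Continuous fun x : ℝ => (p.1, x) := by fun_prop
    filter_upwards [h2.continuousAt.preimage_mem_nhds (hΩ.mem_nhds hp)] with x hx
    exact (h hx).symm

theorem contDiffOn_succ_of_partial (hΩ : IsOpen Ω) {k : ℕ} {f a b : ℝ × ℝ → E}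
    (ha : ∀ p ∈ Ω, HasDerivAt (fun t => f (t, p.2)) (a p) p.1)
    (hb : ∀ p ∈ Ω, HasDerivAt (fun x => f (p.1, x)) (b p) p.2)
    (hka : ContDiffOn ℝ k a Ω) (hkb : ContDiffOn ℝ k b Ω) : ContDiffOn ℝ (k + 1 : ℕ) f Ω := by
  push_cast
  rw [contDiffOn_succ_iff_hasFDerivWithinAt_of_uniqueDiffOn hΩ.uniqueDiffOn]
  refine ⟨fun h => absurd h (by simp), fun p =>
    (ContinuousLinearMap.toSpanSingleton ℝ (a p)).coprod
      (ContinuousLinearMap.toSpanSingleton ℝ (b p)), ?_, fun p hp => ?_⟩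
  · have h1 : ContDiffOn ℝ k (fun p => (ContinuousLinearMap.fst ℝ ℝ ℝ).smulRight (a p)
        + (ContinuousLinearMap.snd ℝ ℝ ℝ).smulRight (b p)) Ω :=
      (contDiffOn_const.smulRight hka).add (contDiffOn_const.smulRight hkb)
    refine h1.congr fun p _ => ?_
    ext <;> simp
  · have hp' := hΩ.mem_nhds hp
    have hT : Continuous fun e : E => ContinuousLinearMap.toSpanSingleton ℝ e :=
      (ContinuousLinearMap.toSpanSingletonCLE (𝕜 := ℝ) (E := E)).continuous
    have h := hasStrictFDerivAt_uncurry_coprod (𝕜 := ℝ) (u := p) (f := fun t x => f (t, x))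
      (f₁ := fun t x => ContinuousLinearMap.toSpanSingleton ℝ (a (t, x)))
      (f₂ := fun t x => ContinuousLinearMap.toSpanSingleton ℝ (b (t, x)))
      (by filter_upwards [hp'] with q hq; exact (ha q hq).hasFDerivAt)
      (by filter_upwards [hp'] with q hq; exact (hb q hq).hasFDerivAt)
      (hT.continuousAt.comp (hka.continuousOn.continuousAt hp'))
      (hT.continuousAt.comp (hkb.continuousOn.continuousAt hp'))
    exact h.hasFDerivAt.hasFDerivWithinAt

/-- Solutions of evolution equations that are smooth in space are smooth. -/
theorem contDiffOn_of_evolution (hΩ : IsOpen Ω) {u a : ℕ → ℝ × ℝ → E}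
    (hc : ∀ j, ContinuousOn (u j) Ω)
    (hu : ∀ j, ∀ p ∈ Ω, HasDerivAt (fun x => u j (p.1, x)) (u (j + 1) p) p.2)
    (ha : ∀ j, ∀ p ∈ Ω, HasDerivAt (fun x => a j (p.1, x)) (a (j + 1) p) p.2)
    (ht : ∀ j, ∀ p ∈ Ω, HasDerivAt (fun t => u j (t, p.2)) (a j p) p.1)
    {W : Set (ℝ × E × E × E)} (hW : IsOpen W) {G : ℝ × E × E × E → E} (hG : ContDiffOn ℝ ∞ G W)
    (hGW : ∀ p ∈ Ω, (p.2, u 0 p, u 1 p, u 2 p) ∈ W)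
    (hGa : ∀ p ∈ Ω, a 0 p = G (p.2, u 0 p, u 1 p, u 2 p)) (j : ℕ) : ContDiffOn ℝ ∞ (u j) Ω := by
  rw [contDiffOn_infty]
  intro k
  induction k generalizing j with
  | zero => exact contDiffOn_zero.2 (hc j)
  | succ k ih =>
    refine contDiffOn_succ_of_partial hΩ (ht j) (hu j) ?_ (ih (j + 1))
    have h1 := fun i => SpaceSmooth.of_ladder j hu ih i
    have h2 := ((SpaceSmooth.snd k j).prodMk ((h1 0).prodMk ((h1 1).prodMk (h1 2)))).comp hW hG hGW
    have h3 := SpaceSmooth.contDiffOn_ladder hΩ ha j (i := 0) h2 hGa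
    rwa [zero_add] at h3

end smoothness

/-- Fixed points of quadratic perturbations of a linear contraction. -/
theorem exists_small_fixedPoint {E : Type} [NormedAddCommGroup E] [NormedSpace ℝ E]
    [CompleteSpace E] (A : E →L[ℝ] E) (hA : ∀ u, ‖A u‖ ≤ 1 / 2 * ‖u‖) {𝒢 : E → E} (h0 : 𝒢 0 = 0)
    {K r₀ : ℝ} (hK : 0 ≤ K) (hr₀ : 0 < r₀)
    (hG : ∀ r, 0 ≤ r → r ≤ r₀ → ∀ u u', ‖u‖ ≤ r → ‖u'‖ ≤ r → ‖𝒢 u - 𝒢 u'‖ ≤ K * r * ‖u - u'‖)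
    (u₀ : E) :
    ∃ ε₀ > 0, ∃ C > 0, ∀ ε : ℝ, |ε| ≤ ε₀ →
      ∃ u, u = A u + 𝒢 (ε • u₀ + u) ∧ ‖u‖ ≤ C * ε ^ 2 ∧ ‖ε • u₀ + u‖ ≤ r₀ := by
  set B := ‖u₀‖ + 1 with hB
  have hB1 : 0 < B := by positivity
  refine ⟨min (r₀ / (2 * B)) (1 / (8 * (K + 1) * B)), by positivity, 8 * (K + 1) * B ^ 2,
    by positivity, fun ε hε => ?_⟩
  have e1 : 2 * B * |ε| ≤ r₀ := by
    have := hε.trans (min_le_left _ _)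
    rwa [le_div_iff₀ (by positivity), mul_comm] at this
  have e2 : 8 * (K + 1) * B * |ε| ≤ 1 := by
    have := hε.trans (min_le_right _ _)
    rwa [le_div_iff₀ (by positivity), mul_comm] at this
  have hε0 := abs_nonneg ε
  set r := 2 * B * |ε| with hr
  have hr0 : 0 ≤ r := by positivity
  set ρ := 2 * K * r ^ 2 with hρ
  have hKr : K * r ≤ 1 / 4 := by
    have : 0 ≤ B * |ε| := by positivity
    rw [hr]; nlinarith
  have hρB : ρ ≤ B * |ε| := by
    have h1 : ρ = 2 * (K * r) * r := by rw [hρ]; ring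
    have h2 := mul_le_mul_of_nonneg_right hKr hr0
    rw [h1]; linarith
  have hball : ∀ u, ‖u‖ ≤ ρ → ‖ε • u₀ + u‖ ≤ r := fun u hu => by
    refine (norm_add_le _ _).trans ?_
    rw [norm_smul, Real.norm_eq_abs]
    have : |ε| * ‖u₀‖ ≤ |ε| * B := mul_le_mul_of_nonneg_left (by linarith) hε0
    linarith
  set 𝓕 : E → E := fun u => A u + 𝒢 (ε • u₀ + u) with h𝓕
  have hG1 : ∀ u, ‖u‖ ≤ r → ‖𝒢 u‖ ≤ K * r * r := fun u hu => by
    have h1 := hG r hr0 e1 u 0 hu (by rwa [norm_zero])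
    rw [h0, sub_zero, sub_zero] at h1
    exact h1.trans (mul_le_mul_of_nonneg_left hu (by positivity))
  have hmaps : MapsTo 𝓕 (Metric.closedBall 0 ρ) (Metric.closedBall 0 ρ) := fun u hu => by
    rw [mem_closedBall_zero_iff] at hu ⊢
    have h1 := hG1 _ (hball u hu)
    have h2 := hA u
    have h3 : ρ = 2 * (K * r * r) := by rw [hρ]; ring
    refine (norm_add_le _ _).trans ?_
    linarith
  have hcon : ContractingWith (3 / 4 : NNReal) (hmaps.restrict 𝓕 _ _) := by
    refine ⟨by rw [div_lt_one (by norm_num)]; norm_num, LipschitzWith.of_dist_le_mul fun u u' => ?_⟩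
    have hu := mem_closedBall_zero_iff.1 u.2
    have hu' := mem_closedBall_zero_iff.1 u'.2
    rw [Subtype.dist_eq, Subtype.dist_eq, dist_eq_norm, dist_eq_norm]
    simp only [MapsTo.val_restrict_apply, h𝓕]
    have h1 := hG r hr0 e1 _ _ (hball _ hu) (hball _ hu')
    rw [add_sub_add_left_eq_sub] at h1
    have h2 := hA (u - u')
    rw [map_sub] at h2
    have h3 := mul_le_mul_of_nonneg_right hKr (norm_nonneg ((u : E) - u'))
    rw [add_sub_add_comm]
    refine (norm_add_le _ _).trans ?_
    push_cast
    linarith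
  obtain ⟨u, hu, hfix, -⟩ := ContractingWith.exists_fixedPoint'
    (Metric.isClosed_closedBall.isComplete) hmaps hcon
    (x := 0) (Metric.mem_closedBall_self (by positivity)) (edist_ne_top _ _)
  rw [mem_closedBall_zero_iff] at hu
  refine ⟨u, hfix.symm, hu.trans ?_, (hball u hu).trans e1⟩
  have : |ε| ^ 2 = ε ^ 2 := sq_abs ε
  rw [hρ, hr, mul_pow, mul_pow, this]
  have : 0 ≤ B ^ 2 * ε ^ 2 := by positivity
  nlinarith

theorem exists_lipschitz_comp {E F G : Type} [NormedAddCommGroup E] [NormedSpace ℝ E]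
    [NormedAddCommGroup F] [NormedSpace ℝ F] [NormedAddCommGroup G] [NormedSpace ℝ G]
    (Y : E →L[ℝ] F) (B : G →L[ℝ] E) {𝒩 : F → G} {K r₀ : ℝ} (hK : 0 < K) (hr₀ : 0 < r₀)
    (hN : ∀ r, 0 ≤ r → r ≤ r₀ → ∀ u u', ‖u‖ ≤ r → ‖u'‖ ≤ r → ‖𝒩 u - 𝒩 u'‖ ≤ K * r * ‖u - u'‖) :
    ∃ K' ≥ 0, ∃ r₁ > 0, (∀ u, ‖u‖ ≤ r₁ → ‖Y u‖ ≤ r₀) ∧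
      ∀ r, 0 ≤ r → r ≤ r₁ → ∀ u u', ‖u‖ ≤ r → ‖u'‖ ≤ r →
        ‖B (𝒩 (Y u)) - B (𝒩 (Y u'))‖ ≤ K' * r * ‖u - u'‖ := by
  set κ := ‖Y‖ + 1 with hκ
  have hκ0 : 0 < κ := by positivity
  have hY : ∀ u, ‖Y u‖ ≤ κ * ‖u‖ := fun u =>
    (Y.le_opNorm u).trans (mul_le_mul_of_nonneg_right (by linarith) (norm_nonneg _))
  have hYr : ∀ r, r ≤ r₀ / κ → ∀ u, ‖u‖ ≤ r → ‖Y u‖ ≤ κ * r := fun r _ u hu =>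
    (hY u).trans (mul_le_mul_of_nonneg_left hu hκ0.le)
  have hκr : ∀ r, r ≤ r₀ / κ → κ * r ≤ r₀ := fun r hr => by
    rwa [le_div_iff₀ hκ0, mul_comm] at hr
  refine ⟨‖B‖ * (K * κ * κ), by positivity, r₀ / κ, by positivity,
    fun u hu => (hYr _ le_rfl u hu).trans (hκr _ le_rfl), fun r hr0 hr u u' hu hu' => ?_⟩
  have h1 := hN (κ * r) (by positivity) (hκr r hr) _ _ (hYr r hr u hu) (hYr r hr u' hu')
  have h2 := hY (u - u')
  rw [map_sub] at h2
  rw [← map_sub]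
  refine (B.le_opNorm _).trans ?_
  rw [mul_assoc, mul_assoc]
  refine mul_le_mul_of_nonneg_left (h1.trans ?_) (norm_nonneg _)
  refine (mul_le_mul_of_nonneg_left h2 (by positivity)).trans (le_of_eq (by ring))

theorem HasDerivAt.eqOn_of_eqOn {V : Set ℝ} (hV : IsOpen V) {f g f' g' : ℝ → ℝ} (h : EqOn f g V)
    (hf : ∀ x ∈ V, HasDerivAt f (f' x) x) (hg : ∀ x ∈ V, HasDerivAt g (g' x) x) : EqOn f' g' V :=
  fun x hx => (hf x hx).unique ((hg x hx).congr_of_eventuallyEq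
    (h.eventuallyEq_of_mem (hV.mem_nhds hx)))

/-- A degenerate elliptic expression in a function and its first two derivatives. -/
noncomputable def ellip (b l : ℝ → ℝ) (x y η ζ : ℝ) : ℝ :=
  -(x * (1 - x)) * ζ + (b x - (1 / 2) * (1 - 2 * x)) * η + l x * y

namespace EllOne

theorem evD_add {w : Wt} {σ : ℝ} (hw : Decays w σ) (hσ : 0 < σ) (j : ℕ) (t : ℝ) {x : ℝ}
    (hx : x ∈ nhdI σ) (a b : EllOne) : evD j w t x (a + b) = evD j w t x a + evD j w t x b :=
  (hasSum_evD hw hσ j t hx (a + b)).unique (((hasSum_evD hw hσ j t hx a).add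
    (hasSum_evD hw hσ j t hx b)).congr_fun fun n => by
      simp only [add_apply, BoundedContinuousFunction.coe_add, Pi.add_apply]; ring)

theorem evD_smul {w : Wt} (j : ℕ) (t x c : ℝ) (a : EllOne) :
    evD j w t x (c • a) = c * evD j w t x a := by
  rw [evD, evD, ← tsum_mul_left]
  refine tsum_congr fun n => ?_
  simp only [smul_apply, BoundedContinuousFunction.coe_smul, smul_eq_mul]
  ring

theorem evD_ofCoef {σ S M : ℝ} (hσ : 0 < σ) (hS : 0 < S) (hM : 0 ≤ M) {c : ℕ → ℝ} {i : ℕ}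
    (hc : Summable fun n => |c n| * (((n : ℝ) + 1) ^ i * Real.exp (4 * σ * n))) (θ : ℝ →ᵇ ℝ)
    {f : ℝ → ℝ} (hf : ∀ x ∈ nhdI σ, AnalyticAt ℝ f x)
    (hfc : ∀ x ∈ nhdI σ, f x = ∑' n, c n * chebT n (1 - 2 * x)) (t : ℝ) {x : ℝ} (hx : x ∈ nhdI σ) :
    evD 0 (wt σ S M i) t x (ofCoef hc hσ hS hM θ) = θ t * f x ∧
      evD 1 (wt σ S M i) t x (ofCoef hc hσ hS hM θ) = θ t * deriv f x ∧
      evD 2 (wt σ S M i) t x (ofCoef hc hσ hS hM θ) = θ t * deriv (deriv f) x := by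
  have h0 : EqOn (fun x => evD 0 (wt σ S M i) t x (ofCoef hc hσ hS hM θ))
      (fun x => θ t * f x) (nhdI σ) := fun x hx => by
    dsimp only
    rw [evD_zero, ev_ofCoef, hfc x hx]
  have h1 := HasDerivAt.eqOn_of_eqOn (isOpen_nhdI σ) h0
    (fun x hx => hasDerivAt_evD (decays_wt hσ hS hM i) hσ 0 t hx _)
    (fun x hx => (hf x hx).differentiableAt.hasDerivAt.const_mul (θ t))
  have h2 := HasDerivAt.eqOn_of_eqOn (isOpen_nhdI σ) h1
    (fun x hx => hasDerivAt_evD (decays_wt hσ hS hM i) hσ 1 t hx _)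
    (fun x hx => (hf x hx).deriv.differentiableAt.hasDerivAt.const_mul (θ t))
  exact ⟨h0 hx, h1 hx, h2 hx⟩

/-- The bounded function `t ↦ A * sin (ω * t + Θ)`. -/
noncomputable def sinB (A ω Θ : ℝ) : ℝ →ᵇ ℝ :=
  BoundedContinuousFunction.ofNormedAddCommGroup (fun t => A * Real.sin (ω * t + Θ))
    (by fun_prop) |A| (fun t => by
      rw [Real.norm_eq_abs, abs_mul]
      exact mul_le_of_le_one_right (abs_nonneg _) (Real.abs_sin_le_one _))

/-- The bounded function `t ↦ A * cos (ω * t + Θ)`. -/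
noncomputable def cosB (A ω Θ : ℝ) : ℝ →ᵇ ℝ :=
  BoundedContinuousFunction.ofNormedAddCommGroup (fun t => A * Real.cos (ω * t + Θ))
    (by fun_prop) |A| (fun t => by
      rw [Real.norm_eq_abs, abs_mul]
      exact mul_le_of_le_one_right (abs_nonneg _) (Real.abs_cos_le_one _))

theorem sinB_apply (A ω Θ t : ℝ) : sinB A ω Θ t = A * Real.sin (ω * t + Θ) := rfl

theorem cosB_apply (A ω Θ t : ℝ) : cosB A ω Θ t = A * Real.cos (ω * t + Θ) := rfl

theorem hasDerivAt_sinB (A ω Θ t : ℝ) : HasDerivAt (sinB A ω Θ) (cosB (A * ω) ω Θ t) t := by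
  have h := (((Real.hasDerivAt_sin (ω * t + Θ)).comp t
    (((hasDerivAt_id t).const_mul ω).add_const Θ)).const_mul A)
  refine h.congr_deriv ?_
  rw [cosB_apply]; ring

theorem hasDerivAt_cosB (A ω Θ t : ℝ) : HasDerivAt (cosB A ω Θ) (sinB (-(A * ω)) ω Θ t) t := by
  have h := (((Real.hasDerivAt_cos (ω * t + Θ)).comp t
    (((hasDerivAt_id t).const_mul ω).add_const Θ)).const_mul A)
  refine h.congr_deriv ?_
  rw [sinB_apply]; ring

end EllOne

theorem ellip_eigen_of_Icc {b l Φ : ℝ → ℝ} {σ μ : ℝ} (hσ : 0 < σ)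
    (hb : ∀ x ∈ nhdI σ, AnalyticAt ℝ b x) (hl : ∀ x ∈ nhdI σ, AnalyticAt ℝ l x)
    (hΦ : ∀ x ∈ nhdI σ, AnalyticAt ℝ Φ x)
    (h : ∀ x ∈ Icc (0 : ℝ) 1, ellip b l x (Φ x) (deriv Φ x) (deriv (deriv Φ) x) = μ * Φ x) :
    ∀ x ∈ nhdI σ, ellip b l x (Φ x) (deriv Φ x) (deriv (deriv Φ) x) = μ * Φ x := by
  have h1 : AnalyticOnNhd ℝ (fun x => ellip b l x (Φ x) (deriv Φ x) (deriv (deriv Φ) x)) (nhdI σ) :=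
    fun x hx => by
      have := hb x hx
      have := hl x hx
      have h0 := hΦ x hx
      have := h0.deriv
      have := h0.deriv.deriv
      unfold ellip
      fun_prop
  have h2 : AnalyticOnNhd ℝ (fun x => μ * Φ x) (nhdI σ) := fun x hx => by
    have := hΦ x hx
    fun_prop
  refine h1.eqOn_of_preconnected_of_eventuallyEq h2 (convex_nhdI σ).isPreconnected (z₀ := 1 / 2)
    (Icc_subset_nhdI hσ ⟨by norm_num, by norm_num⟩) ?_
  filter_upwards [Icc_mem_nhds (show (0 : ℝ) < 1 / 2 by norm_num)
    (show (1 / 2 : ℝ) < 1 by norm_num)] with x hx using h x hx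

/-- The arguments of the nonlinearity in the first equation. -/
noncomputable def sysVec₁ (x : ℝ) (e₀ e₁ : ℝ × ℝ) : Fin 5 → ℝ := ![e₀.1, x * e₁.1, e₀.2, 0, 0]

/-- The arguments of the nonlinearity in the second equation. -/
noncomputable def sysVec₂ (b l : ℝ → ℝ) (x : ℝ) (e₀ e₁ e₂ : ℝ × ℝ) : Fin 5 → ℝ :=
  ![e₀.1, x * e₁.1, e₀.2, x * e₁.2, ellip b l x e₀.1 e₁.1 e₂.1]

namespace EllOne

/-- The values of the space derivatives of a pair of Chebyshev series. -/
noncomputable def jet (w w' : Wt) (z : EllOne × EllOne) (j : ℕ) (p : ℝ × ℝ) : ℝ × ℝ :=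
  (evD j w p.1 p.2 z.1, evD j w' p.1 p.2 z.2)

section jet

variable {w w' : Wt} {σ : ℝ}

theorem continuousOn_jet (hσ : 0 < σ) (hw : Decays w σ) (hw' : Decays w' σ) (z : EllOne × EllOne)
    (j : ℕ) : ContinuousOn (jet w w' z j) (univ ×ˢ nhdI σ) :=
  (continuousOn_evD hw hσ j z.1).prodMk (continuousOn_evD hw' hσ j z.2)

theorem hasDerivAt_jet (hσ : 0 < σ) (hw : Decays w σ) (hw' : Decays w' σ) (z : EllOne × EllOne)
    (j : ℕ) (p : ℝ × ℝ) (hp : p.2 ∈ nhdI σ) :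
    HasDerivAt (fun x => jet w w' z j (p.1, x)) (jet w w' z (j + 1) p) p.2 :=
  (hasDerivAt_evD hw hσ j p.1 hp z.1).prodMk (hasDerivAt_evD hw' hσ j p.1 hp z.2)

end jet

variable {σ S M : ℝ}

theorem exists_levelOps (hσ : 0 < σ) (hS : 0 < S) (hM : 0 ≤ M) {b l : ℝ → ℝ}
    {m₁ m₀ R : EllOne →L[ℝ] EllOne}
    (h₁ : ∀ a t, ∀ x ∈ nhdI σ,
      ev (wt σ S M 1) t (1 - 2 * x) (m₁ a) = x * ev (wt σ S M 1) t (1 - 2 * x) a)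
    (h₀ : ∀ a t, ∀ x ∈ nhdI σ,
      ev (wt σ S M 0) t (1 - 2 * x) (m₀ a) = x * ev (wt σ S M 0) t (1 - 2 * x) a)
    (hR : ∀ a t, ∀ x ∈ nhdI σ,
      ev (wt σ S M 0) t (1 - 2 * x) (freqSq σ S M a + incl σ S M zero_le_one (R a))
        = ellip b l x (evD 0 (wt σ S M 2) t x a) (evD 1 (wt σ S M 2) t x a)
          (evD 2 (wt σ S M 2) t x a)) :
    ∃ Y₁ Y₂ : EllOne × EllOne →L[ℝ] (Fin 5 → EllOne), ∀ z t, ∀ x ∈ nhdI σ,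
      ((fun i => ev (wt σ S M 1) t (1 - 2 * x) (Y₁ z i))
        = sysVec₁ x (jet (wt σ S M 2) (wt σ S M 1) z 0 (t, x))
          (jet (wt σ S M 2) (wt σ S M 1) z 1 (t, x))) ∧
      (fun i => ev (wt σ S M 0) t (1 - 2 * x) (Y₂ z i))
        = sysVec₂ b l x (jet (wt σ S M 2) (wt σ S M 1) z 0 (t, x))
          (jet (wt σ S M 2) (wt σ S M 1) z 1 (t, x)) (jet (wt σ S M 2) (wt σ S M 1) z 2 (t, x)) := by
  have hz : ∀ t x, ev (wt σ S M 1) t (1 - 2 * x) 0 = 0 := fun t x => by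
    unfold ev; simp [show ∀ n, (0 : EllOne) n = 0 from fun _ => rfl]
  refine ⟨ContinuousLinearMap.pi (![(incl σ S M one_le_two).comp (.fst ℝ _ _),
      (m₁.comp (derivOp hσ hS M 1)).comp (.fst ℝ _ _), .snd ℝ _ _, 0, 0] :
        Fin 5 → (EllOne × EllOne →L[ℝ] EllOne)),
    ContinuousLinearMap.pi (![(incl σ S M zero_le_two).comp (.fst ℝ _ _),
      ((incl σ S M zero_le_one).comp (m₁.comp (derivOp hσ hS M 1))).comp (.fst ℝ _ _),
      (incl σ S M zero_le_one).comp (.snd ℝ _ _), (m₀.comp (derivOp hσ hS M 0)).comp (.snd ℝ _ _),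
      (freqSq σ S M + (incl σ S M zero_le_one).comp R).comp (.fst ℝ _ _)] :
        Fin 5 → (EllOne × EllOne →L[ℝ] EllOne)), fun z t x hx => ⟨?_, ?_⟩⟩
  · funext i
    fin_cases i
    · simp [sysVec₁, jet, ev_incl, evD_zero]
    · simp [sysVec₁, jet, h₁ _ _ x hx, ev_derivOp hσ hS hM 1 _ t hx]
    · simp [sysVec₁, jet, evD_zero]
    · simp [sysVec₁, hz]
    · simp [sysVec₁, hz]
  · funext i
    fin_cases i
    · simp [sysVec₂, jet, ev_incl, evD_zero]
    · simp [sysVec₂, jet, ev_incl, h₁ _ _ x hx, ev_derivOp hσ hS hM 1 _ t hx]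
    · simp [sysVec₂, jet, ev_incl, evD_zero]
    · simp [sysVec₂, jet, h₀ _ _ x hx, ev_derivOp hσ hS hM 0 _ t hx]
    · simp [sysVec₂, jet, hR _ _ x hx]

end EllOne

namespace EllOne

variable {σ S M : ℝ}

theorem norm_prod_le {P Q : EllOne →L[ℝ] EllOne} {C : ℝ} (hP : ∀ a, ‖P a‖ ≤ C * ‖a‖)
    (hQ : ∀ a, ‖Q a‖ ≤ C * ‖a‖) (a : EllOne) : ‖(P.prod Q) a‖ ≤ C * ‖a‖ := by
  rw [ContinuousLinearMap.prod_apply, Prod.norm_def]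
  exact max_le (hP a) (hQ a)

theorem exists_evolution (hσ : 0 < σ) (hS : 0 < S) (hM : 2 * σ / S ≤ M) {R : EllOne →L[ℝ] EllOne}
    {CR : ℝ} (hR : ∀ a, ‖R a‖ ≤ CR * ‖a‖) (hRM : 2 * CR ≤ M)
    (Y₁ Y₂ : EllOne × EllOne →L[ℝ] (Fin 5 → EllOne)) {𝒩₁ 𝒩₂ : (Fin 5 → EllOne) → EllOne}
    {K₁ r₁ K₂ r₂ : ℝ} (hK₁ : 0 < K₁) (hr₁ : 0 < r₁) (h0₁ : 𝒩₁ 0 = 0)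
    (hN₁ : ∀ r, 0 ≤ r → r ≤ r₁ → ∀ Y Y', ‖Y‖ ≤ r → ‖Y'‖ ≤ r → ‖𝒩₁ Y - 𝒩₁ Y'‖ ≤ K₁ * r * ‖Y - Y'‖)
    (hK₂ : 0 < K₂) (hr₂ : 0 < r₂) (h0₂ : 𝒩₂ 0 = 0)
    (hN₂ : ∀ r, 0 ≤ r → r ≤ r₂ → ∀ Y Y', ‖Y‖ ≤ r → ‖Y'‖ ≤ r → ‖𝒩₂ Y - 𝒩₂ Y'‖ ≤ K₂ * r * ‖Y - Y'‖)
    {a b c : EllOne}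
    (hab : ∀ n t, HasDerivAt (fun t => wt σ S M 2 n t * a n t) (wt σ S M 1 n t * b n t) t)
    (hbc : ∀ n t, HasDerivAt (fun t => wt σ S M 1 n t * b n t) (wt σ S M 0 n t * c n t) t) :
    ∃ ε₀ > 0, ∃ C > 0, ∀ ε : ℝ, |ε| ≤ ε₀ → ∃ u z : EllOne × EllOne, z = ε • (a, b) + u ∧
      ‖u‖ ≤ C * ε ^ 2 ∧ ‖Y₁ z‖ ≤ r₁ ∧ ‖Y₂ z‖ ≤ r₂ ∧ (∀ n, u.1 n 0 = 0) ∧ (∀ n, u.2 n 0 = 0) ∧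
      ∀ n, ∀ t ∈ Ioo (-S) S,
        HasDerivAt (fun t => wt σ S M 2 n t * z.1 n t) (wt σ S M 1 n t * (z.2 + 𝒩₁ (Y₁ z)) n t) t ∧
        HasDerivAt (fun t => wt σ S M 1 n t * z.2 n t)
          (wt σ S M 0 n t * (ε • c - 𝒩₂ (Y₂ z)
            - (freqSq σ S M u.1 + incl σ S M zero_le_one (R u.1))) n t) t := by
  obtain ⟨Pf, Pg, Ph, Qf, Qg, Qh, -, -, hPh, -, -, hQh, key⟩ := exists_propagator hσ hS hM
  have hM0 : 0 < M := lt_of_lt_of_le (by positivity) hM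
  obtain ⟨K₁', hK₁', s₁, hs₁, hb₁, hL₁⟩ := exists_lipschitz_comp Y₁ (Pf.prod Qf) hK₁ hr₁ hN₁
  obtain ⟨K₂', hK₂', s₂, hs₂, hb₂, hL₂⟩ := exists_lipschitz_comp Y₂ (Pg.prod Qg) hK₂ hr₂ hN₂
  obtain ⟨ε₀, hε₀, C, hC, hfix⟩ := exists_small_fixedPoint
    (-((Ph.prod Qh).comp (R.comp (.fst ℝ EllOne EllOne)))) (fun u => by
      rw [_root_.neg_apply, norm_neg]
      have h1 := norm_prod_le hPh hQh (R u.1)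
      have h2 := hR u.1
      have h3 : ‖u.1‖ ≤ ‖u‖ := norm_fst_le u
      have h4 : 1 / M * ‖R u.1‖ ≤ 1 / 2 * ‖u.1‖ := by
        rw [div_mul_eq_mul_div, one_mul, div_le_iff₀ hM0]
        have := mul_le_mul_of_nonneg_right hRM (norm_nonneg u.1)
        linarith
      exact h1.trans (by linarith))
    (𝒢 := fun z => (Pf.prod Qf) (𝒩₁ (Y₁ z)) - (Pg.prod Qg) (𝒩₂ (Y₂ z)))
    (by simp [h0₁, h0₂]) (add_nonneg hK₁' hK₂') (lt_min hs₁ hs₂)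
    (fun r hr hr' u u' hu hu' => by
      have h1 := hL₁ r hr (hr'.trans (min_le_left _ _)) u u' hu hu'
      have h2 := hL₂ r hr (hr'.trans (min_le_right _ _)) u u' hu hu'
      rw [sub_sub_sub_comm]
      refine (norm_sub_le _ _).trans ((add_le_add h1 h2).trans (le_of_eq (by ring))))
    (a, b)
  refine ⟨ε₀, hε₀, C, hC, fun ε hε => ?_⟩
  obtain ⟨u, hu, huC, hz⟩ := hfix ε hε
  set z := ε • (a, b) + u with hzu
  have k := key (𝒩₁ (Y₁ z)) (-𝒩₂ (Y₂ z)) (-R u.1) u.1 u.2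
    ((congrArg Prod.fst hu).trans (by
      simp only [Prod.fst_add, Prod.fst_sub, _root_.neg_apply, ContinuousLinearMap.comp_apply,
        ContinuousLinearMap.prod_apply, ContinuousLinearMap.coe_fst', Prod.fst_neg, map_neg]
      abel))
    ((congrArg Prod.snd hu).trans (by
      simp only [Prod.snd_add, Prod.snd_sub, _root_.neg_apply, ContinuousLinearMap.comp_apply,
        ContinuousLinearMap.prod_apply, ContinuousLinearMap.coe_fst', Prod.snd_neg, map_neg]
      abel))
  have hz1 : z.1 = ε • a + u.1 := rfl
  have hz2 : z.2 = ε • b + u.2 := rfl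
  refine ⟨u, z, rfl, huC, hb₁ _ (hz.trans (min_le_left _ _)), hb₂ _ (hz.trans (min_le_right _ _)),
    k.1, k.2.1, fun n t ht => ?_⟩
  obtain ⟨k1, k2⟩ := k.2.2 n t ht
  constructor
  · refine (((hab n t).const_mul ε).add k1).congr_deriv ?_ |>.congr_of_eventuallyEq
      (Eventually.of_forall fun s => ?_)
    · rw [hz2]
      simp only [add_apply, smul_apply, BoundedContinuousFunction.coe_add,
        BoundedContinuousFunction.coe_smul, Pi.add_apply, smul_eq_mul]
      ring
    · simp only [hz1, add_apply, smul_apply, BoundedContinuousFunction.coe_add,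
        BoundedContinuousFunction.coe_smul, Pi.add_apply, smul_eq_mul]
      ring
  · refine (((hbc n t).const_mul ε).add k2).congr_deriv ?_ |>.congr_of_eventuallyEq
      (Eventually.of_forall fun s => ?_)
    · rw [map_neg, show ε • c - 𝒩₂ (Y₂ z) - (freqSq σ S M u.1 + incl σ S M zero_le_one (R u.1))
        = ε • c + (-𝒩₂ (Y₂ z) + -incl σ S M zero_le_one (R u.1) - freqSq σ S M u.1) by abel]
      generalize -𝒩₂ (Y₂ z) + -incl σ S M zero_le_one (R u.1) - freqSq σ S M u.1 = q
      simp only [add_apply, smul_apply, BoundedContinuousFunction.coe_add,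
        BoundedContinuousFunction.coe_smul, Pi.add_apply, smul_eq_mul]
      ring
    · simp only [hz2, add_apply, smul_apply, BoundedContinuousFunction.coe_add,
        BoundedContinuousFunction.coe_smul, Pi.add_apply, smul_eq_mul]
      ring

end EllOne

theorem ellip_add (b l : ℝ → ℝ) (x y η ζ y' η' ζ' c : ℝ) :
    ellip b l x (c * y + y') (c * η + η') (c * ζ + ζ') = c * ellip b l x y η ζ + ellip b l x y' η' ζ' := by
  unfold ellip; ring

open EllOne in
theorem exists_analytic_evolution {F₁ F₂ : ℝ → (Fin 5 → ℝ) → ℝ} {b l Φ : ℝ → ℝ}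
    (hF₁ : ∀ x ∈ Icc (0 : ℝ) 1, AnalyticAt ℝ (fun p : ℝ × (Fin 5 → ℝ) => F₁ p.1 p.2) (x, 0))
    (hF₁0 : ∀ x ∈ Icc (0 : ℝ) 1, F₁ x 0 = 0)
    (hF₁1 : ∀ x ∈ Icc (0 : ℝ) 1, ∀ i, deriv (fun s => F₁ x (Pi.single i s)) 0 = 0)
    (hF₂ : ∀ x ∈ Icc (0 : ℝ) 1, AnalyticAt ℝ (fun p : ℝ × (Fin 5 → ℝ) => F₂ p.1 p.2) (x, 0))
    (hF₂0 : ∀ x ∈ Icc (0 : ℝ) 1, F₂ x 0 = 0)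
    (hF₂1 : ∀ x ∈ Icc (0 : ℝ) 1, ∀ i, deriv (fun s => F₂ x (Pi.single i s)) 0 = 0)
    (hb : AnalyticOnNhd ℝ b (Icc 0 1)) (hl : AnalyticOnNhd ℝ l (Icc 0 1))
    (hΦ : AnalyticOnNhd ℝ Φ (Icc 0 1)) (ω Θ : ℝ)
    (heig : ∀ x ∈ Icc (0 : ℝ) 1, ellip b l x (Φ x) (deriv Φ x) (deriv (deriv Φ) x) = ω ^ 2 * Φ x)
    {S : ℝ} (hS : 0 < S) :
    ∃ σ > 0, ∃ δ₁ > 0, ∃ δ₂ > 0, (∀ x ∈ nhdI σ, AnalyticAt ℝ b x) ∧ (∀ x ∈ nhdI σ, AnalyticAt ℝ l x) ∧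
      (∀ x ∈ nhdI σ, ∀ Y : Fin 5 → ℝ, ‖Y‖ < δ₁ →
        AnalyticAt ℝ (fun p : ℝ × (Fin 5 → ℝ) => F₁ p.1 p.2) (x, Y)) ∧
      (∀ x ∈ nhdI σ, ∀ Y : Fin 5 → ℝ, ‖Y‖ < δ₂ →
        AnalyticAt ℝ (fun p : ℝ × (Fin 5 → ℝ) => F₂ p.1 p.2) (x, Y)) ∧
      ∃ ε₀ > 0, ∃ C > 0, ∀ ε : ℝ, |ε| ≤ ε₀ → ∃ u a : ℕ → ℝ × ℝ → ℝ × ℝ,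
        (∀ j, ContinuousOn (u j) (Ioo (-S) S ×ˢ nhdI σ)) ∧
        (∀ j, ∀ p ∈ Ioo (-S) S ×ˢ nhdI σ, HasDerivAt (fun x => u j (p.1, x)) (u (j + 1) p) p.2) ∧
        (∀ j, ∀ p ∈ Ioo (-S) S ×ˢ nhdI σ, HasDerivAt (fun x => a j (p.1, x)) (a (j + 1) p) p.2) ∧
        (∀ j, ∀ p ∈ Ioo (-S) S ×ˢ nhdI σ, HasDerivAt (fun t => u j (t, p.2)) (a j p) p.1) ∧
        ∀ p ∈ Ioo (-S) S ×ˢ nhdI σ,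
          ‖sysVec₁ p.2 (u 0 p) (u 1 p)‖ < δ₁ ∧ ‖sysVec₂ b l p.2 (u 0 p) (u 1 p) (u 2 p)‖ < δ₂ ∧
          a 0 p = ((u 0 p).2 + F₁ p.2 (sysVec₁ p.2 (u 0 p) (u 1 p)),
            -ellip b l p.2 (u 0 p).1 (u 1 p).1 (u 2 p).1
              - F₂ p.2 (sysVec₂ b l p.2 (u 0 p) (u 1 p) (u 2 p))) ∧
          u 0 (0, p.2) = (ε * (Real.sin Θ * Φ p.2), ε * (ω * Real.cos Θ * Φ p.2)) ∧
          |(u 0 p).1 - ε * (Real.sin (ω * p.1 + Θ) * Φ p.2)| ≤ C * ε ^ 2 ∧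
          |(u 0 p).2 - ε * (ω * Real.cos (ω * p.1 + Θ) * Φ p.2)| ≤ C * ε ^ 2 := by
  obtain ⟨σ₁, hσ₁, δ₁, hδ₁, hs₁⟩ := exists_substitution hF₁ hF₁0 hF₁1
  obtain ⟨σ₂, hσ₂, δ₂, hδ₂, hs₂⟩ := exists_substitution hF₂ hF₂0 hF₂1
  obtain ⟨σ₃, hσ₃, hgen⟩ := exists_generator hb hl
  obtain ⟨σ₄, hσ₄, hmul⟩ := exists_mulOp (f := fun x => x) (fun x _ => analyticAt_id)
  obtain ⟨σ₅, hσ₅, hcheb⟩ := exists_chebyshev_coef hΦ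
  obtain ⟨σ₆, hσ₆, hb'⟩ := exists_mulOp hb
  obtain ⟨σ₇, hσ₇, hl'⟩ := exists_mulOp hl
  obtain ⟨σ, hσ, h₁, h₂, h₃, h₄, h₅, h₆, h₇⟩ : ∃ σ > 0, σ ≤ σ₁ ∧ σ ≤ σ₂ ∧ σ ≤ σ₃ ∧ σ ≤ σ₄ ∧
      σ ≤ σ₅ ∧ σ ≤ σ₆ ∧ σ ≤ σ₇ :=
    ⟨min σ₁ (min σ₂ (min σ₃ (min σ₄ (min σ₅ (min σ₆ σ₇))))), by positivity, by simp, by simp,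
      by simp, by simp, by simp, by simp, by simp⟩
  have hb' := (hb' σ hσ h₆).1
  have hl' := (hl' σ hσ h₇).1
  obtain ⟨hF₁a, hs₁⟩ := hs₁ σ hσ h₁
  obtain ⟨hF₂a, hs₂⟩ := hs₂ σ hσ h₂
  obtain ⟨CR, hCR, hgen⟩ := hgen σ hσ h₃ S hS
  obtain ⟨hΦ', c, hc, hΦc⟩ := hcheb σ hσ h₅
  have heig' := ellip_eigen_of_Icc hσ hb' hl' hΦ' heig
  obtain ⟨M, hM, hMR⟩ : ∃ M, 2 * σ / S ≤ M ∧ 2 * CR ≤ M := ⟨_, le_max_left _ _, le_max_right _ _⟩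
  have hM0 : 0 ≤ M := by linarith
  obtain ⟨_, -, hm₁⟩ := (hmul σ hσ h₄).2 S hS 1
  obtain ⟨_, -, hm₀⟩ := (hmul σ hσ h₄).2 S hS 0
  obtain ⟨m₁, -, hm₁⟩ := hm₁ M hM0
  obtain ⟨m₀, -, hm₀⟩ := hm₀ M hM0
  obtain ⟨R, hRn, hR⟩ := hgen M hM0
  obtain ⟨Y₁, Y₂, hY⟩ := exists_levelOps hσ hS hM0 (b := b) (l := l) hm₁ hm₀ hR
  obtain ⟨𝒩₁, K₁, hK₁, r₁, hr₁, hr₁δ, h0₁, hL₁, he₁⟩ := hs₁ S hS M hM0 1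
  obtain ⟨𝒩₂, K₂, hK₂, r₂, hr₂, hr₂δ, h0₂, hL₂, he₂⟩ := hs₂ S hS M hM0 0
  obtain ⟨ε₀, hε₀, C, hC, hev⟩ := exists_evolution hσ hS hM hRn hMR Y₁ Y₂ hK₁ hr₁ h0₁ hL₁ hK₂ hr₂ h0₂
    hL₂ (a := ofCoef (hc 2) hσ hS hM0 (sinB 1 ω Θ)) (b := ofCoef (hc 1) hσ hS hM0 (cosB (1 * ω) ω Θ))
    (c := ofCoef (hc 0) hσ hS hM0 (sinB (-(1 * ω * ω)) ω Θ))
    (fun n t => by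
      simp only [wt_mul_ofCoef]
      exact (hasDerivAt_sinB 1 ω Θ t).const_mul (c n))
    (fun n t => by
      simp only [wt_mul_ofCoef]
      exact (hasDerivAt_cosB (1 * ω) ω Θ t).const_mul (c n))
  refine ⟨σ, hσ, δ₁, hδ₁, δ₂, hδ₂, hb', hl', hF₁a, hF₂a, ε₀, hε₀, C, hC, fun ε hε => ?_⟩
  obtain ⟨u, z, hz, hu, hz₁, hz₂, hu₁, hu₂, hder⟩ := hev ε hε
  have w2 := decays_wt hσ hS hM0 2
  have w1 := decays_wt hσ hS hM0 1
  have w0 := decays_wt hσ hS hM0 0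
  generalize ha : ofCoef (hc 2) hσ hS hM0 (sinB 1 ω Θ) = a at *
  generalize hb₀ : ofCoef (hc 1) hσ hS hM0 (cosB (1 * ω) ω Θ) = b₀ at *
  generalize hc₀ : ofCoef (hc 0) hσ hS hM0 (sinB (-(1 * ω * ω)) ω Θ) = c₀ at *
  have ea : ∀ t, ∀ x ∈ nhdI σ, _ := fun t x hx =>
    ha ▸ evD_ofCoef hσ hS hM0 (hc 2) (sinB 1 ω Θ) hΦ' hΦc t hx
  have eb : ∀ t, ∀ x ∈ nhdI σ, _ := fun t x hx =>
    hb₀ ▸ (evD_ofCoef hσ hS hM0 (hc 1) (cosB (1 * ω) ω Θ) hΦ' hΦc t hx).1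
  have ec : ∀ t, ∀ x ∈ nhdI σ, _ := fun t x hx =>
    hc₀ ▸ (evD_ofCoef hσ hS hM0 (hc 0) (sinB (-(1 * ω * ω)) ω Θ) hΦ' hΦc t hx).1
  simp only [sinB_apply, cosB_apply, one_mul] at ea eb ec
  have ez1 : ∀ j t, ∀ x ∈ nhdI σ, evD j (wt σ S M 2) t x z.1
      = ε * evD j (wt σ S M 2) t x a + evD j (wt σ S M 2) t x u.1 := fun j t x hx => by
    rw [hz, Prod.fst_add, Prod.smul_fst, evD_add w2 hσ j t hx, evD_smul]
  have ez2 : ∀ j t, ∀ x ∈ nhdI σ, evD j (wt σ S M 1) t x z.2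
      = ε * evD j (wt σ S M 1) t x b₀ + evD j (wt σ S M 1) t x u.2 := fun j t x hx => by
    rw [hz, Prod.snd_add, Prod.smul_snd, evD_add w1 hσ j t hx, evD_smul]
  have hY1 : ∀ p : ℝ × ℝ, p.2 ∈ nhdI σ → _ := fun p hp => (hY z p.1 p.2 hp).1
  have hY2 : ∀ p : ℝ × ℝ, p.2 ∈ nhdI σ → _ := fun p hp => (hY z p.1 p.2 hp).2
  have hzero : ∀ (w : Wt) (x : ℝ) (d : EllOne), (∀ n, d n 0 = 0) → evD 0 w 0 x d = 0 :=
    fun w x d hd => by simp [evD, hd]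
  refine ⟨jet (wt σ S M 2) (wt σ S M 1) z, jet (wt σ S M 1) (wt σ S M 0) (z.2 + 𝒩₁ (Y₁ z),
    ε • c₀ - 𝒩₂ (Y₂ z) - (freqSq σ S M u.1 + incl σ S M zero_le_one (R u.1))),
    fun j => (continuousOn_jet hσ w2 w1 z j).mono (prod_mono_left (subset_univ _)),
    fun j p hp => hasDerivAt_jet hσ w2 w1 z j p hp.2,
    fun j p hp => hasDerivAt_jet hσ w1 w0 _ j p hp.2,
    fun j p hp => (hasDerivAt_evD_time w2 hσ w1 (fun n t ht => (hder n t ht).1) j hp.1 hp.2).prodMk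
      (hasDerivAt_evD_time w1 hσ w0 (fun n t ht => (hder n t ht).2) j hp.1 hp.2),
    fun p hp => ⟨?_, ?_, ?_, ?_, ?_, ?_⟩⟩
  · rw [← hY1 p hp.2, pi_norm_lt_iff hδ₁]
    exact fun i => ((abs_ev_le (w1.evBound hσ hp.2) _).trans
      ((norm_le_pi_norm _ i).trans hz₁)).trans_lt hr₁δ
  · rw [← hY2 p hp.2, pi_norm_lt_iff hδ₂]
    exact fun i => ((abs_ev_le (w0.evBound hσ hp.2) _).trans
      ((norm_le_pi_norm _ i).trans hz₂)).trans_lt hr₂δ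
  · refine Prod.ext ?_ ?_
    · simp only [jet]
      rw [evD_add w1 hσ 0 _ hp.2, evD_zero _ _ _ (𝒩₁ _), he₁ _ hz₁ _ _ hp.2]
      exact congrArg _ (congrArg (F₁ p.2) (hY1 p hp.2))
    · have hev0 := w0.evBound hσ hp.2
      have e1 := congrArg (F₂ p.2) (hY2 p hp.2)
      rw [← he₂ _ hz₂ _ _ hp.2] at e1
      have e2 := heig' p.2 hp.2
      simp only [jet] at e1 ⊢
      rw [evD_zero, ev_sub hev0, ev_sub hev0, e1, hR _ _ _ hp.2, ev_smul hev0, ← evD_zero,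
        ec _ _ hp.2, ez1 0 _ _ hp.2, ez1 1 _ _ hp.2, ez1 2 _ _ hp.2, ellip_add,
        (ea p.1 p.2 hp.2).1, (ea p.1 p.2 hp.2).2.1, (ea p.1 p.2 hp.2).2.2]
      unfold ellip at e2 ⊢
      linear_combination (ε * Real.sin (ω * p.1 + Θ)) * e2
  · simp only [jet]
    rw [ez1 0 _ _ hp.2, ez2 0 _ _ hp.2, hzero _ _ _ hu₁, hzero _ _ _ hu₂, (ea _ _ hp.2).1,
      eb _ _ hp.2, mul_zero, zero_add, add_zero, add_zero]
  · simp only [jet]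
    rw [ez1 0 _ _ hp.2, (ea _ _ hp.2).1, add_sub_cancel_left, evD_zero]
    exact (abs_ev_le (w2.evBound hσ hp.2) _).trans ((norm_fst_le u).trans hu)
  · simp only [jet]
    rw [ez2 0 _ _ hp.2, eb _ _ hp.2, add_sub_cancel_left, evD_zero]
    exact (abs_ev_le (w1.evBound hσ hp.2) _).trans ((norm_snd_le u).trans hu)

open scoped ContDiff Manifold in
theorem exists_contDiff_eventuallyEq_nhdsSet {K Ω : Set (ℝ × ℝ)} (hK : IsClosed K) (hΩ : IsOpen Ω)
    (h : K ⊆ Ω) {f : ℝ × ℝ → ℝ} (hf : ContDiffOn ℝ ∞ f Ω) :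
    ∃ f' : ℝ × ℝ → ℝ, ContDiff ℝ ∞ f' ∧ ∀ᶠ p in nhdsSet K, f' p = f p := by
  obtain ⟨χ, h0, h1, -⟩ := exists_contMDiffMap_zero_one_nhds_of_isClosed (n := ⊤)
    𝓘(ℝ, ℝ × ℝ) (s := Ωᶜ) (t := K) hΩ.isClosed_compl hK (disjoint_compl_left_iff_subset.2 h)
  have hχ : ContDiff ℝ ∞ χ := χ.contMDiff.contDiff
  refine ⟨fun p => χ p * f p, contDiff_iff_contDiffAt.2 fun p => ?_, ?_⟩
  · by_cases hp : p ∈ Ω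
    · exact hχ.contDiffAt.mul (hf.contDiffAt (hΩ.mem_nhds hp))
    · refine (contDiffAt_const (c := (0 : ℝ))).congr_of_eventuallyEq ?_
      filter_upwards [(eventually_nhdsSet_iff_forall.1 h0) p hp] with q hq
      rw [hq, zero_mul]
  · filter_upwards [h1] with p hp
    rw [hp, one_mul]

theorem hasDerivAt_comp_mul_of_partial {f : ℝ × ℝ → ℝ} (hf : DifferentiableAt ℝ f (0, 0))
    (h₁ : deriv (fun v => f (v, 0)) 0 = 0) (h₂ : deriv (fun w => f (0, w)) 0 = 0) (α β : ℝ) :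
    HasDerivAt (fun s => f (α * s, β * s)) 0 0 := by
  obtain ⟨L, hL⟩ := hf
  have hid : HasDerivAt (fun s : ℝ => s) 1 0 := hasDerivAt_id 0
  have k : ∀ c d : ℝ, HasDerivAt (fun s => f (c * s, d * s)) (L (c * 1, d * 1)) 0 := fun c d =>
    HasFDerivAt.comp_hasDerivAt_of_eq (0 : ℝ) hL ((hid.const_mul c).prodMk (hid.const_mul d)) (by simp)
  have k1 := k 1 0
  have k2 := k 0 1
  simp only [one_mul, zero_mul] at k1 k2
  rw [k1.deriv] at h₁
  rw [k2.deriv] at h₂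
  refine (k α β).congr_deriv ?_
  have : ((α * 1, β * 1) : ℝ × ℝ) = α • ((1, 0) : ℝ × ℝ) + β • ((0, 1) : ℝ × ℝ) := by simp
  rw [this, map_add, map_smul, map_smul, h₁, h₂]
  simp

theorem contDiffAt_sysVec₁ {n : WithTop ℕ∞} (q : ℝ × (ℝ × ℝ) × (ℝ × ℝ) × (ℝ × ℝ)) :
    ContDiffAt ℝ n (fun p : ℝ × (ℝ × ℝ) × (ℝ × ℝ) × (ℝ × ℝ) => sysVec₁ p.1 p.2.1 p.2.2.1) q := by
  rw [contDiffAt_pi]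
  intro i
  fin_cases i <;> simp [sysVec₁] <;> fun_prop

theorem contDiffAt_ellip {n : WithTop ℕ∞} {b l : ℝ → ℝ} {q : ℝ × (ℝ × ℝ) × (ℝ × ℝ) × (ℝ × ℝ)}
    (hb : ContDiffAt ℝ n b q.1) (hl : ContDiffAt ℝ n l q.1) :
    ContDiffAt ℝ n (fun p : ℝ × (ℝ × ℝ) × (ℝ × ℝ) × (ℝ × ℝ) =>
      ellip b l p.1 p.2.1.1 p.2.2.1.1 p.2.2.2.1) q := by
  have hb' : ContDiffAt ℝ n (fun p : ℝ × (ℝ × ℝ) × (ℝ × ℝ) × (ℝ × ℝ) => b p.1) q :=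
    hb.comp q contDiffAt_fst
  have hl' : ContDiffAt ℝ n (fun p : ℝ × (ℝ × ℝ) × (ℝ × ℝ) × (ℝ × ℝ) => l p.1) q :=
    hl.comp q contDiffAt_fst
  unfold ellip
  fun_prop

theorem contDiffAt_sysVec₂ {n : WithTop ℕ∞} {b l : ℝ → ℝ} {q : ℝ × (ℝ × ℝ) × (ℝ × ℝ) × (ℝ × ℝ)}
    (hb : ContDiffAt ℝ n b q.1) (hl : ContDiffAt ℝ n l q.1) :
    ContDiffAt ℝ n (fun p : ℝ × (ℝ × ℝ) × (ℝ × ℝ) × (ℝ × ℝ) =>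
      sysVec₂ b l p.1 p.2.1 p.2.2.1 p.2.2.2) q := by
  have h := contDiffAt_ellip hb hl
  rw [contDiffAt_pi]
  intro i
  fin_cases i <;> simp [sysVec₂] <;> fun_prop

open scoped ContDiff in
theorem contDiffOn_of_system {σ : ℝ} {Ω : Set (ℝ × ℝ)} (hΩ : IsOpen Ω) (hΩσ : ∀ p ∈ Ω, p.2 ∈ nhdI σ)
    {b l : ℝ → ℝ} (hb : ∀ x ∈ nhdI σ, AnalyticAt ℝ b x) (hl : ∀ x ∈ nhdI σ, AnalyticAt ℝ l x)
    {F₁ F₂ : ℝ → (Fin 5 → ℝ) → ℝ} {δ₁ δ₂ : ℝ}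
    (hF₁ : ∀ x ∈ nhdI σ, ∀ Y : Fin 5 → ℝ, ‖Y‖ < δ₁ →
      AnalyticAt ℝ (fun p : ℝ × (Fin 5 → ℝ) => F₁ p.1 p.2) (x, Y))
    (hF₂ : ∀ x ∈ nhdI σ, ∀ Y : Fin 5 → ℝ, ‖Y‖ < δ₂ →
      AnalyticAt ℝ (fun p : ℝ × (Fin 5 → ℝ) => F₂ p.1 p.2) (x, Y))
    {u a : ℕ → ℝ × ℝ → ℝ × ℝ} (hc : ∀ j, ContinuousOn (u j) Ω)
    (hu : ∀ j, ∀ p ∈ Ω, HasDerivAt (fun x => u j (p.1, x)) (u (j + 1) p) p.2)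
    (ha : ∀ j, ∀ p ∈ Ω, HasDerivAt (fun x => a j (p.1, x)) (a (j + 1) p) p.2)
    (ht : ∀ j, ∀ p ∈ Ω, HasDerivAt (fun t => u j (t, p.2)) (a j p) p.1)
    (h₁ : ∀ p ∈ Ω, ‖sysVec₁ p.2 (u 0 p) (u 1 p)‖ < δ₁)
    (h₂ : ∀ p ∈ Ω, ‖sysVec₂ b l p.2 (u 0 p) (u 1 p) (u 2 p)‖ < δ₂)
    (hsys : ∀ p ∈ Ω, a 0 p = ((u 0 p).2 + F₁ p.2 (sysVec₁ p.2 (u 0 p) (u 1 p)),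
      -ellip b l p.2 (u 0 p).1 (u 1 p).1 (u 2 p).1
        - F₂ p.2 (sysVec₂ b l p.2 (u 0 p) (u 1 p) (u 2 p)))) :
    ContDiffOn ℝ ∞ (u 0) Ω := by
  set D : Set (ℝ × (ℝ × ℝ) × (ℝ × ℝ) × (ℝ × ℝ)) := {p | p.1 ∈ nhdI σ} with hD
  have hDo : IsOpen D := (isOpen_nhdI σ).preimage continuous_fst
  have hs₂ : ∀ q ∈ D, ContDiffAt ℝ ∞ (fun p : ℝ × (ℝ × ℝ) × (ℝ × ℝ) × (ℝ × ℝ) =>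
      sysVec₂ b l p.1 p.2.1 p.2.2.1 p.2.2.2) q := fun q hq =>
    contDiffAt_sysVec₂ (hb _ hq).contDiffAt (hl _ hq).contDiffAt
  have hW₁ : IsOpen {p : ℝ × (ℝ × ℝ) × (ℝ × ℝ) × (ℝ × ℝ) | ‖sysVec₁ p.1 p.2.1 p.2.2.1‖ < δ₁} :=
    isOpen_lt (continuous_iff_continuousAt.2 fun q =>
      (contDiffAt_sysVec₁ (n := 0) q).continuousAt.norm) continuous_const
  have hW₂ : IsOpen (D ∩ (fun p : ℝ × (ℝ × ℝ) × (ℝ × ℝ) × (ℝ × ℝ) =>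
      sysVec₂ b l p.1 p.2.1 p.2.2.1 p.2.2.2) ⁻¹' Metric.ball 0 δ₂) :=
    ContinuousOn.isOpen_inter_preimage (fun q hq => (hs₂ q hq).continuousAt.continuousWithinAt) hDo
      Metric.isOpen_ball
  refine contDiffOn_of_evolution hΩ hc hu ha ht (hW₂.inter hW₁)
    (G := fun p => (p.2.1.2 + F₁ p.1 (sysVec₁ p.1 p.2.1 p.2.2.1),
      -ellip b l p.1 p.2.1.1 p.2.2.1.1 p.2.2.2.1 - F₂ p.1 (sysVec₂ b l p.1 p.2.1 p.2.2.1 p.2.2.2)))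
    (fun q hq => ContDiffAt.contDiffWithinAt ?_)
    (fun p hp => ⟨⟨hΩσ p hp, mem_ball_zero_iff.2 (h₂ p hp)⟩, h₁ p hp⟩) hsys 0
  obtain ⟨⟨hq, hq₂⟩, hq₁⟩ := hq
  have e₁ := ContDiffAt.comp q (hF₁ q.1 hq _ hq₁).contDiffAt
    (contDiffAt_fst.prodMk (contDiffAt_sysVec₁ (n := ∞) q))
  have e₂ := ContDiffAt.comp q (hF₂ q.1 hq _ (mem_ball_zero_iff.1 hq₂)).contDiffAt
    (contDiffAt_fst.prodMk (hs₂ q hq))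
  have e₃ := contDiffAt_ellip (n := ∞) (q := q) (hb _ hq).contDiffAt (hl _ hq).contDiffAt
  have e₄ : ContDiffAt ℝ ∞ (fun p : ℝ × (ℝ × ℝ) × (ℝ × ℝ) × (ℝ × ℝ) => p.2.1.2) q := by fun_prop
  exact (e₄.add e₁).prodMk (e₃.neg.sub e₂)

/-- The nonlinear part of the first equation for the unknowns `y` and `v / g`. -/
noncomputable def nonlin₁ (J : ℝ → ℝ → ℝ → ℝ) (x : ℝ) (Y : Fin 5 → ℝ) : ℝ :=
  (J x (Y 0) (Y 1) * (J x 0 0)⁻¹ - 1) * Y 2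

/-- The nonlinear part of the second equation for the unknowns `y` and `v / g`. -/
noncomputable def nonlin₂ (J : ℝ → ℝ → ℝ → ℝ) (H₁ : ℝ → ℝ → ℝ → ℝ → ℝ)
    (H₂ : ℝ → ℝ → ℝ → ℝ → ℝ → ℝ) (x : ℝ) (Y : Fin 5 → ℝ) : ℝ :=
  (J x 0 0 * H₁ x (Y 0) (Y 1) ((J x 0 0)⁻¹ * Y 2) - 1) * Y 4
    + J x 0 0 * H₂ x (Y 0) (Y 1) ((J x 0 0)⁻¹ * Y 2)
      (x * deriv (fun x => (J x 0 0)⁻¹) x * Y 2 + (J x 0 0)⁻¹ * Y 3)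

section nonlin

variable {J : ℝ → ℝ → ℝ → ℝ} {H₁ : ℝ → ℝ → ℝ → ℝ → ℝ} {H₂ : ℝ → ℝ → ℝ → ℝ → ℝ → ℝ} {x : ℝ}

theorem analyticAt_coord (q : ℝ × (Fin 5 → ℝ)) (i : Fin 5) :
    AnalyticAt ℝ (fun p : ℝ × (Fin 5 → ℝ) => p.2 i) q :=
  ((ContinuousLinearMap.proj i : (Fin 5 → ℝ) →L[ℝ] ℝ).comp
    (ContinuousLinearMap.snd ℝ ℝ (Fin 5 → ℝ))).analyticAt q

theorem analyticAt_at_zero (hJ : AnalyticAt ℝ (fun p : ℝ × ℝ × ℝ => J p.1 p.2.1 p.2.2) (x, 0, 0)) :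
    AnalyticAt ℝ (fun x => J x 0 0) x :=
  hJ.comp_of_eq (f := fun x : ℝ => (x, (0 : ℝ), (0 : ℝ)))
    (analyticAt_id.prod (analyticAt_const.prod analyticAt_const)) rfl

theorem analyticAt_nonlin₁
    (hJ : AnalyticAt ℝ (fun p : ℝ × ℝ × ℝ => J p.1 p.2.1 p.2.2) (x, 0, 0)) (hx : J x 0 0 ≠ 0) :
    AnalyticAt ℝ (fun p : ℝ × (Fin 5 → ℝ) => nonlin₁ J p.1 p.2) (x, 0) := by
  have hY := analyticAt_coord (x, 0)
  have h1 : AnalyticAt ℝ (fun p : ℝ × (Fin 5 → ℝ) => J p.1 (p.2 0) (p.2 1)) (x, 0) :=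
    hJ.comp_of_eq (f := fun p : ℝ × (Fin 5 → ℝ) => (p.1, p.2 0, p.2 1))
      (analyticAt_fst.prod ((hY 0).prod (hY 1))) rfl
  have h2 : AnalyticAt ℝ (fun p : ℝ × (Fin 5 → ℝ) => (J p.1 0 0)⁻¹) (x, 0) :=
    ((analyticAt_at_zero hJ).fun_inv hx).comp_of_eq
      (f := fun p : ℝ × (Fin 5 → ℝ) => p.1) analyticAt_fst rfl
  exact ((h1.mul h2).sub analyticAt_const).mul (hY 2)

theorem nonlin₁_zero : nonlin₁ J x 0 = 0 := by simp [nonlin₁]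

theorem deriv_nonlin₁ (hx : J x 0 0 ≠ 0) (i : Fin 5) :
    deriv (fun s => nonlin₁ J x (Pi.single i s)) 0 = 0 := by
  have h : (fun s => nonlin₁ J x (Pi.single i s)) = fun _ => 0 := by
    funext s
    fin_cases i <;> simp [nonlin₁, hx]
  rw [h, deriv_const]

theorem analyticAt_nonlin₂
    (hJ : AnalyticAt ℝ (fun p : ℝ × ℝ × ℝ => J p.1 p.2.1 p.2.2) (x, 0, 0)) (hx : J x 0 0 ≠ 0)
    (hH₁ : AnalyticAt ℝ (fun p : ℝ × ℝ × ℝ × ℝ => H₁ p.1 p.2.1 p.2.2.1 p.2.2.2) (x, 0, 0, 0))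
    (hH₂ : AnalyticAt ℝ (fun p : ℝ × ℝ × ℝ × ℝ × ℝ => H₂ p.1 p.2.1 p.2.2.1 p.2.2.2.1 p.2.2.2.2)
      (x, 0, 0, 0, 0)) :
    AnalyticAt ℝ (fun p : ℝ × (Fin 5 → ℝ) => nonlin₂ J H₁ H₂ p.1 p.2) (x, 0) := by
  have hY := analyticAt_coord (x, 0)
  have hf : AnalyticAt ℝ (fun p : ℝ × (Fin 5 → ℝ) => p.1) (x, 0) := analyticAt_fst
  have hJ0 := analyticAt_at_zero hJ
  have h0 : AnalyticAt ℝ (fun p : ℝ × (Fin 5 → ℝ) => J p.1 0 0) (x, 0) := hJ0.comp_of_eq hf rfl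
  have h2 : AnalyticAt ℝ (fun p : ℝ × (Fin 5 → ℝ) => (J p.1 0 0)⁻¹) (x, 0) := h0.fun_inv hx
  have h3 : AnalyticAt ℝ
      (fun p : ℝ × (Fin 5 → ℝ) => deriv (fun x => (J x 0 0)⁻¹) p.1) (x, 0) :=
    (hJ0.fun_inv hx).deriv.comp_of_eq hf rfl
  have h4 := h2.mul (hY 2)
  have h5 := ((hf.mul h3).mul (hY 2)).add (h2.mul (hY 3))
  have k1 := hH₁.comp_of_eq (hf.prod ((hY 0).prod ((hY 1).prod h4))) (by simp)
  have k2 := hH₂.comp_of_eq (hf.prod ((hY 0).prod ((hY 1).prod (h4.prod h5)))) (by simp)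
  exact (((h0.mul k1).sub analyticAt_const).mul (hY 4)).add (h0.mul k2)

theorem nonlin₂_zero (h : H₂ x 0 0 0 0 = 0) : nonlin₂ J H₁ H₂ x 0 = 0 := by
  simp [nonlin₂, h]

theorem deriv_nonlin₂ (hx : J x 0 0 ≠ 0) (hH₁ : H₁ x 0 0 0 = (J x 0 0)⁻¹)
    (hH₂ : AnalyticAt ℝ (fun p : ℝ × ℝ × ℝ × ℝ × ℝ => H₂ p.1 p.2.1 p.2.2.1 p.2.2.2.1 p.2.2.2.2)
      (x, 0, 0, 0, 0)) (h0 : H₂ x 0 0 0 0 = 0)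
    (hy : deriv (fun y => H₂ x y 0 0 0) 0 = 0) (hz : deriv (fun z => H₂ x 0 z 0 0) 0 = 0)
    (hv : deriv (fun v => H₂ x 0 0 v 0) 0 = 0) (hw : deriv (fun w => H₂ x 0 0 0 w) 0 = 0)
    (i : Fin 5) : deriv (fun s => nonlin₂ J H₁ H₂ x (Pi.single i s)) 0 = 0 := by
  have hd : DifferentiableAt ℝ (fun p : ℝ × ℝ => H₂ x 0 0 p.1 p.2) (0, 0) :=
    (hH₂.comp_of_eq (f := fun p : ℝ × ℝ => (x, (0 : ℝ), (0 : ℝ), p.1, p.2))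
      (analyticAt_const.prod (analyticAt_const.prod (analyticAt_const.prod analyticAt_id)))
      rfl).differentiableAt
  have key := fun α β => (hasDerivAt_comp_mul_of_partial hd hv hw α β).deriv
  fin_cases i
  · simp [nonlin₂, hy]
  · simp [nonlin₂, hz]
  · simp [nonlin₂, key]
  · have k := key 0 (J x 0 0)⁻¹
    simp only [zero_mul] at k
    simp [nonlin₂, k]
  · simp [nonlin₂, h0, hH₁, hx]

end nonlin

/-- The first order coefficient of `opL` in the normalization used for `ellip`. -/
noncomputable def drift (N : ℝ) (ℓ₁ : ℝ → ℝ) (x : ℝ) : ℝ :=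
  (1 / 2) * (1 - 2 * x) - ((5 / 2) * (1 - x) - (N / 2) * x) + ℓ₁ x * (x * (1 - x))

theorem opL_eq_ellip (N : ℝ) (ℓ₁ L₀ y : ℝ → ℝ) (x : ℝ) :
    opL N ℓ₁ L₀ y x = ellip (drift N ℓ₁) L₀ x (y x) (deriv y x) (deriv (deriv y) x) := by
  unfold opL ellip drift; ring

theorem deriv_time_slice_eq {f' f : ℝ × ℝ → ℝ} {c : ℝ} {p : ℝ × ℝ} (h : f' =ᶠ[nhds p] f)
    (ht : HasDerivAt (fun t => f (t, p.2)) c p.1) : deriv (fun t => f' (t, p.2)) p.1 = c :=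
  (ht.congr_of_eventuallyEq
    (((by fun_prop : Continuous fun t : ℝ => (t, p.2)).tendsto p.1).eventually h)).deriv

theorem deriv_space_slice_eq {f' f : ℝ × ℝ → ℝ} {c : ℝ} {p : ℝ × ℝ} (h : f' =ᶠ[nhds p] f)
    (hx : HasDerivAt (fun x => f (p.1, x)) c p.2) : deriv (fun x => f' (p.1, x)) p.2 = c :=
  (hx.congr_of_eventuallyEq
    (((by fun_prop : Continuous fun x : ℝ => (p.1, x)).tendsto p.2).eventually h)).deriv

theorem deriv_deriv_slice_eq {f' f fx fxx : ℝ × ℝ → ℝ} {Ω : Set (ℝ × ℝ)} (hΩ : IsOpen Ω) {p : ℝ × ℝ}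
    (hp : p ∈ Ω) (h : f' =ᶠ[nhds p] f)
    (hx : ∀ q ∈ Ω, HasDerivAt (fun x => f (q.1, x)) (fx q) q.2)
    (hxx : HasDerivAt (fun x => fx (p.1, x)) (fxx p) p.2) :
    deriv (deriv fun x => f' (p.1, x)) p.2 = fxx p := by
  have key : ∀ᶠ q in nhds p, deriv (fun x => f' (q.1, x)) q.2 = fx q := by
    filter_upwards [h.eventually_nhds, hΩ.mem_nhds hp] with q hq hqΩ
    exact deriv_space_slice_eq hq (hx q hqΩ)
  exact (hxx.congr_of_eventuallyEq
    (((by fun_prop : Continuous fun x : ℝ => (p.1, x)).tendsto p.2).eventually key)).deriv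

/-- (Corollary 1.)  Under (B0)–(B3) and (B4) (`N/2` a positive integer), for any positive
eigenvalue `λ` of `𝓛` with analytic eigenfunction `Φ`, the time periodic linearized solution
`(Y₁, V₁)` generates, for every `T > 0` and all sufficiently small `ε`, a genuine solution
`(y, v) = (εY₁ + O(ε²), εV₁ + O(ε²))` on `[0,T]×[0,1]`. -/
theorem corollary1
    -- (B0)
    (N : ℝ) (hN : 4 < N)
    (ℓ₁ L₀ : ℝ → ℝ)
    (hℓ₁ : AnalyticOnNhd ℝ ℓ₁ (Icc 0 1))
    (hL₀ : AnalyticOnNhd ℝ L₀ (Icc 0 1))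
    (U : Set ℝ) (hUopen : IsOpen U) (hU0 : (0:ℝ) ∈ U)
    (J : ℝ → ℝ → ℝ → ℝ) (H₁ : ℝ → ℝ → ℝ → ℝ → ℝ) (H₂ : ℝ → ℝ → ℝ → ℝ → ℝ → ℝ)
    -- (B1)
    (hJ : AnalyticOnNhd ℝ (fun p : ℝ × ℝ × ℝ => J p.1 p.2.1 p.2.2)
      (Icc 0 1 ×ˢ closure U ×ˢ closure U))
    (hH₁ : AnalyticOnNhd ℝ (fun p : ℝ × ℝ × ℝ × ℝ => H₁ p.1 p.2.1 p.2.2.1 p.2.2.2)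
      (Icc 0 1 ×ˢ closure U ×ˢ closure U ×ˢ closure U))
    (hH₂ : AnalyticOnNhd ℝ
      (fun p : ℝ × ℝ × ℝ × ℝ × ℝ => H₂ p.1 p.2.1 p.2.2.1 p.2.2.2.1 p.2.2.2.2)
      (Icc 0 1 ×ˢ closure U ×ˢ closure U ×ˢ closure U ×ˢ closure U))
    (hH₂0 : ∀ x ∈ Icc (0:ℝ) 1, H₂ x 0 0 0 0 = 0)
    (hH₂y : ∀ x ∈ Icc (0:ℝ) 1, deriv (fun y => H₂ x y 0 0 0) 0 = 0)
    (hH₂z : ∀ x ∈ Icc (0:ℝ) 1, deriv (fun z => H₂ x 0 z 0 0) 0 = 0)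
    (hH₂v : ∀ x ∈ Icc (0:ℝ) 1, deriv (fun v => H₂ x 0 0 v 0) 0 = 0)
    (hH₂w : ∀ x ∈ Icc (0:ℝ) 1, deriv (fun w => H₂ x 0 0 0 w) 0 = 0)
    -- (B2)
    (hB2 : ∀ x ∈ Icc (0:ℝ) 1, H₁ x 0 0 0 = (J x 0 0)⁻¹)
    (C₀ : ℝ) (hC₀ : 1 < C₀)
    (hJlow : ∀ x ∈ Icc (0:ℝ) 1, 1 / C₀ < J x 0 0)
    (hJhigh : ∀ x ∈ Icc (0:ℝ) 1, J x 0 0 < C₀)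
    -- (B3)
    (hB3J : ∃ Ω : ℝ × ℝ × ℝ → ℝ, AnalyticAt ℝ Ω ((1,0,0) : ℝ × ℝ × ℝ) ∧
      ∀ᶠ p : ℝ × ℝ × ℝ in nhds ((1,0,0) : ℝ × ℝ × ℝ),
        deriv (fun z => J p.1 p.2.1 z) p.2.2 = (1 - p.1) * Ω p)
    (hB3H : ∃ Ω : ℝ × ℝ × ℝ × ℝ × ℝ × ℝ → ℝ,
      AnalyticAt ℝ Ω ((1,0,0,0,0,0) : ℝ × ℝ × ℝ × ℝ × ℝ × ℝ) ∧
      ∀ᶠ p : ℝ × ℝ × ℝ × ℝ × ℝ × ℝ in nhds ((1,0,0,0,0,0) : ℝ × ℝ × ℝ × ℝ × ℝ × ℝ),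
        deriv (fun z => H₁ p.1 p.2.1 z p.2.2.2.2.1) (p.1 * p.2.2.1)
            * Lfun N ℓ₁ L₀ p.1 p.2.1 p.2.2.1 p.2.2.2.1
          + deriv (fun z => H₂ p.1 p.2.1 z p.2.2.2.2.1 (p.1 * p.2.2.2.2.2)) (p.1 * p.2.2.1)
          = (1 - p.1) * Ω p)
    (hB3W : ∃ Ω : ℝ × ℝ × ℝ × ℝ × ℝ → ℝ,
      AnalyticAt ℝ Ω ((1,0,0,0,0) : ℝ × ℝ × ℝ × ℝ × ℝ) ∧
      ∀ᶠ p : ℝ × ℝ × ℝ × ℝ × ℝ in nhds ((1,0,0,0,0) : ℝ × ℝ × ℝ × ℝ × ℝ),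
        deriv (fun w => H₂ p.1 p.2.1 p.2.2.1 p.2.2.2.1 w) p.2.2.2.2 = (1 - p.1) * Ω p)
    -- (B4)
    (hB4 : ∃ m : ℕ, 0 < m ∧ N = 2 * m)
    -- the eigenvalue and eigenfunction
    (lam : ℝ) (hlam : 0 < lam)
    (Φ : ℝ → ℝ) (hΦ : AnalyticOnNhd ℝ Φ (Icc 0 1))
    (heig : ∀ x ∈ Icc (0:ℝ) 1, opL N ℓ₁ L₀ Φ x = lam * Φ x)
    (Θ₀ : ℝ) (Y₁ V₁ : ℝ → ℝ → ℝ)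
    (hY₁ : ∀ t x, Y₁ t x = Real.sin (Real.sqrt lam * t + Θ₀) * Φ x)
    (hV₁ : ∀ t x, V₁ t x = (Real.sqrt lam / J x 0 0) * Real.cos (Real.sqrt lam * t + Θ₀) * Φ x)
    (T : ℝ) (hT : 0 < T) :
    ∃ ε₀ > (0:ℝ), ∃ C > (0:ℝ), ∀ ε : ℝ, |ε| ≤ ε₀ →
      ∃ y v : ℝ → ℝ → ℝ,
        ContDiff ℝ (⊤ : ℕ∞) (Function.uncurry y) ∧
        ContDiff ℝ (⊤ : ℕ∞) (Function.uncurry v) ∧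
        (∀ t ∈ Icc (0:ℝ) T, ∀ x ∈ Icc (0:ℝ) 1,
          deriv (fun s => y s x) t
            - J x (y t x) (x * deriv (y t) x) * v t x = 0 ∧
          deriv (fun s => v s x) t
            + H₁ x (y t x) (x * deriv (y t) x) (v t x) * opL N ℓ₁ L₀ (y t) x
            + H₂ x (y t x) (x * deriv (y t) x) (v t x) (x * deriv (v t) x) = 0) ∧
        (∀ x ∈ Icc (0:ℝ) 1, y 0 x = ε * Y₁ 0 x ∧ v 0 x = ε * V₁ 0 x) ∧
        (∀ t ∈ Icc (0:ℝ) T, ∀ x ∈ Icc (0:ℝ) 1,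
          |y t x - ε * Y₁ t x| ≤ C * ε ^ 2 ∧ |v t x - ε * V₁ t x| ≤ C * ε ^ 2) := by
  have hcl : (0 : ℝ) ∈ closure U := subset_closure hU0
  have hJpos : ∀ x ∈ Icc (0 : ℝ) 1, 0 < J x 0 0 := fun x hx =>
    (by positivity : (0 : ℝ) < 1 / C₀).trans (hJlow x hx)
  have aJ : ∀ x ∈ Icc (0 : ℝ) 1,
      AnalyticAt ℝ (fun p : ℝ × ℝ × ℝ => J p.1 p.2.1 p.2.2) (x, 0, 0) :=
    fun x hx => hJ _ ⟨hx, hcl, hcl⟩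
  have aH₁ : ∀ x ∈ Icc (0 : ℝ) 1,
      AnalyticAt ℝ (fun p : ℝ × ℝ × ℝ × ℝ => H₁ p.1 p.2.1 p.2.2.1 p.2.2.2) (x, 0, 0, 0) :=
    fun x hx => hH₁ _ ⟨hx, hcl, hcl, hcl⟩
  have aH₂ : ∀ x ∈ Icc (0 : ℝ) 1, AnalyticAt ℝ
      (fun p : ℝ × ℝ × ℝ × ℝ × ℝ => H₂ p.1 p.2.1 p.2.2.1 p.2.2.2.1 p.2.2.2.2) (x, 0, 0, 0, 0) :=
    fun x hx => hH₂ _ ⟨hx, hcl, hcl, hcl, hcl⟩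
  set g : ℝ → ℝ := fun x => (J x 0 0)⁻¹ with hg
  have ag : ∀ x ∈ Icc (0 : ℝ) 1, AnalyticAt ℝ g x := fun x hx =>
    (analyticAt_at_zero (aJ x hx)).fun_inv (hJpos x hx).ne'
  have hdrift : AnalyticOnNhd ℝ (drift N ℓ₁) (Icc 0 1) := fun x hx => by
    have := hℓ₁ x hx
    unfold drift
    fun_prop
  obtain ⟨σ, hσ, δ₁, hδ₁, δ₂, hδ₂, hb, hl, hF₁, hF₂, ε₀, hε₀, C, hC, hsol⟩ :=
    exists_analytic_evolution (F₁ := nonlin₁ J) (F₂ := nonlin₂ J H₁ H₂)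
      (fun x hx => analyticAt_nonlin₁ (aJ x hx) (hJpos x hx).ne') (fun x _ => nonlin₁_zero)
      (fun x hx i => deriv_nonlin₁ (hJpos x hx).ne' i)
      (fun x hx => analyticAt_nonlin₂ (aJ x hx) (hJpos x hx).ne' (aH₁ x hx) (aH₂ x hx))
      (fun x hx => nonlin₂_zero (hH₂0 x hx))
      (fun x hx i => deriv_nonlin₂ (hJpos x hx).ne' (hB2 x hx) (aH₂ x hx) (hH₂0 x hx) (hH₂y x hx)
        (hH₂z x hx) (hH₂v x hx) (hH₂w x hx) i)
      hdrift hL₀ hΦ (Real.sqrt lam) Θ₀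
      (fun x hx => by rw [← opL_eq_ellip, heig x hx, Real.sq_sqrt hlam.le])
      (S := T + 1) (by linarith)
  refine ⟨ε₀, hε₀, C * C₀, by positivity, fun ε hε => ?_⟩
  obtain ⟨u, a, hc, hu, ha, ht, hrest⟩ := hsol ε hε
  set Ω := Ioo (-(T + 1)) (T + 1) ×ˢ nhdI σ with hΩdef
  have hΩ : IsOpen Ω := isOpen_Ioo.prod (isOpen_nhdI σ)
  set K : Set (ℝ × ℝ) := Icc 0 T ×ˢ Icc 0 1 with hKdef
  have hK : IsClosed K := isClosed_Icc.prod isClosed_Icc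
  have hKΩ : K ⊆ Ω := prod_mono (fun t ht => ⟨by linarith [ht.1], by linarith [ht.2]⟩)
    (Icc_subset_nhdI hσ)
  have hsm : ContDiffOn ℝ (⊤ : ℕ∞) (u 0) Ω := contDiffOn_of_system hΩ (fun p hp => hp.2) hb hl hF₁ hF₂
    hc hu ha ht (fun p hp => (hrest p hp).1) (fun p hp => (hrest p hp).2.1)
    (fun p hp => (hrest p hp).2.2.1)
  set Ω' := Ω ∩ {p | AnalyticAt ℝ g p.2} with hΩ'def
  have hΩ' : IsOpen Ω' := hΩ.inter ((isOpen_analyticAt ℝ g).preimage continuous_snd)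
  have hKΩ' : K ⊆ Ω' := fun p hp => ⟨hKΩ hp, ag _ hp.2⟩
  have hgsm : ContDiffOn ℝ (⊤ : ℕ∞) (fun p : ℝ × ℝ => g p.2 * (u 0 p).2) Ω' := fun p hp =>
    ((ContDiffAt.comp p hp.2.contDiffAt contDiffAt_snd).contDiffWithinAt).mul
      ((hsm.mono inter_subset_left).snd p hp)
  obtain ⟨y, hy, hyu⟩ := exists_contDiff_eventuallyEq_nhdsSet hK hΩ hKΩ hsm.fst
  obtain ⟨v, hv, hvu⟩ := exists_contDiff_eventuallyEq_nhdsSet hK hΩ' hKΩ' hgsm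
  have hyp : ∀ p ∈ K, y =ᶠ[nhds p] fun q => (u 0 q).1 := fun p hp =>
    eventually_nhdsSet_iff_forall.1 hyu p hp
  have hvp : ∀ p ∈ K, v =ᶠ[nhds p] fun q => g q.2 * (u 0 q).2 := fun p hp =>
    eventually_nhdsSet_iff_forall.1 hvu p hp
  refine ⟨fun t x => y (t, x), fun t x => v (t, x), hy, hv, fun t htt x hx => ?_, fun x hx => ?_,
    fun t htt x hx => ?_⟩
  · have hp : (t, x) ∈ K := ⟨htt, hx⟩
    have hpΩ := hKΩ hp
    have hJ0 := (hJpos x hx).ne'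
    obtain ⟨-, -, hsys, -⟩ := hrest _ hpΩ
    have d1 : deriv (fun s => y (s, x)) t = (a 0 (t, x)).1 :=
      deriv_time_slice_eq (hyp _ hp) (ht 0 _ hpΩ).fst
    have d2 : deriv (fun x => y (t, x)) x = (u 1 (t, x)).1 :=
      deriv_space_slice_eq (hyp _ hp) (hu 0 _ hpΩ).fst
    have d3 : deriv (deriv fun x => y (t, x)) x = (u 2 (t, x)).1 :=
      deriv_deriv_slice_eq (fx := fun q => (u 1 q).1) (fxx := fun q => (u 2 q).1) hΩ hpΩ (hyp _ hp)
        (fun q hq => (hu 0 q hq).fst) (hu 1 _ hpΩ).fst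
    have d4 : deriv (fun s => v (s, x)) t = g x * (a 0 (t, x)).2 :=
      deriv_time_slice_eq (hvp _ hp) (HasDerivAt.const_mul (g x)
        (show HasDerivAt (fun s => (u 0 (s, x)).2) (a 0 (t, x)).2 t from (ht 0 _ hpΩ).snd))
    have d5 : deriv (fun x => v (t, x)) x
        = deriv g x * (u 0 (t, x)).2 + g x * (u 1 (t, x)).2 :=
      deriv_space_slice_eq (hvp _ hp)
        ((ag x hx).differentiableAt.hasDerivAt.mul (hu 0 _ hpΩ).snd)
    have hyv : y (t, x) = (u 0 (t, x)).1 := (hyp _ hp).self_of_nhds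
    have hvv : v (t, x) = g x * (u 0 (t, x)).2 := (hvp _ hp).self_of_nhds
    have hgJ : g x * J x 0 0 = 1 := inv_mul_cancel₀ hJ0
    rw [opL_eq_ellip]
    dsimp only
    rw [d1, d2, d3, d4, d5, hyv, hvv, hsys]
    have hw : x * (deriv g x * (u 0 (t, x)).2 + g x * (u 1 (t, x)).2)
        = x * deriv g x * (u 0 (t, x)).2 + g x * (x * (u 1 (t, x)).2) := by ring
    rw [hw]
    constructor
    · simp only [nonlin₁, sysVec₁, hg]
      simp
      ring
    · simp only [nonlin₂, sysVec₂]
      simp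
      generalize ellip _ _ _ _ _ _ = e
      generalize H₁ x _ _ _ = h
      generalize H₂ x _ _ _ _ = k
      linear_combination (-(h * e) - k) * hgJ
  · have hp : ((0 : ℝ), x) ∈ K := ⟨⟨le_rfl, hT.le⟩, hx⟩
    obtain ⟨-, -, -, hinit, -⟩ := hrest _ (hKΩ hp)
    dsimp only at hinit
    have hyv : y (0, x) = (u 0 (0, x)).1 := (hyp _ hp).self_of_nhds
    have hvv : v (0, x) = g x * (u 0 (0, x)).2 := (hvp _ hp).self_of_nhds
    dsimp only
    rw [hyv, hvv, hinit, hY₁, hV₁, mul_zero, zero_add]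
    exact ⟨rfl, by simp only [hg]; ring⟩
  · have hp : (t, x) ∈ K := ⟨htt, hx⟩
    obtain ⟨-, -, -, -, hb₁, hb₂⟩ := hrest _ (hKΩ hp)
    have hε2 : 0 ≤ C * ε ^ 2 := by positivity
    have hgC : |g x| ≤ C₀ := by
      rw [abs_of_pos (inv_pos.2 (hJpos x hx))]
      have := hJlow x hx
      rw [one_div] at this
      exact (inv_lt_of_inv_lt₀ (by linarith) this).le
    have hyv : y (t, x) = (u 0 (t, x)).1 := (hyp _ hp).self_of_nhds
    have hvv : v (t, x) = g x * (u 0 (t, x)).2 := (hvp _ hp).self_of_nhds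
    dsimp only
    rw [hyv, hvv, hY₁, hV₁]
    refine ⟨hb₁.trans ?_, ?_⟩
    · have := mul_le_mul_of_nonneg_left hC₀.le hε2
      linarith
    · rw [show g x * (u 0 (t, x)).2
          - ε * (Real.sqrt lam / J x 0 0 * Real.cos (Real.sqrt lam * t + Θ₀) * Φ x)
        = g x * ((u 0 (t, x)).2 - ε * (Real.sqrt lam * Real.cos (Real.sqrt lam * t + Θ₀) * Φ x)) by
          simp only [hg]; ring, abs_mul]
      refine (mul_le_mul hgC hb₂ (abs_nonneg _) (by linarith)).trans (le_of_eq ?_)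
      ring
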